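/- arXiv:0907.4517 — 8 statements merged into one kernel-verified Lean document; each statement's English description precedes it below -/
import Mathlib

section
/- Given a datum for a quantum linear space, if i, j, l are three pairwise distinct indices in {1,…,θ} such that g_i = g_j = g_l, then q_l^2 = 1; consequently (since q_l ≠ 1) q_l = −1 and the order N_l of q_l equals 2. -/
/-- Given a datum for a quantum linear space
(elements `g i` of a finite abelian group `Γ` and characters `χ i : Γ →* kˣ`
with `q i := χ i (g i) ≠ 1` and `χ i (g j) * χ j (g i) = 1` for `i ≠ j`),
if `i, j, l` are pairwise distinct indices with `g i = g j = g l`, then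
`q l ^ 2 = 1`; consequently `q l = -1` and the order `N l` of `q l` equals `2`. -/
theorem quantum_linear_space_three_equal_grouplikes
    (k : Type*) [Field k] [IsAlgClosed k] [CharZero k]
    (Γ : Type*) [CommGroup Γ] [Fintype Γ]
    (θ : ℕ) (g : Fin θ → Γ) (χ : Fin θ → (Γ →* kˣ))
    (hq : ∀ i, χ i (g i) ≠ 1)
    (hcompat : ∀ i j, i ≠ j → χ i (g j) * χ j (g i) = 1)
    (i j l : Fin θ) (hij : i ≠ j) (hil : i ≠ l) (hjl : j ≠ l)
    (hgij : g i = g j) (hgjl : g j = g l) :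
    (χ l (g l)) ^ 2 = 1 ∧ χ l (g l) = -1 ∧ orderOf (χ l (g l)) = 2 := by
  have h1 := hcompat i j hij
  have h2 := hcompat i l hil
  have h3 := hcompat j l hjl
  have hl := hq l
  rw [hgij, hgjl] at h1 h2
  rw [hgjl] at h3
  generalize χ l (g l) = c at *
  generalize χ i (g l) = a at *
  generalize χ j (g l) = b at *
  have hsq : c ^ 2 = 1 := by
    calc c ^ 2 = (a * b) * c ^ 2 := by rw [h1, one_mul]
      _ = (a * c) * (b * c) := by rw [pow_two, mul_mul_mul_comm]
      _ = 1 := by rw [h2, h3, one_mul]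
  refine ⟨hsq, ?_, orderOf_eq_prime hsq hl⟩
  have h : (c : k) ^ 2 = 1 := by rw [← Units.val_pow_eq_pow_val, hsq, Units.val_one]
  rcases eq_or_eq_neg_of_sq_eq_sq (c : k) 1 (by rw [h, one_pow]) with h | h
  · exact absurd (Units.ext h) hl
  · exact Units.ext (by simpa using h)
end

section
/- Given a datum for a quantum linear space, let i, j, l, m ∈ {1,…,θ} satisfy i ≠ j, l ≠ m and j ≠ l. If g_i = g_l and g_j = g_m, then q_{ij} = q_{lm}, i.e. χ_j(g_i) = χ_m(g_l). (Hence for g, h ∈ Γ there is a scalar q_{h,g} ∈ k, depending only on g and h, such that χ_j(g_i) = q_{h,g} whenever g_i = g and g_j = h with i ≠ j.) -/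
/-- Given a datum for a quantum linear space, if `i ≠ j`, `l ≠ m`,
`j ≠ l`, `g i = g l` and `g j = g m`, then `q_{ij} = q_{lm}`, i.e.
`χ j (g i) = χ m (g l)`.  (Hence for `g, h ∈ Γ` there is a scalar `q_{h,g}`
depending only on `g` and `h` with `χ j (g i) = q_{h,g}` whenever
`g i = g`, `g j = h`, `i ≠ j`.) -/
theorem quantum_linear_space_qij_depends_only_on_grouplikes
    (k : Type*) [Field k] [IsAlgClosed k] [CharZero k]
    (Γ : Type*) [CommGroup Γ] [Fintype Γ]
    (θ : ℕ) (g : Fin θ → Γ) (χ : Fin θ → (Γ →* kˣ))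
    (hq : ∀ i, χ i (g i) ≠ 1)
    (hcompat : ∀ i j, i ≠ j → χ i (g j) * χ j (g i) = 1)
    (i j l m : Fin θ) (hij : i ≠ j) (hlm : l ≠ m) (hjl : j ≠ l)
    (hgil : g i = g l) (hgjm : g j = g m) :
    χ j (g i) = χ m (g l) := by
  have h1 := hcompat l j hjl.symm
  have h2 := hcompat l m hlm
  rw [hgjm] at h1
  rw [hgil]
  exact mul_left_cancel (h1.trans h2.symm)
end

section
/- Let A be an associative unital k-algebra, q ∈ k a primitive N-th root of unity (q^N = 1 and q^d ≠ 1 for 0 < d < N), and x, y ∈ A with y·x = q·(x·y). Then (x + y)^N = x^N + y^N. -/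
/-- Gaussian binomial coefficients. -/
def qbin {k : Type*} [Field k] (q : k) : ℕ → ℕ → k
  | _, 0 => 1
  | 0, _ + 1 => 0
  | n + 1, i + 1 => qbin q n i + q ^ (i + 1) * qbin q n (i + 1)

theorem qbin_zero {k : Type*} [Field k] (q : k) (n : ℕ) : qbin q n 0 = 1 := by
  cases n <;> simp [qbin]

theorem qbin_succ {k : Type*} [Field k] (q : k) (n i : ℕ) :
    qbin q (n + 1) (i + 1) = qbin q n i + q ^ (i + 1) * qbin q n (i + 1) := by
  simp [qbin]

theorem qbin_gt {k : Type*} [Field k] (q : k) (n : ℕ) : ∀ i, n < i → qbin q n i = 0 := by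
  induction n with
  | zero =>
    intro i hi
    cases i with
    | zero => omega
    | succ i => simp [qbin]
  | succ n ih =>
    intro i hi
    cases i with
    | zero => omega
    | succ i => rw [qbin_succ, ih i (by omega), ih (i + 1) (by omega)]; simp

theorem qbin_self {k : Type*} [Field k] (q : k) (n : ℕ) : qbin q n n = 1 := by
  induction n with
  | zero => simp [qbin]
  | succ n ih => rw [qbin_succ, ih, qbin_gt q n (n + 1) (by omega)]; simp

theorem qbin_absorb {k : Type*} [Field k] (q : k) (n : ℕ) : ∀ j,
    (q ^ (j + 1) - 1) * qbin q (n + 1) (j + 1) = (q ^ (n + 1) - 1) * qbin q n j := by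
  induction n with
  | zero =>
    intro j
    cases j with
    | zero => simp [qbin]
    | succ j => simp [qbin]
  | succ n ih =>
    intro j
    rw [qbin_succ q (n + 1) j, mul_add, mul_left_comm, ih j]
    cases j with
    | zero => simp only [qbin_zero]; ring
    | succ m =>
      have h := ih m
      rw [qbin_succ] at h ⊢
      linear_combination q * h

theorem qcomm_pow {k : Type*} [Field k] {A : Type*} [Ring A] [Algebra k A] (q : k)
    (x y : A) (hcomm : y * x = q • (x * y)) (i : ℕ) :
    y * x ^ i = q ^ i • (x ^ i * y) := by
  induction i with
  | zero => simp
  | succ i ih =>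
    rw [pow_succ x, ← mul_assoc, ih, smul_mul_assoc, mul_assoc, hcomm, mul_smul_comm, smul_smul,
      ← mul_assoc, pow_succ]

theorem qbinomial {k : Type*} [Field k] {A : Type*} [Ring A] [Algebra k A] (q : k)
    (x y : A) (hcomm : y * x = q • (x * y)) (n : ℕ) :
    (x + y) ^ n = ∑ i ∈ Finset.range (n + 1), qbin q n i • (x ^ i * y ^ (n - i)) := by
  induction n with
  | zero => simp [qbin]
  | succ n ih =>
    have hy : y * (x + y) ^ n =
        ∑ i ∈ Finset.range (n + 1), (q ^ i * qbin q n i) • (x ^ i * y ^ (n + 1 - i)) := by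
      rw [ih, Finset.mul_sum]
      refine Finset.sum_congr rfl fun i hi => ?_
      have hi' : n + 1 - i = (n - i) + 1 := by
        have := Finset.mem_range.mp hi
        omega
      rw [mul_smul_comm, ← mul_assoc, qcomm_pow q x y hcomm, smul_mul_assoc, smul_smul, hi',
        pow_succ' y, mul_assoc, mul_comm (q ^ i)]
    have hy2 : y * (x + y) ^ n =
        ∑ i ∈ Finset.range (n + 2), (q ^ i * qbin q n i) • (x ^ i * y ^ (n + 1 - i)) := by
      rw [Finset.sum_range_succ, ← hy, qbin_gt q n (n + 1) (by omega)]; simp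
    rw [pow_succ', add_mul, hy2, ih, Finset.mul_sum, Finset.sum_range_succ' _ (n + 1),
      Finset.sum_range_succ' _ (n + 1), ← add_assoc, ← Finset.sum_add_distrib]
    congr 1
    · refine Finset.sum_congr rfl fun i _ => ?_
      rw [qbin_succ, add_smul, mul_smul_comm, ← mul_assoc, ← pow_succ', Nat.add_sub_add_right]
    · simp [qbin_zero]


/-- quantum Frobenius identity.  Let `A` be an associative
unital `k`-algebra, `q ∈ k` a primitive `N`-th root of unity (`q^N = 1` and
`q^d ≠ 1` for `0 < d < N`), and `x, y ∈ A` with `y·x = q·(x·y)`.  Then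
`(x + y)^N = x^N + y^N`. -/
theorem quantum_frobenius
    {k : Type*} [Field k] {A : Type*} [Ring A] [Algebra k A]
    (N : ℕ) (hN : 1 ≤ N) (q : k)
    (hqN : q ^ N = 1) (hqprim : ∀ d : ℕ, 0 < d → d < N → q ^ d ≠ 1)
    (x y : A) (hcomm : y * x = q • (x * y)) :
    (x + y) ^ N = x ^ N + y ^ N := by
  obtain ⟨n, rfl⟩ : ∃ n, N = n + 1 := ⟨N - 1, by omega⟩
  rw [qbinomial q x y hcomm, Finset.sum_range_succ, Finset.sum_range_succ', Finset.sum_eq_zero]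
  · simp [qbin_zero, qbin_self, add_comm]
  · intro i hi
    have hi' := Finset.mem_range.mp hi
    have h := qbin_absorb q n i
    rw [hqN, sub_self, zero_mul] at h
    have h2 := (mul_eq_zero.mp h).resolve_left
      (sub_ne_zero.mpr (hqprim (i + 1) (by omega) (by omega)))
    rw [h2, zero_smul]
end

section
/- Let K(n) ⊆ B(n) (n ≥ 0) be k-subspaces with K(0) = k·1 such that K := Σ_n K(n) is a subalgebra of U, the subspace W := K(1) satisfies W = ⊕_{h∈Γ} (W ∩ V_h), and for every n ≥ 0 the comultiplication satisfies Δ(K(n)) ⊆ Σ_{i=0}^{n} U(i) ⊗ K(n−i) inside U ⊗ U. Then K is generated as a unital k-algebra by W, i.e. K equals the subalgebra of U generated by the subspace W. -/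
open scoped TensorProduct

noncomputable section

namespace QLS

variable (k : Type) [Field k] [IsAlgClosed k] [CharZero k]
variable (Γ : Type) [CommGroup Γ] [Fintype Γ]
variable (θ : ℕ) (g : Fin θ → Γ) (χ : Fin θ → (Γ →* kˣ)) (N : Fin θ → ℕ)

/-- The relations presenting the bosonization `U = B(V) # kΓ` of a quantum linear
space: `G 1 = 1`, `G h · G h' = G (h h')`, `G h · X i = χ i h · X i · G h`,
`X i ^ N i = 0` and `X i · X j = χ j (g i) · X j · X i` for `i ≠ j`. -/
inductive Rel : FreeAlgebra k (Fin θ ⊕ Γ) → FreeAlgebra k (Fin θ ⊕ Γ) → Prop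
  | group_one : Rel (FreeAlgebra.ι k (Sum.inr (1 : Γ))) 1
  | group_mul (h h' : Γ) :
      Rel (FreeAlgebra.ι k (Sum.inr h) * FreeAlgebra.ι k (Sum.inr h'))
        (FreeAlgebra.ι k (Sum.inr (h * h')))
  | group_comm (h : Γ) (i : Fin θ) :
      Rel (FreeAlgebra.ι k (Sum.inr h) * FreeAlgebra.ι k (Sum.inl i))
        ((χ i h : k) • (FreeAlgebra.ι k (Sum.inl i) * FreeAlgebra.ι k (Sum.inr h)))
  | nilpotent (i : Fin θ) : Rel (FreeAlgebra.ι k (Sum.inl i) ^ N i) 0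
  | qcomm (i j : Fin θ) (hij : i ≠ j) :
      Rel (FreeAlgebra.ι k (Sum.inl i) * FreeAlgebra.ι k (Sum.inl j))
        ((χ j (g i) : k) • (FreeAlgebra.ι k (Sum.inl j) * FreeAlgebra.ι k (Sum.inl i)))

/-- The bosonization `U` of the quantum linear space, presented by generators
and relations. -/
abbrev U := RingQuot (Rel k Γ θ g χ N)

/-- The generator `X i` of `U`. -/
def X (i : Fin θ) : U k Γ θ g χ N :=
  RingQuot.mkAlgHom k (Rel k Γ θ g χ N) (FreeAlgebra.ι k (Sum.inl i))

/-- The group-like generator `G h` of `U`. -/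
def G (h : Γ) : U k Γ θ g χ N :=
  RingQuot.mkAlgHom k (Rel k Γ θ g χ N) (FreeAlgebra.ι k (Sum.inr h))

/-- `B(n)`: the span of all products of exactly `n` of the generators `X i`. -/
def Bgrade (n : ℕ) : Submodule k (U k Γ θ g χ N) :=
  Submodule.span k
    {u | ∃ w : List (Fin θ), w.length = n ∧ u = (w.map (X k Γ θ g χ N)).prod}

/-- `V_h`: the span of the `X i` with `g i = h`. -/
def Vh (h : Γ) : Submodule k (U k Γ θ g χ N) :=
  Submodule.span k {u | ∃ i : Fin θ, g i = h ∧ u = X k Γ θ g χ N i}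

/-- `U(n)`: the span of the elements `b · G h` with `b ∈ B(n)`, `h ∈ Γ`. -/
def Ugrade (n : ℕ) : Submodule k (U k Γ θ g χ N) :=
  Submodule.span k
    {u | ∃ b ∈ Bgrade k Γ θ g χ N n, ∃ h : Γ, u = b * G k Γ θ g χ N h}

local notation "Uu" => U k Γ θ g χ N
local notation "Xx" => X k Γ θ g χ N
local notation "Gg" => G k Γ θ g χ N
local notation "Bgr" => Bgrade k Γ θ g χ N
local notation "Vv" => Vh k Γ θ g χ N
local notation "Ugr" => Ugrade k Γ θ g χ N

section helpers
set_option linter.unusedSectionVars false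
variable {k Γ θ g χ N}

lemma G_one : Gg 1 = 1 := by
  have := RingQuot.mkAlgHom_rel k (Rel.group_one (k := k) (Γ := Γ) (θ := θ) (g := g) (χ := χ) (N := N))
  simpa [G] using this

lemma G_mul (h h' : Γ) : Gg h * Gg h' = Gg (h * h') := by
  have := RingQuot.mkAlgHom_rel k (Rel.group_mul (k := k) (Γ := Γ) (θ := θ) (g := g) (χ := χ) (N := N) h h')
  simpa [G] using this

lemma G_X (h : Γ) (i : Fin θ) : Gg h * Xx i = (χ i h : k) • (Xx i * Gg h) := by
  have := RingQuot.mkAlgHom_rel k (Rel.group_comm (k := k) (Γ := Γ) (θ := θ) (g := g) (χ := χ) (N := N) h i)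
  simpa [G, X] using this

lemma X_pow (i : Fin θ) : Xx i ^ N i = 0 := by
  have := RingQuot.mkAlgHom_rel k (Rel.nilpotent (k := k) (Γ := Γ) (θ := θ) (g := g) (χ := χ) (N := N) i)
  simpa [X] using this

lemma X_X (i j : Fin θ) (hij : i ≠ j) : Xx i * Xx j = (χ j (g i) : k) • (Xx j * Xx i) := by
  have := RingQuot.mkAlgHom_rel k (Rel.qcomm (k := k) (Γ := Γ) (θ := θ) (g := g) (χ := χ) (N := N) i j hij)
  simpa [X] using this

lemma U_induction {P : Uu → Prop} (hX : ∀ i, P (Xx i)) (hG : ∀ h, P (Gg h))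
    (hc : ∀ r : k, P (algebraMap k Uu r)) (hadd : ∀ a b, P a → P b → P (a + b))
    (hmul : ∀ a b, P a → P b → P (a * b)) (u : Uu) : P u := by
  obtain ⟨a, rfl⟩ := RingQuot.mkAlgHom_surjective k (Rel k Γ θ g χ N) u
  induction a using FreeAlgebra.induction with
  | grade0 r => simpa using hc r
  | grade1 x =>
    cases x with
    | inl i => exact hX i
    | inr h => exact hG h
  | mul a b ha hb => rw [map_mul]; exact hmul _ _ ha hb
  | add a b ha hb => rw [map_add]; exact hadd _ _ ha hb

/-- The two-dimensional representation detecting `X j`. -/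
lemma exists_rho (hN1 : ∀ i, 1 < N i) (j : Fin θ) :
    ∃ ρ : Uu →ₐ[k] Matrix (Fin 2) (Fin 2) k,
      (∀ l, ρ (Xx l) = if l = j then !![0, 1; 0, 0] else 0) ∧
      (∀ h, ρ (Gg h) = !![(χ j h : k), 0; 0, 1]) := by
  let F : FreeAlgebra k (Fin θ ⊕ Γ) →ₐ[k] Matrix (Fin 2) (Fin 2) k :=
    FreeAlgebra.lift k (Sum.elim (fun l => if l = j then !![0, 1; 0, 0] else 0)
      (fun h => !![(χ j h : k), 0; 0, 1]))
  have hF : ∀ ⦃x y⦄, Rel k Γ θ g χ N x y → F x = F y := by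
    intro x y hxy
    cases hxy with
    | group_one => simp [F, Matrix.one_fin_two]
    | group_mul h h' => simp [F]
    | group_comm h i =>
      by_cases hi : i = j
      · subst hi; simp [F]
      · simp [F, hi]
    | nilpotent i =>
      obtain ⟨m, hm⟩ : ∃ m, N i = m + 2 := ⟨N i - 2, by have := hN1 i; omega⟩
      have : (!![0, 1; 0, 0] : Matrix (Fin 2) (Fin 2) k) ^ 2 = 0 := by
        ext a b; fin_cases a <;> fin_cases b <;> simp [pow_two]
      by_cases hi : i = j
      · simp [F, hi, map_pow]
        rw [← hi, hm, pow_add, this, mul_zero]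
      · simp [F, hi, map_pow, hm]
    | qcomm a b hab =>
      by_cases ha : a = j
      · have : b ≠ j := fun h => hab (ha.trans h.symm)
        simp [F, this]
      · simp [F, ha]
  refine ⟨RingQuot.liftAlgHom k ⟨F, hF⟩, ?_, ?_⟩
  · intro l; simp [X, F]
  · intro h; simp [G, F]

/-- The linear functional dual to `X j`. -/
lemma exists_phi (hN1 : ∀ i, 1 < N i) (ε : Uu →ₐ[k] k)
    (hεG : ∀ h : Γ, ε (Gg h) = 1) (hεX : ∀ i : Fin θ, ε (Xx i) = 0) (j : Fin θ) :
    ∃ φ : Uu →ₗ[k] k, φ 1 = 0 ∧ ∀ l u, φ (Xx l * u) = if l = j then ε u else 0 := by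
  obtain ⟨ρ, hX, hG⟩ := exists_rho (k := k) (g := g) (χ := χ) hN1 j
  have key : ∀ u, ρ u 1 0 = 0 ∧ ρ u 1 1 = ε u := by
    intro u
    induction u using U_induction with
    | hX i => rw [hX, hεX]; split_ifs <;> simp
    | hG h => rw [hG, hεG]; simp
    | hc r => simp [Matrix.algebraMap_matrix_apply]
    | hadd a b ha hb => simp [ha, hb]
    | hmul a b ha hb => simp [Matrix.mul_apply, Fin.sum_univ_two, ha, hb]
  refine ⟨{ toFun := fun u => ρ u 0 1, map_add' := by simp, map_smul' := by simp }, by simp, ?_⟩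
  intro l u
  simp only [LinearMap.coe_mk, AddHom.coe_mk, map_mul, hX]
  split_ifs <;> simp [Matrix.mul_apply, Fin.sum_univ_two, key]

lemma exists_phi_f (hN1 : ∀ i, 1 < N i) (ε : Uu →ₐ[k] k)
    (hεG : ∀ h : Γ, ε (Gg h) = 1) (hεX : ∀ i : Fin θ, ε (Xx i) = 0) (f : Fin θ → k) :
    ∃ φ : Uu →ₗ[k] k, φ 1 = 0 ∧ ∀ l u, φ (Xx l * u) = f l * ε u := by
  choose φ h1 h2 using exists_phi (k := k) (g := g) (χ := χ) hN1 ε hεG hεX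
  refine ⟨∑ j, f j • φ j, by simp [h1], fun l u => by simp [h2]⟩

/-- The skew derivation attached to a functional. -/
def der (Δ : Uu →ₐ[k] Uu ⊗[k] Uu) (φ : Uu →ₗ[k] k) : Uu →ₗ[k] Uu :=
  (TensorProduct.rid k Uu).toLinearMap ∘ₗ (LinearMap.lTensor Uu φ) ∘ₗ Δ.toLinearMap

lemma der_mul (Δ : Uu →ₐ[k] Uu ⊗[k] Uu) (ε : Uu →ₐ[k] k)
    (hcounit_right : (Algebra.TensorProduct.rid k k Uu).toAlgHom.comp
        ((Algebra.TensorProduct.map (AlgHom.id k Uu) ε).comp Δ) = AlgHom.id k Uu)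
    (hΔX : ∀ i : Fin θ, Δ (Xx i) = Xx i ⊗ₜ[k] (1 : Uu) + Gg (g i) ⊗ₜ[k] Xx i)
    (φ : Uu →ₗ[k] k) (f : Fin θ → k) (hφ : ∀ l u, φ (Xx l * u) = f l * ε u)
    (j : Fin θ) (y : Uu) :
    der Δ φ (Xx j * y) = Xx j * der Δ φ y + f j • (Gg (g j) * y) := by
  have hy : (Algebra.TensorProduct.rid k k Uu)
      (Algebra.TensorProduct.map (AlgHom.id k Uu) ε (Δ y)) = y := DFunLike.congr_fun hcounit_right y
  conv_rhs => rw [← hy]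
  simp only [der, LinearMap.comp_apply, AlgHom.toLinearMap_apply, map_mul, hΔX]
  have e2 : f j • (Gg (g j) * (Algebra.TensorProduct.rid k k Uu)
      (Algebra.TensorProduct.map (AlgHom.id k Uu) ε (Δ y))) = f j • (Gg (g j) * y) := by rw [hy]
  rw [hy]
  rw [← e2]
  generalize Δ y = z
  induction z with
  | zero => simp
  | add a b ha hb =>
    simp only [mul_add, map_add, ha, hb, smul_add]
    abel
  | tmul a b =>
    simp [add_mul, hφ, mul_smul, mul_comm]

lemma der_kill (Δ : Uu →ₐ[k] Uu ⊗[k] Uu) (φ : Uu →ₗ[k] k)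
    (K : ℕ → Submodule k Uu) (hK : ∀ n, ∀ x ∈ K n, φ x = 0)
    (hΔK : ∀ n, Submodule.map Δ.toLinearMap (K n) ≤
      ∑ i ∈ Finset.range (n + 1),
        Submodule.map₂ (TensorProduct.mk k Uu Uu) (Ugr i) (K (n - i)))
    (n : ℕ) (x : Uu) (hx : x ∈ K n) : der Δ φ x = 0 := by
  have h1 := hΔK n (Submodule.mem_map_of_mem hx)
  have h2 : ∑ i ∈ Finset.range (n + 1),
        Submodule.map₂ (TensorProduct.mk k Uu Uu) (Ugr i) (K (n - i)) ≤
      LinearMap.ker (LinearMap.lTensor Uu φ) := by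
    refine Finset.sum_induction _ (fun p => p ≤ LinearMap.ker (LinearMap.lTensor Uu φ)) ?_ ?_ ?_
    · intro a b ha hb
      exact sup_le ha hb
    · exact bot_le
    · intro i _
      rw [Submodule.map₂_le]
      intro a _ b hb
      simp [hK _ b hb]
  have h3 := h2 h1
  rw [LinearMap.mem_ker] at h3
  simp only [der, LinearMap.comp_apply]
  rw [h3, map_zero]

/-- Triangularity lemma. -/
lemma triangular {M : Type} [AddCommGroup M] [Module k M] (D L : M →ₗ[k] M) (Y : Submodule k M)
    (c : ℕ → k) (hD0 : ∀ y ∈ Y, D y = 0)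
    (hD : ∀ a, ∀ y ∈ Y, D ((L ^ (a + 1)) y) = c (a + 1) • (L ^ a) y)
    (n : ℕ) (hc : ∀ a, 0 < a → a < n → c a ≠ 0) (y : ℕ → M) (hy : ∀ a, y a ∈ Y)
    (hx : D (∑ a ∈ Finset.range n, (L ^ a) (y a)) = 0) :
    ∑ a ∈ Finset.range n, (L ^ a) (y a) ∈ Y := by
  have hlow : ∀ m a, a < m → ∀ y ∈ Y, (D ^ m) ((L ^ a) y) = 0 := by
    intro m
    induction m with
    | zero => intro a ha; omega
    | succ m ih =>
      intro a ha y hy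
      rw [pow_succ, Module.End.mul_apply]
      cases a with
      | zero => simp [hD0 y hy]
      | succ a => rw [hD a y hy, map_smul, ih a (by omega) y hy, smul_zero]
  have htop : ∀ m, m < n → ∃ d : k, d ≠ 0 ∧ ∀ y ∈ Y, (D ^ m) ((L ^ m) y) = d • y := by
    intro m
    induction m with
    | zero => intro _; exact ⟨1, one_ne_zero, by simp⟩
    | succ m ih =>
      intro hm
      obtain ⟨d, hd, h⟩ := ih (by omega)
      refine ⟨c (m + 1) * d, mul_ne_zero (hc _ (by omega) hm) hd, ?_⟩
      intro y hy
      rw [pow_succ, Module.End.mul_apply, hD m y hy, map_smul, h y hy, smul_smul]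
  clear hc hD
  induction n with
  | zero => simp
  | succ n ih =>
    by_cases hn : n = 0
    · subst hn; simp [hy]
    · have h0 : (D ^ n) (∑ a ∈ Finset.range (n + 1), (L ^ a) (y a)) = 0 := by
        obtain ⟨m, rfl⟩ := Nat.exists_eq_succ_of_ne_zero hn
        rw [Nat.succ_eq_add_one, pow_succ, Module.End.mul_apply]
        rw [Nat.succ_eq_add_one] at hx
        rw [hx, map_zero]
      obtain ⟨d, hd, h⟩ := htop n (by omega)
      have hyn : y n = 0 := by
        rw [Finset.sum_range_succ, map_add, h _ (hy n), map_sum,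
          Finset.sum_eq_zero (fun a ha => hlow n a (Finset.mem_range.1 ha) _ (hy a)), zero_add] at h0
        exact (smul_eq_zero.1 h0).resolve_left hd
      rw [Finset.sum_range_succ, hyn, map_zero, add_zero] at hx ⊢
      exact ih hx (fun m hm => htop m (by omega))

lemma Vh_mul_X (i : Fin θ) (h : Γ) (w : Uu) (hw : w ∈ Vv h) :
    ∃ c d : k, w * Xx i = c • (Xx i * w) + d • (Xx i * Xx i) := by
  have : ∃ d : k, w * Xx i = (χ i h : k) • (Xx i * w) + d • (Xx i * Xx i) := by
    induction hw using Submodule.span_induction with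
    | mem x hx =>
      obtain ⟨j, rfl, rfl⟩ := hx
      by_cases hij : j = i
      · subst hij
        refine ⟨1 - (χ j (g j) : k), ?_⟩
        rw [← add_smul]; simp
      · exact ⟨0, by rw [X_X j i hij]; simp⟩
    | zero => exact ⟨0, by simp⟩
    | add x y _ _ hx hy =>
      obtain ⟨d, hx⟩ := hx
      obtain ⟨e, hy⟩ := hy
      refine ⟨d + e, ?_⟩
      rw [add_mul, hx, hy, mul_add, smul_add, add_smul]; abel
    | smul a x _ hx =>
      obtain ⟨d, hx⟩ := hx
      refine ⟨a * d, ?_⟩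
      rw [smul_mul_assoc, hx, mul_smul_comm, smul_add, smul_smul, smul_smul, smul_smul, mul_comm a]
  exact ⟨_, this⟩

lemma Vh_mul_X_pow (i : Fin θ) (h : Γ) (w : Uu) (hw : w ∈ Vv h) (a : ℕ) :
    ∃ c d : k, w * Xx i ^ a = c • (Xx i ^ a * w) + d • (Xx i ^ (a + 1)) := by
  obtain ⟨c, d, h1⟩ := Vh_mul_X i h w hw
  induction a with
  | zero => exact ⟨1, 0, by simp⟩
  | succ a ih =>
    obtain ⟨c', d', h2⟩ := ih
    refine ⟨c' * c, c' * d + d', ?_⟩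
    rw [pow_succ, ← mul_assoc, h2, add_mul, smul_mul_assoc, mul_assoc, h1, mul_add, mul_smul_comm,
      mul_smul_comm, smul_add, smul_smul, smul_smul, smul_mul_assoc, add_smul, ← mul_assoc,
      ← mul_assoc, ← pow_succ, ← pow_succ, add_assoc]

lemma decomp (T : Set Uu) (hT : ∀ t ∈ T, ∃ h, t ∈ Vv h) (i : Fin θ) (x : Uu)
    (hx : x ∈ Algebra.adjoin k (T ∪ {Xx i})) :
    x ∈ ⨆ a : ℕ, Submodule.map (LinearMap.mulLeft k (Xx i ^ a))
      (Subalgebra.toSubmodule (Algebra.adjoin k T)) := by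
  set M := ⨆ a : ℕ, Submodule.map (LinearMap.mulLeft k (Xx i ^ a))
      (Subalgebra.toSubmodule (Algebra.adjoin k T)) with hM
  have hmem : ∀ a y, y ∈ Algebra.adjoin k T → Xx i ^ a * y ∈ M := fun a y hy =>
    Submodule.mem_iSup_of_mem a ⟨y, hy, rfl⟩
  have key : ∀ x ∈ Algebra.adjoin k (T ∪ {Xx i}), ∀ m ∈ M, x * m ∈ M := by
    intro x hx
    induction hx using Algebra.adjoin_induction with
    | mem t ht =>
      intro m hm
      have : M ≤ M.comap (LinearMap.mulLeft k t) := by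
        conv_lhs => rw [hM]
        refine iSup_le fun a => ?_
        rintro _ ⟨y, hy, rfl⟩
        simp only [Submodule.mem_comap, LinearMap.mulLeft_apply]
        rcases ht with ht | ht
        · obtain ⟨h, hh⟩ := hT t ht
          obtain ⟨c, d, e⟩ := Vh_mul_X_pow i h t hh a
          rw [← mul_assoc, e, add_mul, smul_mul_assoc, smul_mul_assoc, mul_assoc]
          exact M.add_mem (M.smul_mem _ (hmem _ _ (mul_mem (Algebra.subset_adjoin ht) hy)))
            (M.smul_mem _ (hmem _ _ hy))
        · rw [Set.mem_singleton_iff.1 ht, ← mul_assoc, ← pow_succ']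
          exact hmem _ _ hy
      exact this hm
    | algebraMap r => intro m hm; rw [← Algebra.smul_def]; exact M.smul_mem _ hm
    | add a b _ _ ha hb => intro m hm; rw [add_mul]; exact M.add_mem (ha m hm) (hb m hm)
    | mul a b _ _ ha hb => intro m hm; rw [mul_assoc]; exact ha _ (hb m hm)
  have := key x hx 1 (by simpa using hmem 0 1 (one_mem _))
  simpa using this

lemma decomp_sum (T : Set Uu) (hT : ∀ t ∈ T, ∃ h, t ∈ Vv h) (i : Fin θ) (x : Uu)
    (hx : x ∈ Algebra.adjoin k (T ∪ {Xx i})) :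
    ∃ y : ℕ → Uu, (∀ a, y a ∈ Algebra.adjoin k T) ∧
      x = ∑ a ∈ Finset.range (N i), Xx i ^ a * y a := by
  have := decomp T hT i x hx
  clear hx
  induction this using Submodule.iSup_induction' with
  | mem a x hx =>
    obtain ⟨y, hy, rfl⟩ := hx
    by_cases ha : a < N i
    · refine ⟨fun b => if b = a then y else 0, ?_, ?_⟩
      · intro b; dsimp only; split_ifs
        · exact hy
        · exact zero_mem _
      · simp [ha]
    · refine ⟨0, fun _ => zero_mem _, ?_⟩
      have : Xx i ^ a = 0 := by
        rw [← Nat.sub_add_cancel (not_lt.1 ha), pow_add, X_pow, mul_zero]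
      simp [this]
  | zero => exact ⟨0, fun _ => zero_mem _, by simp⟩
  | add x y _ _ hx hy =>
    obtain ⟨u, hu, e⟩ := hx
    obtain ⟨v, hv, e'⟩ := hy
    refine ⟨fun a => u a + v a, fun a => add_mem (hu a) (hv a), ?_⟩
    conv_lhs => rw [e, e']
    simp only [mul_add, Finset.sum_add_distrib]

lemma step (hq : ∀ i, χ i (g i) ≠ 1) (hN : ∀ i, N i = orderOf (χ i (g i)))
    (T : Set Uu) (hT : ∀ t ∈ T, ∃ h, t ∈ Vv h) (i : Fin θ)
    (f : Uu →ₗ[k] k) (hfT : ∀ t ∈ T, f t = 0) (hfi : f (Xx i) = 1)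
    (d : Uu →ₗ[k] Uu) (hd1 : d 1 = 0)
    (hd : ∀ j y, d (Xx j * y) = Xx j * d y + f (Xx j) • (Gg (g j) * y))
    (x : Uu) (hx : x ∈ Algebra.adjoin k (T ∪ {Xx i})) (hdx : d x = 0) :
    x ∈ Algebra.adjoin k T := by
  have hV : ∀ h, ∀ w ∈ Vv h, ∀ y, d (w * y) = w * d y + f w • (Gg h * y) := by
    intro h w hw y
    induction hw using Submodule.span_induction with
    | mem x hx => obtain ⟨j, rfl, rfl⟩ := hx; exact hd j y
    | zero => simp
    | add a b _ _ ha hb => rw [add_mul, map_add, ha, hb, add_mul, map_add, add_smul]; abel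
    | smul c a _ ha =>
      rw [smul_mul_assoc, map_smul, ha, smul_add, map_smul, smul_mul_assoc, smul_smul, smul_eq_mul]
  have hkill : ∀ a ∈ Algebra.adjoin k T, ∀ y, d y = 0 → d (a * y) = 0 := by
    intro a ha
    induction ha using Algebra.adjoin_induction with
    | mem t ht =>
      intro y hy
      obtain ⟨h, hh⟩ := hT t ht
      rw [hV h t hh, hy, hfT t ht]; simp
    | algebraMap r => intro y hy; rw [← Algebra.smul_def, map_smul, hy, smul_zero]
    | add a b _ _ ha hb => intro y hy; rw [add_mul, map_add, ha y hy, hb y hy, add_zero]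
    | mul a b _ _ ha hb => intro y hy; rw [mul_assoc]; exact ha _ (hb y hy)
  have hkill' : ∀ a ∈ Algebra.adjoin k T, d a = 0 := fun a ha => by
    simpa using hkill a ha 1 hd1
  obtain ⟨y, hy, rfl⟩ := decomp_sum T hT i x hx
  set q : k := ((χ i (g i)⁻¹ : kˣ) : k) with hqdef
  let c : ℕ → k := fun a => ∑ s ∈ Finset.range a, q ^ s
  have hc : ∀ a, 0 < a → a < N i → c a ≠ 0 := by
    intro a ha haN h0
    have h1 : c a * (q - 1) = q ^ a - 1 := geom_sum_mul q a
    rw [h0, zero_mul] at h1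
    have h2 : (χ i (g i)) ^ a = 1 := by
      have : q ^ a = 1 := (sub_eq_zero.1 h1.symm)
      rw [hqdef, ← Units.val_pow_eq_pow_val, Units.val_eq_one, map_inv, inv_pow, inv_eq_one] at this
      exact this
    have := Nat.le_of_dvd ha (orderOf_dvd_of_pow_eq_one h2)
    rw [← hN] at this
    omega
  have hLp : ∀ a (z : Uu), ((LinearMap.mulLeft k (Xx i)) ^ a) z = Xx i ^ a * z := by
    intro a z
    rw [LinearMap.pow_mulLeft, LinearMap.mulLeft_apply]
  have hDD : ∀ a, ∀ z ∈ Algebra.adjoin k T,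
      Gg (g i)⁻¹ * d (Xx i ^ (a + 1) * z) = c (a + 1) • (Xx i ^ a * z) := by
    intro a z hz
    have hrec : ∀ z, Gg (g i)⁻¹ * d (Xx i * z) = q • (Xx i * (Gg (g i)⁻¹ * d z)) + z := by
      intro z
      rw [hd, hfi, one_smul, mul_add, ← mul_assoc, G_X, ← mul_assoc (Gg _), G_mul,
        inv_mul_cancel, G_one, one_mul, smul_mul_assoc, mul_assoc]
    induction a with
    | zero => rw [pow_one, hrec, hkill' z hz]; simp [c]
    | succ a ih =>
      rw [pow_succ', mul_assoc, hrec, ih, mul_smul_comm, smul_smul, ← mul_assoc, ← pow_succ']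
      have : c (a + 1 + 1) = q * c (a + 1) + 1 := by
        simp only [c]
        rw [Finset.sum_range_succ' _ (a + 1), Finset.mul_sum]
        simp [pow_succ']
      rw [this, add_smul, one_smul]
  have hfin := triangular ((LinearMap.mulLeft k (Gg (g i)⁻¹)) ∘ₗ d) (LinearMap.mulLeft k (Xx i))
    (Subalgebra.toSubmodule (Algebra.adjoin k T)) c
    (by intro z hz; simp [hkill' z hz])
    (by intro a z hz; rw [hLp, hLp]; exact hDD a z hz)
    (N i) hc y hy
    (by
      simp only [hLp]
      rw [LinearMap.comp_apply, hdx, map_zero])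
  simpa only [hLp, Subalgebra.mem_toSubmodule] using hfin

end helpers

/-- Let `K(n) ⊆ B(n)` be subspaces with `K(0) = k·1` such that
`K = Σ_n K(n)` is a subalgebra of `U`, `W := K(1)` decomposes as
`⊕_{h∈Γ} (W ∩ V_h)`, and `Δ(K(n)) ⊆ Σ_{i=0}^n U(i) ⊗ K(n-i)` for all `n`.
Then `K` is generated as a unital `k`-algebra by `W := K(1)`. -/
theorem coideal_subalgebra_generated_in_degree_one
    (hθ : 1 ≤ θ)
    (hq : ∀ i, χ i (g i) ≠ 1)
    (hcompat : ∀ i j, i ≠ j → χ i (g j) * χ j (g i) = 1)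
    (hN : ∀ i, N i = orderOf (χ i (g i))) (hN1 : ∀ i, 1 < N i)
    -- a bialgebra structure on `U`:
    (Δ : Uu →ₐ[k] Uu ⊗[k] Uu) (ε : Uu →ₐ[k] k)
    (hcoassoc : (Algebra.TensorProduct.assoc k k k Uu Uu Uu).toAlgHom.comp
        ((Algebra.TensorProduct.map Δ (AlgHom.id k Uu)).comp Δ) =
      (Algebra.TensorProduct.map (AlgHom.id k Uu) Δ).comp Δ)
    (hcounit_left : (Algebra.TensorProduct.lid k Uu).toAlgHom.comp
        ((Algebra.TensorProduct.map ε (AlgHom.id k Uu)).comp Δ) = AlgHom.id k Uu)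
    (hcounit_right : (Algebra.TensorProduct.rid k k Uu).toAlgHom.comp
        ((Algebra.TensorProduct.map (AlgHom.id k Uu) ε).comp Δ) = AlgHom.id k Uu)
    (hΔG : ∀ h : Γ, Δ (Gg h) = Gg h ⊗ₜ[k] Gg h)
    (hΔX : ∀ i : Fin θ, Δ (Xx i) = Xx i ⊗ₜ[k] (1 : Uu) + Gg (g i) ⊗ₜ[k] Xx i)
    (hεG : ∀ h : Γ, ε (Gg h) = 1) (hεX : ∀ i : Fin θ, ε (Xx i) = 0)
    -- the subspaces `K(n)`:
    (K : ℕ → Submodule k Uu)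
    (hKB : ∀ n, K n ≤ Bgr n)
    (hK0 : K 0 = Submodule.span k {(1 : Uu)})
    (S : Subalgebra k Uu) (hS : Subalgebra.toSubmodule S = ⨆ n, K n)
    (hW : K 1 = ⨆ h : Γ, (K 1 ⊓ Vv h))
    (hWindep : iSupIndep fun h : Γ => K 1 ⊓ Vv h)
    (hΔK : ∀ n, Submodule.map Δ.toLinearMap (K n) ≤
      ∑ i ∈ Finset.range (n + 1),
        Submodule.map₂ (TensorProduct.mk k Uu Uu) (Ugr i) (K (n - i))) :
    S = Algebra.adjoin k ((K 1 : Submodule k Uu) : Set Uu) := by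
  have hT0 : ∀ n, ∀ x ∈ K n, ∀ φ : Uu →ₗ[k] k, ∀ f : Uu →ₗ[k] k, φ 1 = 0 →
      (∀ l u, φ (Xx l * u) = f (Xx l) * ε u) → (∀ h : Γ, ∀ x ∈ K 1 ⊓ Vv h, f x = 0) → φ x = 0 := by
    intro n x hx φ f h1 h2 h3
    by_cases hn : n = 1
    · subst hn
      have e : ∀ h : Γ, ∀ x ∈ Vv h, φ x = f x := by
        intro h x hx
        induction hx using Submodule.span_induction with
        | mem x hx => obtain ⟨j, -, rfl⟩ := hx; simpa using h2 j 1
        | zero => simp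
        | add a b _ _ ha hb => simp [ha, hb]
        | smul c a _ ha => simp [ha]
      have : (⨆ h : Γ, (K 1 ⊓ Vv h)) ≤ LinearMap.ker φ := by
        refine iSup_le fun h x hx => ?_
        rw [LinearMap.mem_ker, e h x hx.2, h3 h x hx]
      exact this (hW ▸ hx)
    · have : Bgr n ≤ LinearMap.ker φ := by
        refine Submodule.span_le.2 ?_
        rintro _ ⟨w, hw, rfl⟩
        match w, hw with
        | [], _ => simp [h1]
        | [a], hw => exact absurd hw.symm hn
        | a :: b :: w, _ => simp [h2, hεX]
      exact this (hKB n hx)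
  let T : ℕ → Set Uu := fun m => {t | ∃ h : Γ, t ∈ K 1 ⊓ Vv h} ∪ {t | ∃ j : Fin θ, j.1 < m ∧ t = Xx j}
  have hTV : ∀ m, ∀ t ∈ T m, ∃ h, t ∈ Vv h := by
    rintro m t (⟨h, ht⟩ | ⟨j, -, rfl⟩)
    · exact ⟨h, ht.2⟩
    · exact ⟨g j, Submodule.subset_span ⟨j, rfl, rfl⟩⟩
  have hstep : ∀ n, ∀ x ∈ K n, ∀ m, m < θ → x ∈ Algebra.adjoin k (T (m + 1)) →
      x ∈ Algebra.adjoin k (T m) := by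
    intro n x hx m hm hxm
    have hsub : T (m + 1) ⊆ T m ∪ {Xx ⟨m, hm⟩} := by
      rintro t (ht | ⟨j, hj, rfl⟩)
      · exact Or.inl (Or.inl ht)
      · by_cases hjm : j.1 < m
        · exact Or.inl (Or.inr ⟨j, hjm, rfl⟩)
        · right
          have : j = ⟨m, hm⟩ := Fin.ext (by simp; omega)
          rw [this]; rfl
    have hxm' := Algebra.adjoin_mono hsub hxm
    by_cases hmem : Xx ⟨m, hm⟩ ∈ Submodule.span k (T m)
    · refine (Algebra.adjoin_le ?_) hxm'
      rintro t (ht | ht)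
      · exact Algebra.subset_adjoin ht
      · rw [Set.mem_singleton_iff.1 ht]
        exact Algebra.span_le_adjoin k _ hmem
    · obtain ⟨f0, hf0, hf0'⟩ := Submodule.exists_le_ker_of_notMem hmem
      obtain ⟨f, hfT, hf1⟩ : ∃ f : Uu →ₗ[k] k, (∀ t ∈ T m, f t = 0) ∧ f (Xx ⟨m, hm⟩) = 1 := by
        refine ⟨(f0 (Xx ⟨m, hm⟩))⁻¹ • f0, fun t ht => ?_, ?_⟩
        · have : f0 t = 0 := hf0' (Submodule.subset_span ht)
          simp [this]
        · simp [hf0]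
      obtain ⟨φ, hφ1, hφ⟩ := exists_phi_f (k := k) (g := g) (χ := χ) hN1 ε hεG hεX (fun l => f (Xx l))
      refine step hq hN (T m) (hTV m) ⟨m, hm⟩ f hfT hf1 (der Δ φ) ?_
        (der_mul Δ ε hcounit_right hΔX φ _ hφ) x hxm' ?_
      · simp [der, Algebra.TensorProduct.one_def, hφ1]
      · exact der_kill Δ φ K (fun n x hx => hT0 n x hx φ f hφ1 hφ
          (fun h x hx => hfT x (Or.inl ⟨h, hx⟩))) hΔK n x hx
  have hall : ∀ n, ∀ x ∈ K n, x ∈ Algebra.adjoin k ((K 1 : Submodule k Uu) : Set Uu) := by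
    intro n x hx
    have htop : x ∈ Algebra.adjoin k (T θ) := by
      have : Bgr n ≤ Subalgebra.toSubmodule (Algebra.adjoin k (T θ)) := by
        refine Submodule.span_le.2 ?_
        rintro _ ⟨w, -, rfl⟩
        refine list_prod_mem (S := Algebra.adjoin k (T θ)) ?_
        intro u hu
        obtain ⟨j, -, rfl⟩ := List.mem_map.1 hu
        exact Algebra.subset_adjoin (Or.inr ⟨j, j.2, rfl⟩)
      exact this (hKB n hx)
    have hdesc : ∀ m, m ≤ θ → x ∈ Algebra.adjoin k (T m) → x ∈ Algebra.adjoin k (T 0) := by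
      intro m
      induction m with
      | zero => exact fun _ h => h
      | succ m ih => exact fun hm h => ih (by omega) (hstep n x hx m (by omega) h)
    refine Algebra.adjoin_mono ?_ (hdesc θ le_rfl htop)
    rintro t (⟨h, ht⟩ | ⟨j, hj, -⟩)
    · exact ht.1
    · omega
  apply le_antisymm
  · intro x hx
    have hx' : x ∈ ⨆ n, K n := hS ▸ hx
    have : (⨆ n, K n) ≤ Subalgebra.toSubmodule
        (Algebra.adjoin k ((K 1 : Submodule k Uu) : Set Uu)) := iSup_le fun n x hx => hall n x hx
    exact this hx'
  · refine Algebra.adjoin_le fun x hx => ?_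
    have : x ∈ Subalgebra.toSubmodule S := by
      rw [hS]; exact Submodule.mem_iSup_of_mem 1 hx
    exact this

end QLS

end
end

section
/- The algebra A(Γ,R,D) admits a Hopf algebra structure over k (comultiplication, counit and antipode satisfying the bialgebra and antipode axioms) whose comultiplication Δ satisfies Δ(G_h) = G_h ⊗ G_h for all h ∈ Γ and Δ(a_i) = a_i ⊗ 1 + G_{g_i} ⊗ a_i for all i, and whose counit ε satisfies ε(G_h) = 1 and ε(a_i) = 0. -/
open scoped TensorProduct

noncomputable section

namespace QLSLift

variable (k : Type) [Field k] [IsAlgClosed k] [CharZero k]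
variable (Γ : Type) [CommGroup Γ] [Fintype Γ]
variable (θ : ℕ) (g : Fin θ → Γ) (χ : Fin θ → (Γ →* kˣ)) (N : Fin θ → ℕ)
variable (μ : Fin θ → k) (lamb : Fin θ → Fin θ → k)

/-- The relations presenting the lifting `A(Γ,R,D)` of a quantum linear space:
`G 1 = 1`, `G h · G h' = G (h h')`, `G h · a i = χ i h · a i · G h`,
`a i ^ N i = μ i · (1 − G (g i ^ N i))` and
`a i · a j = χ j (g i) · a j · a i + λ_{ij} · (1 − G (g i · g j))` for `i < j`. -/
inductive Rel : FreeAlgebra k (Fin θ ⊕ Γ) → FreeAlgebra k (Fin θ ⊕ Γ) → Prop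
  | group_one : Rel (FreeAlgebra.ι k (Sum.inr (1 : Γ))) 1
  | group_mul (h h' : Γ) :
      Rel (FreeAlgebra.ι k (Sum.inr h) * FreeAlgebra.ι k (Sum.inr h'))
        (FreeAlgebra.ι k (Sum.inr (h * h')))
  | group_comm (h : Γ) (i : Fin θ) :
      Rel (FreeAlgebra.ι k (Sum.inr h) * FreeAlgebra.ι k (Sum.inl i))
        ((χ i h : k) • (FreeAlgebra.ι k (Sum.inl i) * FreeAlgebra.ι k (Sum.inr h)))
  | pow (i : Fin θ) :
      Rel (FreeAlgebra.ι k (Sum.inl i) ^ N i)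
        (μ i • (1 - FreeAlgebra.ι k (Sum.inr (g i ^ N i))))
  | lift_qcomm (i j : Fin θ) (hij : i < j) :
      Rel (FreeAlgebra.ι k (Sum.inl i) * FreeAlgebra.ι k (Sum.inl j))
        ((χ j (g i) : k) • (FreeAlgebra.ι k (Sum.inl j) * FreeAlgebra.ι k (Sum.inl i))
          + lamb i j • (1 - FreeAlgebra.ι k (Sum.inr (g i * g j))))

/-- The lifting `A(Γ,R,D)`, presented by generators and relations. -/
abbrev A := RingQuot (Rel k Γ θ g χ N μ lamb)

/-- The generator `a i` of `A(Γ,R,D)`. -/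
def a (i : Fin θ) : A k Γ θ g χ N μ lamb :=
  RingQuot.mkAlgHom k (Rel k Γ θ g χ N μ lamb) (FreeAlgebra.ι k (Sum.inl i))

/-- The group-like generator `G h` of `A(Γ,R,D)`. -/
def G (h : Γ) : A k Γ θ g χ N μ lamb :=
  RingQuot.mkAlgHom k (Rel k Γ θ g χ N μ lamb) (FreeAlgebra.ι k (Sum.inr h))

section abstract_lemmas

variable {F : Type} [Field F]

/-- Gaussian binomial coefficients. -/
def gb (q : F) : ℕ → ℕ → F
  | _, 0 => 1
  | 0, _ + 1 => 0
  | n + 1, m + 1 => gb q n m + q ^ (m + 1) * gb q n (m + 1)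

theorem gb_zero (q : F) (n : ℕ) : gb q n 0 = 1 := by cases n <;> simp [gb]

theorem gb_of_lt (q : F) (n m : ℕ) (h : n < m) : gb q n m = 0 := by
  induction n generalizing m with
  | zero => cases m with
    | zero => omega
    | succ m => simp [gb]
  | succ n ih => cases m with
    | zero => omega
    | succ m => simp [gb, ih m (by omega), ih (m + 1) (by omega)]

theorem gb_self (q : F) (n : ℕ) : gb q n n = 1 := by
  induction n with
  | zero => simp [gb]
  | succ n ih => simp [gb, ih, gb_of_lt]

theorem gb_absorb (q : F) (n m : ℕ) :
    (1 - q ^ (m + 1)) * gb q (n + 1) (m + 1) = (1 - q ^ (n + 1)) * gb q n m := by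
  induction n generalizing m with
  | zero => cases m <;> simp [gb]
  | succ n ih =>
    cases m with
    | zero =>
      have h1 := ih 0
      have e : gb q (n + 1 + 1) (0 + 1) = gb q (n + 1) 0 + q ^ (0 + 1) * gb q (n + 1) (0 + 1) := by
        rw [gb_zero, gb, gb_zero]
      rw [e]
      rw [gb_zero] at *
      linear_combination q * h1
    | succ m =>
      have h1 := ih (m + 1)
      have h2 := ih m
      have e1 : gb q (n + 1 + 1) (m + 1 + 1)
          = gb q (n + 1) (m + 1) + q ^ (m + 1 + 1) * gb q (n + 1) (m + 1 + 1) := by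
        rw [gb]
      have e2 : gb q (n + 1) (m + 1) = gb q n m + q ^ (m + 1) * gb q n (m + 1) := by
        rw [gb]
      rw [e1]
      linear_combination q ^ (m + 2) * h1 + q * h2 - q * (1 - q ^ (n + 1)) * e2

theorem gb_vanish (q : F) (n : ℕ) (hn : orderOf q = n) (m : ℕ) (h0 : 0 < m) (h1 : m < n) :
    gb q n m = 0 := by
  obtain ⟨m, rfl⟩ : ∃ m', m = m' + 1 := ⟨m - 1, by omega⟩
  obtain ⟨n, rfl⟩ : ∃ n', n = n' + 1 := ⟨n - 1, by omega⟩
  have h := gb_absorb q n m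
  have hq : q ^ (n + 1) = 1 := by rw [← hn]; exact pow_orderOf_eq_one q
  rw [hq, sub_self, zero_mul] at h
  rcases mul_eq_zero.1 h with h | h
  · exact absurd (sub_eq_zero.1 h).symm (pow_ne_one_of_lt_orderOf (by omega) (by omega))
  · exact h

variable {B : Type} [Ring B] [Algebra F B]

theorem q_pow_comm (q : F) (x y : B) (h : y * x = q • (x * y)) (n : ℕ) :
    y * x ^ n = q ^ n • (x ^ n * y) := by
  induction n with
  | zero => simp
  | succ n ih =>
    rw [pow_succ, ← mul_assoc, ih, smul_mul_assoc, mul_assoc, h, mul_smul_comm, smul_smul,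
      mul_assoc, pow_succ]

theorem q_binom (q : F) (x y : B) (h : y * x = q • (x * y)) (n : ℕ) :
    (x + y) ^ n = ∑ m ∈ Finset.range (n + 1), gb q n m • (x ^ m * y ^ (n - m)) := by
  induction n with
  | zero => simp [gb]
  | succ n ih =>
    rw [pow_succ', ih, add_mul, Finset.mul_sum, Finset.mul_sum]
    have hx : ∀ m ∈ Finset.range (n + 1), x * (gb q n m • (x ^ m * y ^ (n - m)))
        = gb q n m • (x ^ (m + 1) * y ^ (n - m)) := by
      intro m _
      rw [mul_smul_comm, ← mul_assoc, pow_succ']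
    have hy : ∀ m ∈ Finset.range (n + 1), y * (gb q n m • (x ^ m * y ^ (n - m)))
        = (q ^ m * gb q n m) • (x ^ m * y ^ (n + 1 - m)) := by
      intro m hm
      have hm' : n + 1 - m = (n - m) + 1 := by
        have := Finset.mem_range.1 hm
        omega
      rw [mul_smul_comm, ← mul_assoc, q_pow_comm q x y h, smul_mul_assoc, smul_smul, mul_assoc,
        hm', pow_succ' y, mul_comm]
    rw [Finset.sum_congr rfl hx, Finset.sum_congr rfl hy]
    have hy2 : ∑ m ∈ Finset.range (n + 1), (q ^ m * gb q n m) • (x ^ m * y ^ (n + 1 - m))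
        = ∑ m ∈ Finset.range (n + 2), (q ^ m * gb q n m) • (x ^ m * y ^ (n + 1 - m)) := by
      rw [Finset.sum_range_succ _ (n + 1), gb_of_lt q n (n + 1) (by omega)]
      simp
    rw [hy2, Finset.sum_range_succ' _ (n + 1), Finset.sum_range_succ' _ (n + 1), ← add_assoc,
      ← Finset.sum_add_distrib]
    congr 1
    · refine Finset.sum_congr rfl fun m _ => ?_
      rw [gb, Nat.add_sub_add_right, add_smul]
    · simp [gb_zero]

theorem q_freshman (q : F) (x y : B) (h : y * x = q • (x * y)) (n : ℕ) (hn : orderOf q = n)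
    (h0 : 0 < n) : (x + y) ^ n = x ^ n + y ^ n := by
  rw [q_binom q x y h, Finset.sum_range_succ, gb_self, one_smul, Nat.sub_self, pow_zero, mul_one]
  obtain ⟨n, rfl⟩ : ∃ n', n = n' + 1 := ⟨n - 1, by omega⟩
  rw [Finset.sum_range_succ', Finset.sum_eq_zero]
  · simp [gb_zero, add_comm]
  · intro m hm
    rw [gb_vanish q (n + 1) hn (m + 1) (by omega) (by have := Finset.mem_range.1 hm; omega),
      zero_smul]

theorem q_mul_pow (q : F) (x y : B) (h : y * x = q • (x * y)) (n : ℕ) :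
    (x * y) ^ n = q ^ (n * (n - 1) / 2) • (x ^ n * y ^ n) := by
  rw [← Finset.sum_range_id_mul_two, Nat.mul_div_cancel _ (by norm_num)]
  induction n with
  | zero => simp
  | succ n ih =>
    have hc : y ^ n * x = q ^ n • (x * y ^ n) := by
      clear ih
      induction n with
      | zero => simp
      | succ n ih =>
        rw [pow_succ', mul_assoc, ih, mul_smul_comm, ← mul_assoc, h, smul_mul_assoc, smul_smul,
          mul_assoc, pow_succ]
    rw [pow_succ, ih, Finset.sum_range_succ, smul_mul_assoc, mul_assoc, ← mul_assoc (y ^ n), hc,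
      smul_mul_assoc, mul_smul_comm, smul_smul, ← pow_add, mul_assoc, ← mul_assoc, ← pow_succ,
      ← pow_succ]

theorem q_sign (q : F) (n : ℕ) (hn : orderOf q = n) (h0 : 0 < n) :
    (-1 : F) ^ n * q ^ (n * (n - 1) / 2) = -1 := by
  have hq : q ^ n = 1 := by rw [← hn]; exact pow_orderOf_eq_one q
  rcases Nat.even_or_odd' n with ⟨c, hc | hc⟩
  · have e : n * (n - 1) / 2 = c * (n - 1) := by
      rw [hc, mul_assoc, Nat.mul_div_cancel_left _ (by norm_num)]
    have hcq : q ^ c = -1 := by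
      have h2 : (q ^ c) ^ 2 = 1 := by rw [← pow_mul, mul_comm, ← hc, hq]
      rcases (mul_self_eq_one_iff.1 (by rw [← sq]; exact h2) : q ^ c = 1 ∨ q ^ c = -1) with h | h
      · exact absurd h (pow_ne_one_of_lt_orderOf (by omega) (by omega))
      · exact h
    rw [e, pow_mul, hcq, Even.neg_one_pow ⟨c, by omega⟩, Odd.neg_one_pow ⟨c - 1, by omega⟩, one_mul]
  · have e : n * (n - 1) / 2 = n * c := by
      have : n - 1 = 2 * c := by omega
      rw [this, mul_left_comm, Nat.mul_div_cancel_left _ (by norm_num)]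
    rw [e, pow_mul, hq, one_pow, mul_one, Odd.neg_one_pow ⟨c, hc⟩]

/-- Left antipode axiom is multiplicative. -/
theorem antipode_left_mul (D : B →ₐ[F] B ⊗[F] B) (e : B →ₐ[F] F) (S : B →ₗ[F] B)
    (hS : ∀ x y, S (x * y) = S y * S x) (x y : B)
    (hx : LinearMap.mul' F B (TensorProduct.map S LinearMap.id (D x)) = e x • (1 : B))
    (hy : LinearMap.mul' F B (TensorProduct.map S LinearMap.id (D y)) = e y • (1 : B)) :
    LinearMap.mul' F B (TensorProduct.map S LinearMap.id (D (x * y))) = e (x * y) • (1 : B) := by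
  have key : ∀ (s : B ⊗[F] B) (c d : B),
      LinearMap.mul' F B (TensorProduct.map S LinearMap.id (s * c ⊗ₜ[F] d))
        = S c * LinearMap.mul' F B (TensorProduct.map S LinearMap.id s) * d := by
    intro s c d
    induction s using TensorProduct.induction_on with
    | zero => simp
    | tmul u v => simp [hS, mul_assoc]
    | add u v hu hv => simp only [add_mul, map_add, hu, hv, mul_add]
  have key2 : ∀ t : B ⊗[F] B,
      LinearMap.mul' F B (TensorProduct.map S LinearMap.id (D x * t))
        = e x • LinearMap.mul' F B (TensorProduct.map S LinearMap.id t) := by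
    intro t
    induction t using TensorProduct.induction_on with
    | zero => simp
    | tmul u v => rw [key, hx]; simp
    | add u v hu hv => simp only [mul_add, map_add, hu, hv, smul_add]
  rw [map_mul, key2, hy, smul_smul, map_mul]

/-- Right antipode axiom is multiplicative. -/
theorem antipode_right_mul (D : B →ₐ[F] B ⊗[F] B) (e : B →ₐ[F] F) (S : B →ₗ[F] B)
    (hS : ∀ x y, S (x * y) = S y * S x) (x y : B)
    (hx : LinearMap.mul' F B (TensorProduct.map LinearMap.id S (D x)) = e x • (1 : B))
    (hy : LinearMap.mul' F B (TensorProduct.map LinearMap.id S (D y)) = e y • (1 : B)) :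
    LinearMap.mul' F B (TensorProduct.map LinearMap.id S (D (x * y))) = e (x * y) • (1 : B) := by
  have key : ∀ (s : B ⊗[F] B) (c d : B),
      LinearMap.mul' F B (TensorProduct.map LinearMap.id S (c ⊗ₜ[F] d * s))
        = c * LinearMap.mul' F B (TensorProduct.map LinearMap.id S s) * S d := by
    intro s c d
    induction s using TensorProduct.induction_on with
    | zero => simp
    | tmul u v => simp [hS, mul_assoc]
    | add u v hu hv => simp only [add_mul, map_add, hu, hv, mul_add]
  have key2 : ∀ t : B ⊗[F] B,
      LinearMap.mul' F B (TensorProduct.map LinearMap.id S (t * D y))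
        = e y • LinearMap.mul' F B (TensorProduct.map LinearMap.id S t) := by
    intro t
    induction t using TensorProduct.induction_on with
    | zero => simp
    | tmul u v => rw [key, hy]; simp
    | add u v hu hv => simp only [add_mul, map_add, hu, hv, smul_add]
  rw [map_mul, key2, hx, smul_smul, map_mul, mul_comm]

end abstract_lemmas

section relations

set_option linter.unusedSectionVars false


variable (B : Type) [Ring B] [Algebra k B]

/-- A family of elements satisfying the defining relations. -/
structure IsModel (fa : Fin θ → B) (fG : Γ → B) : Prop where
  one : fG 1 = 1
  mul : ∀ h h', fG h * fG h' = fG (h * h')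
  comm : ∀ h i, fG h * fa i = (χ i h : k) • (fa i * fG h)
  pow : ∀ i, fa i ^ N i = μ i • (1 - fG (g i ^ N i))
  qcomm : ∀ i j, i < j → fa i * fa j = (χ j (g i) : k) • (fa j * fa i)
    + lamb i j • (1 - fG (g i * g j))

variable {k Γ θ g χ N μ lamb B}

theorem exists_lift {fa : Fin θ → B} {fG : Γ → B}
    (h : IsModel k Γ θ g χ N μ lamb B fa fG) :
    ∃ f : A k Γ θ g χ N μ lamb →ₐ[k] B,
      (∀ i, f (a k Γ θ g χ N μ lamb i) = fa i) ∧ ∀ x, f (G k Γ θ g χ N μ lamb x) = fG x := by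
  have hr : ∀ ⦃x y⦄, Rel k Γ θ g χ N μ lamb x y →
      FreeAlgebra.lift k (Sum.elim fa fG) x = FreeAlgebra.lift k (Sum.elim fa fG) y := by
    intro x y hxy
    cases hxy with
    | group_one => simp [h.one]
    | group_mul u v => simp [h.mul]
    | group_comm u i => simp [h.comm]
    | pow i => simp [h.pow]
    | lift_qcomm i j hij => simp [h.qcomm i j hij]
  refine ⟨RingQuot.liftAlgHom k ⟨FreeAlgebra.lift k (Sum.elim fa fG), hr⟩, ?_, ?_⟩
  · intro i; simp [a]
  · intro i; simp [G]

theorem isModel_A : IsModel k Γ θ g χ N μ lamb (A k Γ θ g χ N μ lamb)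
    (a k Γ θ g χ N μ lamb) (G k Γ θ g χ N μ lamb) where
  one := by
    have := RingQuot.mkAlgHom_rel k (Rel.group_one (k := k) (Γ := Γ) (θ := θ) (g := g) (χ := χ) (N := N) (μ := μ) (lamb := lamb))
    simp only [map_mul, map_one, map_pow, map_sub, map_add, map_smul] at this
    exact this
  mul h h' := by
    have := RingQuot.mkAlgHom_rel k (Rel.group_mul (k := k) (Γ := Γ) (θ := θ) (g := g) (χ := χ) (N := N) (μ := μ) (lamb := lamb) h h')
    simp only [map_mul, map_one, map_pow, map_sub, map_add, map_smul] at this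
    exact this
  comm h i := by
    have := RingQuot.mkAlgHom_rel k (Rel.group_comm (k := k) (Γ := Γ) (θ := θ) (g := g) (χ := χ) (N := N) (μ := μ) (lamb := lamb) h i)
    simp only [map_mul, map_one, map_pow, map_sub, map_add, map_smul] at this
    exact this
  pow i := by
    have := RingQuot.mkAlgHom_rel k (Rel.pow (k := k) (Γ := Γ) (θ := θ) (g := g) (χ := χ) (N := N) (μ := μ) (lamb := lamb) i)
    simp only [map_mul, map_one, map_pow, map_sub, map_add, map_smul] at this
    exact this
  qcomm i j hij := by
    have := RingQuot.mkAlgHom_rel k (Rel.lift_qcomm (k := k) (Γ := Γ) (θ := θ) (g := g) (χ := χ) (N := N) (μ := μ) (lamb := lamb) i j hij)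
    simp only [map_mul, map_one, map_pow, map_sub, map_add, map_smul] at this
    exact this

theorem A_hom_ext {B : Type} [Semiring B] [Algebra k B] {f f' : A k Γ θ g χ N μ lamb →ₐ[k] B}
    (h1 : ∀ i, f (a k Γ θ g χ N μ lamb i) = f' (a k Γ θ g χ N μ lamb i))
    (h2 : ∀ i, f (G k Γ θ g χ N μ lamb i) = f' (G k Γ θ g χ N μ lamb i)) : f = f' := by
  apply RingQuot.ringQuot_ext'
  apply FreeAlgebra.hom_ext
  funext i
  rcases i with i | i
  · exact h1 i
  · exact h2 i

theorem A_induction (P : A k Γ θ g χ N μ lamb → Prop)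
    (hs : ∀ c : k, P (c • 1))
    (ha : ∀ i, P (a k Γ θ g χ N μ lamb i)) (hG : ∀ i, P (G k Γ θ g χ N μ lamb i))
    (hadd : ∀ x y, P x → P y → P (x + y)) (hmul : ∀ x y, P x → P y → P (x * y)) (x) : P x := by
  obtain ⟨x, rfl⟩ := RingQuot.mkAlgHom_surjective k _ x
  induction x using FreeAlgebra.induction with
  | grade0 r =>
    rw [AlgHom.commutes, Algebra.algebraMap_eq_smul_one]
    exact hs r
  | grade1 i =>
    rcases i with i | i
    · exact ha i
    · exact hG i
  | mul x y hx hy => rw [map_mul]; exact hmul _ _ hx hy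
  | add x y hx hy => rw [map_add]; exact hadd _ _ hx hy

theorem IsModel.comm' {fa : Fin θ → B} {fG : Γ → B}
    (H : IsModel k Γ θ g χ N μ lamb B fa fG) (h : Γ) (i : Fin θ) :
    fa i * fG h = (χ i h⁻¹ : k) • (fG h * fa i) := by
  rw [H.comm, smul_smul, ← Units.val_mul, ← map_mul]
  simp

theorem IsModel.gpow {fa : Fin θ → B} {fG : Γ → B}
    (H : IsModel k Γ θ g χ N μ lamb B fa fG) (h : Γ) (n : ℕ) :
    fG h ^ n = fG (h ^ n) := by
  induction n with
  | zero => simp [H.one]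
  | succ n ih => rw [pow_succ, ih, H.mul, pow_succ]

theorem IsModel.cancel {fa : Fin θ → B} {fG : Γ → B}
    (H : IsModel k Γ θ g χ N μ lamb B fa fG) (i : Fin θ) :
    fa i + fG (g i) * -(fG (g i)⁻¹ * fa i) = 0 := by
  rw [mul_neg, ← mul_assoc, H.mul, mul_inv_cancel, H.one, one_mul, add_neg_cancel]

theorem isModel_counit (hN1 : ∀ i, 1 < N i) :
    IsModel k Γ θ g χ N μ lamb k (fun _ => 0) (fun _ => 1) where
  one := rfl
  mul _ _ := by simp
  comm _ _ := by simp
  pow i := by simp [(show N i ≠ 0 by have := hN1 i; omega)]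
  qcomm _ _ _ := by simp

theorem isModel_comul {fa : Fin θ → B} {fG : Γ → B}
    (H : IsModel k Γ θ g χ N μ lamb B fa fG)
    (hcompat : ∀ i j, i ≠ j → χ i (g j) * χ j (g i) = 1)
    (hN : ∀ i, N i = orderOf (χ i (g i))) (hN1 : ∀ i, 1 < N i) :
    IsModel k Γ θ g χ N μ lamb (B ⊗[k] B)
      (fun i => fa i ⊗ₜ[k] (1 : B) + fG (g i) ⊗ₜ[k] fa i) (fun h => fG h ⊗ₜ[k] fG h) where
  one := by rw [H.one]; rfl
  mul h h' := by rw [Algebra.TensorProduct.tmul_mul_tmul, H.mul]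
  comm h i := by
    simp only [mul_add, add_mul, Algebra.TensorProduct.tmul_mul_tmul, H.comm, H.mul, smul_add,
      TensorProduct.smul_tmul', TensorProduct.tmul_smul, mul_one, one_mul, mul_comm h (g i)]
  pow i := by
    rw [q_freshman (χ i (g i) : k) _ _ _ (N i) (by rw [hN, orderOf_units])
      (by have := hN1 i; omega)]
    · rw [Algebra.TensorProduct.tmul_pow, Algebra.TensorProduct.tmul_pow, one_pow, H.pow, H.gpow,
        Algebra.TensorProduct.one_def]
      simp only [TensorProduct.tmul_smul, ← TensorProduct.smul_tmul', TensorProduct.sub_tmul,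
        TensorProduct.tmul_sub, ← smul_add]
      congr 1
      abel
    · simp only [Algebra.TensorProduct.tmul_mul_tmul, H.comm, mul_one, one_mul,
        TensorProduct.smul_tmul']
  qcomm i j hij := by
    have hc : (χ i (g j)⁻¹ : k) = (χ j (g i) : k) := by
      rw [map_inv, inv_eq_of_mul_eq_one_right (hcompat i j hij.ne)]
    have e1 : (fG (g i) * fa j) ⊗ₜ[k] fa i = (χ j (g i) : k) • ((fa j * fG (g i)) ⊗ₜ[k] fa i) := by
      rw [H.comm, TensorProduct.smul_tmul']
    have e2 : (fa i * fG (g j)) ⊗ₜ[k] fa j = (χ j (g i) : k) • ((fG (g j) * fa i) ⊗ₜ[k] fa j) := by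
      rw [H.comm', TensorProduct.smul_tmul', hc]
    simp only [mul_add, add_mul, Algebra.TensorProduct.tmul_mul_tmul, mul_one, one_mul, e1, e2,
      H.qcomm i j hij, H.mul, mul_comm (g j) (g i), Algebra.TensorProduct.one_def,
      TensorProduct.tmul_add, TensorProduct.add_tmul, TensorProduct.tmul_sub,
      TensorProduct.sub_tmul, TensorProduct.tmul_smul, ← TensorProduct.smul_tmul', smul_add,
      smul_sub]
    abel

theorem isModel_antipode {fa : Fin θ → B} {fG : Γ → B}
    (H : IsModel k Γ θ g χ N μ lamb B fa fG)
    (hcompat : ∀ i j, i ≠ j → χ i (g j) * χ j (g i) = 1)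
    (hN : ∀ i, N i = orderOf (χ i (g i))) (hN1 : ∀ i, 1 < N i) :
    IsModel k Γ θ g χ N μ lamb Bᵐᵒᵖ
      (fun i => MulOpposite.op (-(fG (g i)⁻¹ * fa i))) (fun h => MulOpposite.op (fG h⁻¹)) where
  one := by simp [H.one]
  mul h h' := by
    rw [← MulOpposite.op_mul, H.mul]
    simp [mul_comm]
  comm h i := by
    rw [← MulOpposite.op_mul, ← MulOpposite.op_mul, ← MulOpposite.op_smul]
    congr 1
    rw [neg_mul, mul_neg, mul_assoc, H.comm', mul_smul_comm, ← mul_assoc, ← mul_assoc, H.mul, H.mul,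
      inv_inv, smul_neg, mul_comm (g i)⁻¹]
  pow i := by
    have h1 : fa i * fG (g i)⁻¹ = (χ i (g i) : k) • (fG (g i)⁻¹ * fa i) := by
      rw [H.comm', inv_inv]
    rw [← MulOpposite.op_pow, ← MulOpposite.op_one, ← MulOpposite.op_sub, ← MulOpposite.op_smul]
    congr 1
    have h2 := q_mul_pow (χ i (g i) : k) _ _ h1 (N i)
    have h3 := q_sign (χ i (g i) : k) (N i) (by rw [hN, orderOf_units])
      (by have := hN1 i; omega)
    have h4 : (-(fG (g i)⁻¹ * fa i)) = (-1 : k) • (fG (g i)⁻¹ * fa i) := by simp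
    rw [h4, smul_pow, h2, smul_smul, h3, H.pow, H.gpow, mul_smul_comm, mul_sub, H.mul, inv_pow,
      inv_mul_cancel, H.one, mul_one, neg_one_smul, ← smul_neg, neg_sub]
  qcomm i j hij := by
    have hc : (χ j (g i) : k) * (χ i (g j) : k) = 1 := by
      rw [← Units.val_mul, mul_comm, hcompat i j hij.ne, Units.val_one]
    have e : ∀ u v, fG (g u)⁻¹ * fa u * (fG (g v)⁻¹ * fa v)
        = (χ u (g v) : k) • (fG (g u * g v)⁻¹ * (fa u * fa v)) := by
      intro u v
      rw [mul_assoc, ← mul_assoc (fa u), H.comm', inv_inv, smul_mul_assoc, mul_smul_comm,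
        ← mul_assoc, ← mul_assoc, H.mul, mul_inv, mul_assoc]
    rw [← MulOpposite.op_mul, ← MulOpposite.op_mul, ← MulOpposite.op_one, ← MulOpposite.op_sub,
      ← MulOpposite.op_smul, ← MulOpposite.op_smul, ← MulOpposite.op_add]
    congr 1
    rw [neg_mul_neg, neg_mul_neg, e, e, smul_smul, hc, one_smul, H.qcomm i j hij, mul_add,
      mul_smul_comm, mul_smul_comm, mul_sub, H.mul, inv_mul_cancel, H.one, mul_one,
      mul_comm (g j) (g i), smul_sub, smul_sub]
    abel

end relations

local notation "Hh" => A k Γ θ g χ N μ lamb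
local notation "aa" => a k Γ θ g χ N μ lamb
local notation "Gg" => G k Γ θ g χ N μ lamb

/-- Andruskiewitsch–Schneider.  For a datum of a quantum linear
space and a compatible datum `D = (μ, λ)`, the algebra `A(Γ,R,D)` admits a Hopf
algebra structure over `k` whose comultiplication satisfies `Δ(G h) = G h ⊗ G h`
and `Δ(a i) = a i ⊗ 1 + G (g i) ⊗ a i`, and whose counit satisfies `ε(G h) = 1`
and `ε(a i) = 0`. -/
theorem lifting_is_hopf_algebra
    (hθ : 1 ≤ θ)
    (hq : ∀ i, χ i (g i) ≠ 1)
    (hcompat : ∀ i j, i ≠ j → χ i (g j) * χ j (g i) = 1)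
    (hN : ∀ i, N i = orderOf (χ i (g i))) (hN1 : ∀ i, 1 < N i)
    -- `(μ, λ)` is a compatible datum:
    (hμ01 : ∀ i, μ i = 0 ∨ μ i = 1)
    (hμ : ∀ i, μ i = 0 ∨ (g i ^ N i ≠ 1 ∧ ∀ f : Γ, (χ i f) ^ N i = 1))
    (hlamb : ∀ i j : Fin θ, i < j →
      (lamb i j = 0 ∨ (g i * g j ≠ 1 ∧ ∀ f : Γ, χ i f * χ j f = 1))) :
    ∃ (Δ : Hh →ₐ[k] Hh ⊗[k] Hh) (ε : Hh →ₐ[k] k) (antipode : Hh →ₗ[k] Hh),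
      -- coassociativity
      ((Algebra.TensorProduct.assoc k k k Hh Hh Hh).toAlgHom.comp
          ((Algebra.TensorProduct.map Δ (AlgHom.id k Hh)).comp Δ) =
        (Algebra.TensorProduct.map (AlgHom.id k Hh) Δ).comp Δ) ∧
      -- counit axioms
      ((Algebra.TensorProduct.lid k Hh).toAlgHom.comp
          ((Algebra.TensorProduct.map ε (AlgHom.id k Hh)).comp Δ) = AlgHom.id k Hh) ∧
      ((Algebra.TensorProduct.rid k k Hh).toAlgHom.comp
          ((Algebra.TensorProduct.map (AlgHom.id k Hh) ε).comp Δ) = AlgHom.id k Hh) ∧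
      -- antipode axioms
      (∀ x : Hh, LinearMap.mul' k Hh
          (TensorProduct.map antipode LinearMap.id (Δ x)) = ε x • (1 : Hh)) ∧
      (∀ x : Hh, LinearMap.mul' k Hh
          (TensorProduct.map LinearMap.id antipode (Δ x)) = ε x • (1 : Hh)) ∧
      -- values on the generators
      (∀ h : Γ, Δ (Gg h) = Gg h ⊗ₜ[k] Gg h) ∧
      (∀ i : Fin θ, Δ (aa i) = aa i ⊗ₜ[k] (1 : Hh) + Gg (g i) ⊗ₜ[k] aa i) ∧
      (∀ h : Γ, ε (Gg h) = 1) ∧ (∀ i : Fin θ, ε (aa i) = 0) := by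
  have HA := isModel_A (k := k) (Γ := Γ) (θ := θ) (g := g) (χ := χ) (N := N) (μ := μ) (lamb := lamb)
  obtain ⟨Δ, hΔa, hΔG⟩ := exists_lift (isModel_comul HA hcompat hN hN1)
  obtain ⟨ε, hεa, hεG⟩ := exists_lift
    (isModel_counit (k := k) (Γ := Γ) (θ := θ) (g := g) (χ := χ) (N := N) (μ := μ)
      (lamb := lamb) hN1)
  obtain ⟨S, hSa, hSG⟩ := exists_lift (isModel_antipode HA hcompat hN hN1)
  let T : Hh →ₗ[k] Hh := (MulOpposite.opLinearEquiv k).symm.toLinearMap ∘ₗ S.toLinearMap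
  have hT : ∀ x, T x = MulOpposite.unop (S x) := fun x => rfl
  have hTm : ∀ x y, T (x * y) = T y * T x := by
    intro x y
    simp only [hT, map_mul, MulOpposite.unop_mul]
  have hT1 : T 1 = 1 := by simp only [hT, map_one, MulOpposite.unop_one]
  have hTa : ∀ i, T (aa i) = -(Gg (g i)⁻¹ * aa i) := by
    intro i; rw [hT, hSa, MulOpposite.unop_op]
  have hTG : ∀ h, T (Gg h) = Gg h⁻¹ := by
    intro i; rw [hT, hSG, MulOpposite.unop_op]
  clear_value T
  refine ⟨Δ, ε, T, ?_, ?_, ?_, ?_, ?_, hΔG, hΔa, hεG, hεa⟩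
  · apply A_hom_ext
    · intro i
      simp [hΔa, hΔG, TensorProduct.add_tmul, TensorProduct.tmul_add,
        Algebra.TensorProduct.one_def, add_assoc]
    · intro h
      simp [hΔG]
  · apply A_hom_ext
    · intro i
      simp [hΔa, hεa, hεG]
    · intro h
      simp [hΔG, hεG]
  · apply A_hom_ext
    · intro i
      simp [hΔa, hεa, hεG]
    · intro h
      simp [hΔG, hεG]
  · apply A_induction
    · intro c
      simp [Algebra.TensorProduct.one_def, hT1]
    · intro i
      simp [hΔa, hεa, hTa, hTG]
    · intro h
      simp [hΔG, hεG, hTG, HA.mul, HA.one]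
    · intro x y hx hy
      simp only [map_add, hx, hy, add_smul]
    · exact fun x y hx hy => antipode_left_mul Δ ε T hTm x y hx hy
  · apply A_induction
    · intro c
      simp [Algebra.TensorProduct.one_def, hT1]
    · intro i
      simp [hΔa, hεa, hTa, hT1]
      exact HA.cancel i
    · intro h
      simp [hΔG, hεG, hTG, HA.mul, HA.one]
    · intro x y hx hy
      simp only [map_add, hx, hy, add_smul]
    · exact fun x y hx hy => antipode_right_mul Δ ε T hTm x y hx hy

end QLSLift

end
end

section
/- (Skryabin) Let A be a finite-dimensional H-simple left H-comodule algebra and M a finite-dimensional (H,A)-Hopf module. Then there exists an integer t ≥ 1 such that the direct sum M^{⊕t} of t copies of M is a free right A-module; i.e. there exist t ≥ 1 and n ≥ 0 with M^{⊕t} ≅ A^{⊕n} as right A-modules. -/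
open scoped TensorProduct

noncomputable section

namespace Skryabin

variable {k : Type*} [Field k]
variable {H : Type*} [Ring H] [HopfAlgebra k H]
variable {A : Type*} [Ring A] [Algebra k A]
variable {M : Type*} [AddCommGroup M] [Module k M] [Module Aᵐᵒᵖ M]
  [SMulCommClass k Aᵐᵒᵖ M] [IsScalarTower k Aᵐᵒᵖ M]

/-- The right `A`-action on `M` as a `k`-bilinear map `M →ₗ A →ₗ M`,
`(m, a) ↦ m·a`. -/
def actLin (k A M : Type*) [Field k] [Ring A] [Algebra k A] [AddCommGroup M]
    [Module k M] [Module Aᵐᵒᵖ M] [SMulCommClass k Aᵐᵒᵖ M]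
    [IsScalarTower k Aᵐᵒᵖ M] : M →ₗ[k] A →ₗ[k] M where
  toFun m :=
    { toFun := fun a => MulOpposite.op a • m
      map_add' := fun a b => by
        simp only [MulOpposite.op_add, add_smul]
      map_smul' := fun c a => by
        simp only [MulOpposite.op_smul, RingHom.id_apply, smul_assoc] }
  map_add' m m' := by
    ext a
    show MulOpposite.op a • (m + m') = MulOpposite.op a • m + MulOpposite.op a • m'
    exact smul_add _ _ _
  map_smul' c m := by
    ext a
    show MulOpposite.op a • (c • m) = c • (MulOpposite.op a • m)
    exact (smul_comm c (MulOpposite.op a) m).symm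

/-- The `k`-bilinear multiplication `(H ⊗ M) × (H ⊗ A) → H ⊗ M`,
`(h ⊗ m, h' ⊗ a) ↦ h·h' ⊗ m·a`. -/
def hopfModMul (k H A M : Type*) [Field k] [Ring H] [Algebra k H] [Ring A]
    [Algebra k A] [AddCommGroup M] [Module k M] [Module Aᵐᵒᵖ M]
    [SMulCommClass k Aᵐᵒᵖ M] [IsScalarTower k Aᵐᵒᵖ M] :
    (H ⊗[k] M) →ₗ[k] (H ⊗[k] A) →ₗ[k] (H ⊗[k] M) :=
  TensorProduct.curry
    ((TensorProduct.map (LinearMap.mul' k H) (TensorProduct.lift (actLin k A M))) ∘ₗ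
      (TensorProduct.tensorTensorTensorComm k H M H A).toLinearMap)

section HelperA
open Coalgebra HopfAlgebra WithConv
theorem algHom_ext_antipode {k H B : Type*} [Field k] [Ring H] [HopfAlgebra k H] [Ring B] [Algebra k B]
    (f g : H →ₐ[k] B) (h : f.toLinearMap ∘ₗ antipode k = g.toLinearMap ∘ₗ antipode k) : f = g := by
  have key : ∀ f : H →ₐ[k] B,
      toConv f.toLinearMap * toConv (f.toLinearMap ∘ₗ antipode k) = 1 ∧
      toConv (f.toLinearMap ∘ₗ antipode k) * toConv f.toLinearMap = 1 := by
    intro f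
    constructor
    · ext x
      rw [(ℛ k x).convMul_apply]
      have := congrArg f (sum_mul_antipode_eq_algebraMap_counit (ℛ k x))
      simpa [map_sum] using this
    · ext x
      rw [(ℛ k x).convMul_apply]
      have := congrArg f (sum_antipode_mul_eq_algebraMap_counit (ℛ k x))
      simpa [map_sum] using this
  have e : toConv f.toLinearMap = toConv g.toLinearMap := by
    refine left_inv_eq_right_inv (key f).1 ?_
    rw [h]; exact (key g).2
  have e2 : f.toLinearMap = g.toLinearMap := toConv_injective e
  exact AlgHom.toLinearMap_injective e2

def opComp {k H B : Type*} [Field k] [Ring H] [HopfAlgebra k H] [Ring B] [Algebra k B]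
    (f : H →ₐ[k] B) : H →ₐ[k] Bᵐᵒᵖ :=
  AlgHom.ofLinearMap ((MulOpposite.opLinearEquiv k).toLinearMap ∘ₗ f.toLinearMap ∘ₗ antipode k)
    (by simp) (by intro x y; simp [antipode_mul_antidistrib])

theorem algHom_ext_antipode_pow {k H : Type*} [Field k] [Ring H] [HopfAlgebra k H] (n : ℕ) :
    ∀ {B : Type _} [Ring B] [Algebra k B]
    (f g : H →ₐ[k] B) (_ : f.toLinearMap ∘ₗ (antipode k ^ n : Module.End k H)
      = g.toLinearMap ∘ₗ (antipode k ^ n : Module.End k H)), f = g := by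
  induction n with
  | zero => intro B _ _ f g h; exact AlgHom.toLinearMap_injective h
  | succ n ih =>
    intro B _ _ f g h
    have h2 := ih (opComp f) (opComp g) (by
      ext x
      have := LinearMap.congr_fun h x
      rw [pow_succ'] at this
      exact congrArg MulOpposite.op this)
    apply algHom_ext_antipode
    ext x
    have := congrArg MulOpposite.unop (AlgHom.congr_fun h2 x)
    exact this

theorem antipode_pow_two_mul {k H : Type*} [Field k] [Ring H] [HopfAlgebra k H] (n : ℕ) (x y : H) :
    (antipode k ^ (2 * n) : Module.End k H) (x * y) =
     (antipode k ^ (2 * n) : Module.End k H) x * (antipode k ^ (2 * n) : Module.End k H) y := by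
  induction n with
  | zero => simp
  | succ n ih =>
    have : 2 * (n + 1) = (2 * n + 1) + 1 := by ring
    simp only [this, pow_succ', Module.End.mul_apply, ih, antipode_mul_antidistrib]

theorem antipode_pow_one {k H : Type*} [Field k] [Ring H] [HopfAlgebra k H] (n : ℕ) :
    (antipode k ^ n : Module.End k H) 1 = 1 := by
  induction n with
  | zero => simp
  | succ n ih => simp [pow_succ', Module.End.mul_apply, ih]

theorem antipode_injective {k H : Type*} [Field k] [Ring H] [HopfAlgebra k H]
    [FiniteDimensional k H] : Function.Injective (antipode k (A := H)) := by
  let S : Module.End k H := antipode k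
  obtain ⟨n0, hn0⟩ := Filter.eventually_atTop.mp <| S.eventually_isCompl_ker_pow_range_pow
  obtain ⟨N, hN, hpos⟩ : ∃ N, n0 ≤ 2 * N ∧ 1 ≤ N := ⟨n0 + 1, by omega, by omega⟩
  have hc := hn0 _ hN
  set τ : Module.End k H := S ^ (2 * N) with hτ
  have hmul : ∀ x y, τ (x * y) = τ x * τ y := antipode_pow_two_mul N
  have dec : ∀ x : H, ∃ y, τ (x - τ y) = 0 := by
    intro x
    have : x ∈ LinearMap.ker τ ⊔ LinearMap.range τ := by rw [hc.sup_eq_top]; trivial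
    obtain ⟨a, ha, b, ⟨y, rfl⟩, rfl⟩ := Submodule.mem_sup.mp this
    exact ⟨y, by simpa using ha⟩
  have uniq : ∀ x y, τ (τ x - τ y) = 0 → τ x = τ y := by
    intro x y h
    have : τ (x - y) ∈ LinearMap.ker τ ⊓ LinearMap.range τ :=
      ⟨by simpa using h, ⟨_, rfl⟩⟩
    rw [hc.inf_eq_bot] at this
    have : τ (x - y) = 0 := this
    rwa [map_sub, sub_eq_zero] at this
  choose j hj using dec
  let π : H →ₐ[k] H := AlgHom.ofLinearMap
    { toFun := fun x => τ (j x)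
      map_add' := fun x y => by
        rw [← map_add]
        apply uniq
        have h1 := hj x; have h2 := hj y; have h3 := hj (x + y)
        simp only [map_sub, map_add, sub_eq_zero] at *
        rw [← h1, ← h2, ← h3]
      map_smul' := fun c x => by
        simp only [RingHom.id_apply]
        rw [← map_smul]
        apply uniq
        have h1 := hj x; have h3 := hj (c • x)
        simp only [map_sub, map_smul, sub_eq_zero] at *
        rw [← h1, ← h3] }
    (by
      have h1 : τ 1 = 1 := antipode_pow_one _
      have : τ (j 1) = τ 1 := by
        apply uniq
        have := hj 1
        simp only [map_sub, sub_eq_zero, h1] at *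
        rw [← this]
      simpa [h1] using this)
    (by
      intro x y
      show τ (j (x * y)) = τ (j x) * τ (j y)
      rw [← hmul]
      apply uniq
      have h1 := hj x; have h2 := hj y; have h3 := hj (x * y)
      simp only [map_sub, hmul, sub_eq_zero] at *
      rw [← h1, ← h2, ← h3])
  have hπ : AlgHom.id k H = π := by
    apply algHom_ext_antipode_pow (2 * N)
    ext x
    show τ x = τ (j (τ x))
    apply uniq
    have := hj (τ x)
    simpa only [map_sub] using this
  have hτinj : ∀ x, τ x = 0 → x = 0 := by
    intro x hx
    have h1 : x = τ (j x) := AlgHom.congr_fun hπ x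
    have h2 := hj x
    have : τ (j x) = τ 0 := by
      apply uniq
      simp only [map_sub, sub_eq_zero, hx, map_zero] at *
      exact h2.symm
    rw [h1, this, map_zero]
  rw [injective_iff_map_eq_zero]
  intro x hx
  apply hτinj
  obtain ⟨M, hM⟩ : ∃ M, 2 * N = M + 1 := ⟨2 * N - 1, by omega⟩
  rw [hτ, hM, pow_succ, Module.End.mul_apply]
  have : S x = 0 := hx
  rw [this, map_zero]

theorem exists_inv_antipode {k H : Type*} [Field k] [Ring H] [HopfAlgebra k H]
    [FiniteDimensional k H] : ∃ T : H →ₗ[k] H, 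
      (LinearMap.mul' k H) ∘ₗ (TensorProduct.map LinearMap.id T) ∘ₗ
        (TensorProduct.comm k H H).toLinearMap ∘ₗ (comul (R := k)) =
      Algebra.linearMap k H ∘ₗ counit := by
  have hinj := antipode_injective (k := k) (H := H)
  let e := LinearEquiv.ofInjectiveEndo (antipode k (A := H)) hinj
  refine ⟨e.symm.toLinearMap, ?_⟩
  have he : ∀ x, antipode k (e.symm x) = x := fun x => e.apply_symm_apply x
  ext x
  apply hinj
  have h1 := sum_mul_antipode_eq_algebraMap_counit (ℛ k x)
  conv_lhs => simp only [LinearMap.comp_apply]; rw [← (ℛ k x).eq]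
  simp only [map_sum, LinearEquiv.coe_coe, TensorProduct.comm_tmul, TensorProduct.map_tmul,
    LinearMap.mul'_apply, antipode_mul_antidistrib, he, LinearMap.id_apply, h1,
    LinearMap.comp_apply, Algebra.linearMap_apply, Algebra.algebraMap_eq_smul_one, map_smul,
    antipode_one]
end HelperA

theorem finite_hom (k R N S : Type*) [Field k] [Ring R] [Algebra k R]
    [AddCommGroup N] [Module k N] [Module R N] [IsScalarTower k R N]
    [AddCommGroup S] [Module k S] [Module R S] [IsScalarTower k R S]
    [FiniteDimensional k N] [FiniteDimensional k S] : FiniteDimensional k (N →ₗ[R] S) :=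
  FiniteDimensional.of_injective (LinearMap.restrictScalarsₗ k R N S k)
    (LinearMap.restrictScalars_injective k)

theorem finrank_hom_le (k R N S : Type*) [Field k] [Ring R] [Algebra k R]
    [AddCommGroup N] [Module k N] [Module R N] [IsScalarTower k R N]
    [AddCommGroup S] [Module k S] [Module R S] [IsScalarTower k R S]
    [FiniteDimensional k N] [FiniteDimensional k S] :
    Module.finrank k (N →ₗ[R] S) ≤ Module.finrank k N * Module.finrank k S := by
  rw [← Module.finrank_linearMap k k N S]
  exact LinearMap.finrank_le_finrank_of_injective
    (f := LinearMap.restrictScalarsₗ k R N S k) (LinearMap.restrictScalars_injective k)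

theorem exists_surj (k R N : Type*) [Field k] [Ring R] [Algebra k R] [FiniteDimensional k R]
    [AddCommGroup N] [Module k N] [Module R N] [IsScalarTower k R N] [FiniteDimensional k N]
    (r : ℕ) (h : ∀ m : Ideal R, m.IsMaximal →
      Module.finrank k (N →ₗ[R] (R ⧸ m)) ≤ r * Module.finrank k (R ⧸ m)) :
    ∃ p : (Fin r → R) →ₗ[R] N, Function.Surjective p := by
  classical
  have : IsArtinian R N := isArtinian_of_tower k inferInstance
  have : IsNoetherian R N := isNoetherian_of_tower k inferInstance
  have : IsSemisimpleModule R (N ⧸ Module.jacobson R N) := by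
    rw [IsArtinian.isSemisimpleModule_iff_jacobson]
    exact Module.jacobson_quotient_jacobson R N
  set Q := N ⧸ Module.jacobson R N with hQ
  have main : ∃ f : (Fin r → R) →ₗ[R] Q, LinearMap.range f = ⊤ := by
    obtain ⟨_, ⟨f, rfl⟩, hf⟩ := (wellFounded_gt (α := Submodule R Q)).has_min
      (Set.range fun f : (Fin r → R) →ₗ[R] Q => LinearMap.range f) ⟨_, 0, rfl⟩
    refine ⟨f, ?_⟩
    by_contra hne
    obtain ⟨m', hm', hle⟩ := (eq_top_or_exists_le_coatom (LinearMap.range f)).resolve_left hne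
    have : IsSimpleModule R (Q ⧸ m') := isSimpleModule_iff_isCoatom.mpr hm'
    obtain ⟨m, hm, ⟨e⟩⟩ := isSimpleModule_iff_quot_maximal.mp this
    have hs : IsSimpleModule R (R ⧸ m) := isSimpleModule_iff_quot_maximal.mpr ⟨m, hm, ⟨.refl _ _⟩⟩
    let q : Q →ₗ[R] (R ⧸ m) := e.toLinearMap ∘ₗ m'.mkQ
    have hqs : Function.Surjective q := e.surjective.comp (Submodule.mkQ_surjective _)
    have hqf : ∀ x, q (f x) = 0 := by
      intro x
      have : m'.mkQ (f x) = 0 := by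
        simpa using hle ⟨x, rfl⟩
      simp only [q, LinearMap.comp_apply, this, map_zero]
    obtain ⟨ι, hι⟩ : ∃ ι : (R ⧸ m) →ₗ[R] Q, q ∘ₗ ι = LinearMap.id := by
      obtain ⟨C, hC⟩ := exists_isCompl (LinearMap.ker q)
      have hb : Function.Bijective (q.domRestrict C) := by
        constructor
        · rw [← LinearMap.ker_eq_bot, LinearMap.ker_domRestrict, ← Submodule.disjoint_iff_comap_eq_bot]
          exact hC.disjoint.symm
        · rw [← LinearMap.range_eq_top, LinearMap.range_domRestrict]
          have : Submodule.map q (LinearMap.ker q ⊔ C) = ⊤ := by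
            rw [hC.sup_eq_top, Submodule.map_top, LinearMap.range_eq_top.mpr hqs]
          have hz : Submodule.map q (LinearMap.ker q) = ⊥ := by
            rw [Submodule.eq_bot_iff]
            rintro _ ⟨x, hx, rfl⟩
            exact hx
          rw [Submodule.map_sup, hz, bot_sup_eq] at this
          exact this
      let E := LinearEquiv.ofBijective _ hb
      refine ⟨C.subtype ∘ₗ E.symm.toLinearMap, ?_⟩
      refine LinearMap.ext fun x => ?_
      exact E.apply_symm_apply x
    have hι' : ∀ x, q (ι x) = x := fun x => LinearMap.congr_fun hι x
    have := finite_hom k R N (R ⧸ m)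
    have : FiniteDimensional k Q := inferInstance
    have := finite_hom k R Q (R ⧸ m)
    have := finite_hom k R (Fin r → R) (R ⧸ m)
    have hdim : Module.finrank k (Q →ₗ[R] (R ⧸ m)) ≤
        Module.finrank k ((Fin r → R) →ₗ[R] (R ⧸ m)) := by
      have h1 : Module.finrank k ((Fin r → R) →ₗ[R] (R ⧸ m)) = r * Module.finrank k (R ⧸ m) := by
        rw [← ((Pi.basisFun R (Fin r)).constr k (M' := R ⧸ m)).finrank_eq, Module.finrank_pi_fintype]
        simp
      rw [h1]
      refine le_trans ?_ (h m hm)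
      exact LinearMap.finrank_le_finrank_of_injective
        (f := LinearMap.lcomp k (R ⧸ m) ((Module.jacobson R N).mkQ)) (by
          intro a b hab
          refine LinearMap.ext fun x => ?_
          obtain ⟨x, rfl⟩ := Submodule.mkQ_surjective _ x
          exact LinearMap.congr_fun hab x)
    have hnot : ¬ Function.Surjective (LinearMap.lcomp k (R ⧸ m) f) := by
      intro hsurj
      have h2 := LinearMap.injective_iff_surjective_of_finrank_eq_finrank
        (f := LinearMap.lcomp k (R ⧸ m) f)
        (le_antisymm hdim (LinearMap.finrank_le_finrank_of_surjective hsurj))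
      have h3 := h2.mpr hsurj
      have : q = 0 := h3 (by ext x; simp [hqf])
      have hnt : Nontrivial (R ⧸ m) := IsSimpleModule.nontrivial R _
      obtain ⟨s, hs⟩ := exists_ne (0 : R ⧸ m)
      obtain ⟨y, rfl⟩ := hqs s
      exact hs (by rw [this]; rfl)
    rw [Function.Surjective] at hnot
    push Not at hnot
    obtain ⟨g, hg⟩ := hnot
    have hker : ¬ LinearMap.ker f ≤ LinearMap.ker g := by
      intro hk
      obtain ⟨C, hC⟩ := exists_isCompl (LinearMap.range f)
      let g1 : ((Fin r → R) ⧸ LinearMap.ker f) →ₗ[R] (R ⧸ m) := (LinearMap.ker f).liftQ g hk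
      let g2 : LinearMap.range f →ₗ[R] (R ⧸ m) := g1 ∘ₗ f.quotKerEquivRange.symm.toLinearMap
      refine hg (g2 ∘ₗ (LinearMap.range f).projectionOnto C hC) ?_
      refine LinearMap.ext fun x => ?_
      have h1 : (LinearMap.range f).projectionOnto C hC (f x) = ⟨f x, ⟨x, rfl⟩⟩ :=
        Submodule.projectionOnto_apply_left hC ⟨f x, ⟨x, rfl⟩⟩
      simp only [LinearMap.lcomp_apply, LinearMap.comp_apply, h1, g2, g1]
      have h2 : f.quotKerEquivRange.symm ⟨f x, ⟨x, rfl⟩⟩ = (LinearMap.ker f).mkQ x := by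
        rw [LinearEquiv.symm_apply_eq]; rfl
      simp only [LinearEquiv.coe_coe, h2]
      rfl
    have hmap : (LinearMap.ker f).map g = ⊤ := by
      refine (eq_bot_or_eq_top _).resolve_left ?_
      intro hb
      apply hker
      intro x hx
      have : g x ∈ (LinearMap.ker f).map g := ⟨x, hx, rfl⟩
      rw [hb] at this
      exact this
    have hιr : ∀ s, ι s ∈ LinearMap.range (f + ι ∘ₗ g) := by
      intro s
      have : s ∈ (LinearMap.ker f).map g := by rw [hmap]; trivial
      obtain ⟨x, hx, rfl⟩ := this
      have hx' : f x = 0 := hx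
      exact ⟨x, by simp [hx']⟩
    refine hf (LinearMap.range (f + ι ∘ₗ g)) ⟨_, rfl⟩ ?_
    show LinearMap.range f < LinearMap.range (f + ι ∘ₗ g)
    rw [SetLike.lt_iff_le_and_exists]
    constructor
    · rintro _ ⟨y, rfl⟩
      have : f y = (f + ι ∘ₗ g) y - ι (g y) := by simp
      rw [this]
      exact Submodule.sub_mem _ ⟨y, rfl⟩ (hιr _)
    · have hnt : Nontrivial (R ⧸ m) := IsSimpleModule.nontrivial R _
      obtain ⟨s, hs⟩ := exists_ne (0 : R ⧸ m)
      refine ⟨ι s, hιr s, ?_⟩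
      rintro ⟨x, hx⟩
      apply hs
      rw [← hι' s, ← hx, hqf]
  obtain ⟨f, hf⟩ := main
  obtain ⟨p, hp⟩ := Module.projective_lifting_property (Module.jacobson R N).mkQ f
    (Submodule.mkQ_surjective _)
  refine ⟨p, ?_⟩
  rw [← LinearMap.range_eq_top]
  by_contra hne
  obtain ⟨m', hm', hle⟩ := (eq_top_or_exists_le_coatom (LinearMap.range p)).resolve_left hne
  have hj : Module.jacobson R N ≤ m' := sInf_le hm'
  apply hm'.1
  rw [eq_top_iff]
  intro x _
  have : (Module.jacobson R N).mkQ x ∈ LinearMap.range f := by rw [hf]; trivial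
  obtain ⟨y, hy⟩ := this
  rw [← hp] at hy
  have h1 : p y - x ∈ Module.jacobson R N := (Submodule.Quotient.eq _).mp hy
  have h2 := m'.sub_mem (hle ⟨y, rfl⟩) (hj h1)
  simpa using h2

theorem exists_max_ratio {X : Type*} (P : X → Prop) (hP : ∃ x, P x) (c d : X → ℕ) (C D : ℕ)
    (hc : ∀ x, c x ≤ C) (hd : ∀ x, d x ≤ D) (hpos : ∀ x, P x → 1 ≤ d x) :
    ∃ x, P x ∧ ∀ y, P y → d x * c y ≤ c x * d y := by
  have hfin : ((fun m => (c m, d m)) '' {m | P m}).Finite := by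
    refine ((Set.finite_Iic C).prod (Set.finite_Iic D)).subset ?_
    rintro _ ⟨m, _, rfl⟩
    exact ⟨hc m, hd m⟩
  obtain ⟨m0, hm0⟩ := hP
  obtain ⟨_, ⟨m, hm, rfl⟩, hmax⟩ := Set.exists_max_image _ (fun x : ℕ × ℕ => (x.1 : ℚ) / x.2) hfin
    ⟨_, m0, hm0, rfl⟩
  refine ⟨m, hm, ?_⟩
  intro m' hm'
  have h1 := hmax _ ⟨m', hm', rfl⟩
  have p1 : (0 : ℚ) < d m' := by exact_mod_cast hpos m' hm'
  have p2 : (0 : ℚ) < d m := by exact_mod_cast hpos m hm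
  simp only at h1
  rw [div_le_div_iff₀ p1 p2] at h1
  have h2 : c m' * d m ≤ c m * d m' := by exact_mod_cast h1
  rwa [mul_comm]

theorem finrank_pi_hom (k R M S : Type*) [Field k] [Ring R] [Algebra k R]
    [AddCommGroup M] [Module k M] [Module R M] [IsScalarTower k R M] [FiniteDimensional k M]
    [AddCommGroup S] [Module k S] [Module R S] [IsScalarTower k R S] [FiniteDimensional k S]
    (t : ℕ) :
    Module.finrank k ((Fin t → M) →ₗ[R] S) = t * Module.finrank k (M →ₗ[R] S) := by
  have := finite_hom k R M S
  have e := LinearEquiv.finrank_eq (LinearMap.lsum (M := S) R (fun _ : Fin t => M) k)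
  rw [← e, Module.finrank_pi_fintype]
  simp

theorem exists_max (k R M : Type*) [Field k] [Ring R] [Algebra k R] [FiniteDimensional k R]
    [Nontrivial R]
    [AddCommGroup M] [Module k M] [Module R M] [IsScalarTower k R M] [FiniteDimensional k M] :
    ∃ m : Ideal R, m.IsMaximal ∧ 
      ∃ t r : ℕ, 1 ≤ t ∧ t = Module.finrank k (R ⧸ m) ∧ r = Module.finrank k (M →ₗ[R] (R ⧸ m)) ∧
      ∃ p : (Fin r → R) →ₗ[R] (Fin t → M), Function.Surjective p := by
  have hd : ∀ m : Ideal R, Module.finrank k (R ⧸ m) ≤ Module.finrank k R := by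
    intro m
    have hs : Function.Surjective ((Submodule.mkQ m).restrictScalars k) := by
      rw [LinearMap.coe_restrictScalars]
      exact Submodule.mkQ_surjective m
    exact LinearMap.finrank_le_finrank_of_surjective hs
  have hdpos : ∀ m : Ideal R, m.IsMaximal → 1 ≤ Module.finrank k (R ⧸ m) := by
    intro m hm
    have : Nontrivial (R ⧸ m) := Submodule.Quotient.nontrivial_iff.mpr hm.ne_top
    exact Module.finrank_pos
  obtain ⟨m, hm, hmax⟩ := exists_max_ratio (fun m : Ideal R => m.IsMaximal)
    (Ideal.exists_maximal R)
    (fun m => Module.finrank k (M →ₗ[R] (R ⧸ m))) (fun m => Module.finrank k (R ⧸ m)) _ _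
    (fun m => (finrank_hom_le k R M (R ⧸ m)).trans (Nat.mul_le_mul_left _ (hd m))) hd hdpos
  refine ⟨m, hm, _, _, hdpos m hm, rfl, rfl, ?_⟩
  apply exists_surj k
  intro m' hm'
  rw [finrank_pi_hom]
  exact hmax m' hm'

theorem hopfModMul_tmul (h h' : H) (m : M) (a : A) :
    hopfModMul k H A M (h ⊗ₜ m) (h' ⊗ₜ a) = (h * h') ⊗ₜ[k] (MulOpposite.op a • m) := by
  simp [hopfModMul, actLin]

theorem hopfModMul_mul (x : H ⊗[k] M) (y z : H ⊗[k] A) :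
    hopfModMul k H A M x (y * z) = hopfModMul k H A M (hopfModMul k H A M x y) z := by
  induction x with
  | zero => simp
  | add a b ha hb => simp only [map_add, LinearMap.add_apply, ha, hb]
  | tmul h m =>
    induction y with
    | zero => simp
    | add a b ha hb => simp only [map_add, LinearMap.add_apply, add_mul, ha, hb]
    | tmul h' a =>
      induction z with
      | zero => simp
      | add a b ha hb => simp only [map_add, mul_add, ha, hb]
      | tmul h'' a' =>
        rw [Algebra.TensorProduct.tmul_mul_tmul, hopfModMul_tmul, hopfModMul_tmul, hopfModMul_tmul,
          mul_assoc, MulOpposite.op_mul, mul_smul]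

theorem map_hopfModMul {S : Type*} [AddCommGroup S] [Module k S] [Module Aᵐᵒᵖ S]
    [SMulCommClass k Aᵐᵒᵖ S] [IsScalarTower k Aᵐᵒᵖ S] (g : H) (f : M →ₗ[Aᵐᵒᵖ] S)
    (x : H ⊗[k] M) (y : H ⊗[k] A) :
    TensorProduct.map (LinearMap.mulLeft k g) (f.restrictScalars k) (hopfModMul k H A M x y) =
      hopfModMul k H A S
        (TensorProduct.map (LinearMap.mulLeft k g) (f.restrictScalars k) x) y := by
  induction x with
  | zero => simp
  | add a b ha hb => simp only [map_add, LinearMap.add_apply, ha, hb]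
  | tmul h m =>
    induction y with
    | zero => simp
    | add a b ha hb => simp only [map_add, ha, hb]
    | tmul h' a =>
      simp [hopfModMul_tmul, mul_assoc]

theorem recover [FiniteDimensional k H] (δ : M →ₗ[k] H ⊗[k] M)
    (hδcoassoc : (TensorProduct.assoc k H H M).toLinearMap ∘ₗ
        (TensorProduct.map (Coalgebra.comul (R := k) (A := H)) LinearMap.id) ∘ₗ δ =
      (TensorProduct.map LinearMap.id δ) ∘ₗ δ)
    (hδcounit : (TensorProduct.lid k M).toLinearMap ∘ₗ
        (TensorProduct.map (Coalgebra.counit (R := k) (A := H)) LinearMap.id) ∘ₗ δ =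
      LinearMap.id)
    {S : Type*} [AddCommGroup S] [Module k S] {ι : Type*} [Fintype ι] (b : ι → H)
    (f : ι → M →ₗ[k] S)
    (h0 : ∀ m, ∑ j, TensorProduct.map (LinearMap.mulLeft k (b j)) (f j) (δ m) = 0) (m : M) :
    ∑ j, b j ⊗ₜ[k] f j m = 0 := by
  obtain ⟨T, hT⟩ := exists_inv_antipode (k := k) (H := H)
  -- `G (g ⊗ (h ⊗ x)) = h T(g) ⊗ x`
  let G : ∀ (X : Type _) [AddCommGroup X] [Module k X], H ⊗[k] (H ⊗[k] X) →ₗ[k] H ⊗[k] X :=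
    fun X _ _ => (TensorProduct.map (LinearMap.mul' k H ∘ₗ (TensorProduct.map LinearMap.id T) ∘ₗ
      (TensorProduct.comm k H H).toLinearMap) LinearMap.id) ∘ₗ
      (TensorProduct.assoc k H H X).symm.toLinearMap
  let G' : H ⊗[k] (H ⊗[k] S) →ₗ[k] H ⊗[k] S :=
    (TensorProduct.map (LinearMap.mul' k H ∘ₗ (TensorProduct.map LinearMap.id T) ∘ₗ
      (TensorProduct.comm k H H).toLinearMap) LinearMap.id) ∘ₗ
      (TensorProduct.assoc k H H S).symm.toLinearMap
  have hG : G M ∘ₗ (TensorProduct.map LinearMap.id δ) ∘ₗ δ =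
      TensorProduct.mk k H M 1 := by
    rw [← hδcoassoc]
    have h1 : G M ∘ₗ (TensorProduct.assoc k H H M).toLinearMap ∘ₗ
        (TensorProduct.map (Coalgebra.comul (R := k) (A := H)) LinearMap.id) =
        TensorProduct.mk k H M 1 ∘ₗ (TensorProduct.lid k M).toLinearMap ∘ₗ
          (TensorProduct.map (Coalgebra.counit (R := k) (A := H)) LinearMap.id) := by
      ext x m
      have h2 := LinearMap.congr_fun hT x
      simp only [LinearMap.comp_apply] at h2
      simp only [G, TensorProduct.AlgebraTensorModule.curry_apply, TensorProduct.curry_apply,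
        LinearMap.coe_restrictScalars, LinearMap.comp_apply, TensorProduct.map_tmul,
        LinearEquiv.coe_coe, LinearEquiv.symm_apply_apply, LinearMap.id_apply,
        TensorProduct.lid_tmul, TensorProduct.mk_apply]
      simp only [LinearEquiv.coe_coe] at h2
      rw [h2, Algebra.linearMap_apply, Algebra.algebraMap_eq_smul_one, TensorProduct.smul_tmul]
    have h3 : G M ∘ₗ (TensorProduct.assoc k H H M).toLinearMap ∘ₗ
        (TensorProduct.map (Coalgebra.comul (R := k) (A := H)) LinearMap.id) ∘ₗ δ =
      (G M ∘ₗ (TensorProduct.assoc k H H M).toLinearMap ∘ₗ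
        (TensorProduct.map (Coalgebra.comul (R := k) (A := H)) LinearMap.id)) ∘ₗ δ := rfl
    rw [h3, h1]
    have h4 : (TensorProduct.mk k H M 1 ∘ₗ (TensorProduct.lid k M).toLinearMap ∘ₗ
          (TensorProduct.map (Coalgebra.counit (R := k) (A := H)) LinearMap.id)) ∘ₗ δ =
        TensorProduct.mk k H M 1 ∘ₗ ((TensorProduct.lid k M).toLinearMap ∘ₗ
          (TensorProduct.map (Coalgebra.counit (R := k) (A := H)) LinearMap.id) ∘ₗ δ) := rfl
    rw [h4, hδcounit, LinearMap.comp_id]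
  have hnat : ∀ j, (TensorProduct.map (LinearMap.mulLeft k (b j)) (f j)) ∘ₗ G M =
      G' ∘ₗ TensorProduct.map LinearMap.id
        (TensorProduct.map (LinearMap.mulLeft k (b j)) (f j)) := by
    intro j
    ext g h m
    simp [G, G', mul_assoc]
  have hz : (∑ j, TensorProduct.map (LinearMap.mulLeft k (b j)) (f j)) ∘ₗ δ = 0 := by
    ext m
    simpa using h0 m
  have h5 : ∑ j, b j ⊗ₜ[k] f j m =
      ∑ j, TensorProduct.map (LinearMap.mulLeft k (b j)) (f j)
        ((G M ∘ₗ (TensorProduct.map LinearMap.id δ) ∘ₗ δ) m) := by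
    rw [hG]; simp
  have h6 : ∀ j, TensorProduct.map (LinearMap.mulLeft k (b j)) (f j)
        ((G M ∘ₗ (TensorProduct.map LinearMap.id δ) ∘ₗ δ) m) =
      G' (TensorProduct.map LinearMap.id
        (TensorProduct.map (LinearMap.mulLeft k (b j)) (f j) ∘ₗ δ) (δ m)) := by
    intro j
    have := LinearMap.congr_fun (hnat j) (TensorProduct.map LinearMap.id δ (δ m))
    simp only [LinearMap.comp_apply] at this ⊢
    rw [this, ← LinearMap.comp_apply (TensorProduct.map _ _) (TensorProduct.map _ _),
      ← TensorProduct.map_comp, LinearMap.id_comp]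
  rw [h5, Finset.sum_congr rfl (fun j _ => h6 j), ← map_sum, ← LinearMap.sum_apply]
  have h7 : ∑ j, TensorProduct.map (LinearMap.id : H →ₗ[k] H)
        (TensorProduct.map (LinearMap.mulLeft k (b j)) (f j) ∘ₗ δ) =
      TensorProduct.map LinearMap.id
        ((∑ j, TensorProduct.map (LinearMap.mulLeft k (b j)) (f j)) ∘ₗ δ) := by
    refine TensorProduct.ext' fun h x => ?_
    simp [LinearMap.sum_apply, TensorProduct.tmul_sum]
  rw [h7, hz]
  simp

theorem basis_left_zero {N S : Type*} [AddCommGroup N] [Module k N] [AddCommGroup S] [Module k S]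
    {ι : Type*} [Fintype ι] (b : Module.Basis ι k N) (c : ι → S)
    (h : ∑ j, b j ⊗ₜ[k] c j = 0) (j : ι) : c j = 0 := by
  have h1 := TensorProduct.sum_tmul_basis_left_eq_zero b (Finsupp.equivFunOnFinite.symm c) (by
    rw [Finsupp.sum_fintype _ _ (by simp)]
    simpa using h)
  simpa using DFunLike.congr_fun h1 j

theorem ann_zero [FiniteDimensional k H]
    (lam : A →ₐ[k] H ⊗[k] A)
    (hcoassoc : (TensorProduct.assoc k H H A).toLinearMap ∘ₗ
        (TensorProduct.map (Coalgebra.comul (R := k) (A := H)) LinearMap.id) ∘ₗ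
        lam.toLinearMap =
      (TensorProduct.map LinearMap.id lam.toLinearMap) ∘ₗ lam.toLinearMap)
    (hsimple : ∀ J : Submodule Aᵐᵒᵖ A,
      (∀ x ∈ J, lam x ∈
        Submodule.span k {u : H ⊗[k] A | ∃ (h : H) (y : A), y ∈ J ∧ u = h ⊗ₜ[k] y}) →
      J = ⊥ ∨ J = ⊤)
    {S : Type*} [AddCommGroup S] [Module k S] [Module Aᵐᵒᵖ S]
    [SMulCommClass k Aᵐᵒᵖ S] [IsScalarTower k Aᵐᵒᵖ S] [Nontrivial S] (a : A)
    (ha : ∀ s : S, hopfModMul k H A S (1 ⊗ₜ s) (lam a) = 0) : a = 0 := by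
  have hL : ∀ (s : S) (y : H ⊗[k] A), hopfModMul k H A S (1 ⊗ₜ s) y =
      TensorProduct.map LinearMap.id (actLin k A S s) y := by
    intro s y
    induction y with
    | zero => simp
    | add a b ha hb => simp only [map_add, ha, hb]
    | tmul h' a => simp [hopfModMul_tmul, actLin]
  let J : Submodule Aᵐᵒᵖ A :=
    { carrier := {a | ∀ s : S, hopfModMul k H A S (1 ⊗ₜ s) (lam a) = 0}
      add_mem' := by
        intro x y hx hy s
        rw [map_add, map_add, hx, hy, add_zero]
      zero_mem' := by intro s; simp
      smul_mem' := by
        intro c x hx s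
        have : c • x = x * c.unop := rfl
        rw [this, map_mul, hopfModMul_mul, hx]
        simp }
  have hJ : J = ⊥ ∨ J = ⊤ := by
    apply hsimple
    intro x hx
    let b := Module.finBasis k H
    obtain ⟨c, hc⟩ : ∃ c : Fin (Module.finrank k H) → A, lam x = ∑ j, b j ⊗ₜ[k] c j := by
      obtain ⟨c, hc⟩ := TensorProduct.eq_repr_basis_left b (lam x)
      refine ⟨c, ?_⟩
      rw [← hc, Finsupp.sum_fintype _ _ (by simp)]
    have hcJ : ∀ j, c j ∈ J := by
      intro j s
      have h1 := LinearMap.congr_fun hcoassoc x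
      have h2 := congrArg (TensorProduct.map (LinearMap.id : H →ₗ[k] H)
        (TensorProduct.map (LinearMap.id : H →ₗ[k] H) (actLin k A S s))) h1
      have h3 : (TensorProduct.map (LinearMap.id : H →ₗ[k] H)
        (TensorProduct.map (LinearMap.id : H →ₗ[k] H) (actLin k A S s))) ∘ₗ
          (TensorProduct.assoc k H H A).toLinearMap ∘ₗ
        (TensorProduct.map (Coalgebra.comul (R := k) (A := H)) LinearMap.id) =
          (TensorProduct.assoc k H H S).toLinearMap ∘ₗ
        (TensorProduct.map (Coalgebra.comul (R := k) (A := H)) LinearMap.id) ∘ₗ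
          (TensorProduct.map LinearMap.id (actLin k A S s)) := by
        rw [← LinearMap.comp_assoc, TensorProduct.map_map_comp_assoc_eq, LinearMap.comp_assoc,
          ← TensorProduct.map_comp, ← TensorProduct.map_comp, TensorProduct.map_id]
        simp
      have h4 := LinearMap.congr_fun h3 (lam x)
      simp only [LinearMap.comp_apply, AlgHom.toLinearMap_apply] at h2 h4
      have hx' := hx s
      rw [hL] at hx'
      rw [h2, hx', map_zero, map_zero, hc] at h4
      simp only [map_sum, TensorProduct.map_tmul, LinearMap.id_apply,
        AlgHom.toLinearMap_apply] at h4
      rw [hL]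
      exact basis_left_zero b _ h4 j
    rw [hc]
    exact Submodule.sum_mem _ fun j _ => Submodule.subset_span ⟨_, _, hcJ j, rfl⟩
  have haJ : a ∈ J := ha
  rcases hJ with h | h
  · rw [h] at haJ; exact haJ
  · exfalso
    have h1 : (1 : A) ∈ J := by rw [h]; trivial
    obtain ⟨s, hs⟩ := exists_ne (0 : S)
    have h2 := h1 s
    rw [map_one, Algebra.TensorProduct.one_def, hopfModMul_tmul] at h2
    have h3 := congrArg (TensorProduct.lid k S)
      (congrArg (TensorProduct.map (Coalgebra.counit (R := k) (A := H)) LinearMap.id) h2)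
    simp at h3
    exact hs h3

theorem core [FiniteDimensional k H] [FiniteDimensional k A] [FiniteDimensional k M]
    (lam : A →ₐ[k] H ⊗[k] A)
    (hcoassoc : (TensorProduct.assoc k H H A).toLinearMap ∘ₗ
        (TensorProduct.map (Coalgebra.comul (R := k) (A := H)) LinearMap.id) ∘ₗ
        lam.toLinearMap =
      (TensorProduct.map LinearMap.id lam.toLinearMap) ∘ₗ lam.toLinearMap)
    (hsimple : ∀ J : Submodule Aᵐᵒᵖ A,
      (∀ x ∈ J, lam x ∈
        Submodule.span k {u : H ⊗[k] A | ∃ (h : H) (y : A), y ∈ J ∧ u = h ⊗ₜ[k] y}) →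
      J = ⊥ ∨ J = ⊤)
    (δ : M →ₗ[k] H ⊗[k] M)
    (hδcoassoc : (TensorProduct.assoc k H H M).toLinearMap ∘ₗ
        (TensorProduct.map (Coalgebra.comul (R := k) (A := H)) LinearMap.id) ∘ₗ δ =
      (TensorProduct.map LinearMap.id δ) ∘ₗ δ)
    (hδcounit : (TensorProduct.lid k M).toLinearMap ∘ₗ
        (TensorProduct.map (Coalgebra.counit (R := k) (A := H)) LinearMap.id) ∘ₗ δ =
      LinearMap.id)
    (hδcompat : ∀ (m : M) (a : A),
      δ (MulOpposite.op a • m) = hopfModMul k H A M (δ m) (lam a))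
    {S : Type*} [AddCommGroup S] [Module k S] [Module Aᵐᵒᵖ S]
    [SMulCommClass k Aᵐᵒᵖ S] [IsScalarTower k Aᵐᵒᵖ S] [Nontrivial S] [FiniteDimensional k S]
    (t r : ℕ) (ht : t = Module.finrank k S) (hr : r = Module.finrank k (M →ₗ[Aᵐᵒᵖ] S))
    (p : (Fin r → Aᵐᵒᵖ) →ₗ[Aᵐᵒᵖ] (Fin t → M)) (hp : Function.Surjective p) :
    Function.Injective p := by
  classical
  let b := Module.finBasis k H
  set d := Module.finrank k H with hd
  have := finite_hom k Aᵐᵒᵖ M S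
  let F : (Fin t → Fin d → (M →ₗ[Aᵐᵒᵖ] S)) → (Fin t → M) → H ⊗[k] S := fun f n =>
    ∑ s, ∑ j, TensorProduct.map (LinearMap.mulLeft k (b j)) ((f s j).restrictScalars k) (δ (n s))
  have hFadd : ∀ f n n', F f (n + n') = F f n + F f n' := by
    intro f n n'
    simp only [F, Pi.add_apply, map_add, Finset.sum_add_distrib]
  have hFsmul : ∀ f n (c : Aᵐᵒᵖ), F f (c • n) = hopfModMul k H A S (F f n) (lam c.unop) := by
    intro f n c
    simp only [F, Pi.smul_apply, map_sum, LinearMap.sum_apply]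
    refine Finset.sum_congr rfl fun s _ => Finset.sum_congr rfl fun j _ => ?_
    rw [← map_hopfModMul, ← hδcompat, MulOpposite.op_unop]
  let e : Fin r → (Fin t → M) := fun i => p (Pi.single i 1)
  have hpe : ∀ u, p u = ∑ i, u i • e i := by
    intro u
    conv_lhs => rw [pi_eq_sum_univ' u]
    simp only [map_sum, map_smul, e]
  have hFp : ∀ f u, F f (p u) = ∑ i, hopfModMul k H A S (F f (e i)) (lam (u i).unop) := by
    intro f u
    let Fh : (Fin t → M) →+ H ⊗[k] S := AddMonoidHom.mk' (F f) (hFadd f)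
    rw [hpe]
    have := map_sum Fh (fun i => u i • e i) Finset.univ
    refine this.trans (Finset.sum_congr rfl fun i _ => hFsmul f _ _)
  let E : (Fin t → Fin d → (M →ₗ[Aᵐᵒᵖ] S)) →ₗ[k] (Fin r → H ⊗[k] S) :=
    { toFun := fun f i => F f (e i)
      map_add' := by
        intro f g
        ext i
        simp only [F, Pi.add_apply, ← Finset.sum_add_distrib]
        refine Finset.sum_congr rfl fun s _ => Finset.sum_congr rfl fun j _ => ?_
        rw [LinearMap.restrictScalars_add, TensorProduct.map_add_right, LinearMap.add_apply]
      map_smul' := by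
        intro c f
        ext i
        simp only [F, Pi.smul_apply, Finset.smul_sum, RingHom.id_apply]
        refine Finset.sum_congr rfl fun s _ => Finset.sum_congr rfl fun j _ => ?_
        rw [← LinearMap.smul_apply, ← TensorProduct.map_smul_right]
        rfl }
  have hEinj : Function.Injective E := by
    rw [injective_iff_map_eq_zero]
    intro f hf
    have h1 : ∀ n, F f n = 0 := by
      intro n
      obtain ⟨u, rfl⟩ := hp n
      rw [hFp]
      refine Finset.sum_eq_zero fun i _ => ?_
      have : F f (e i) = 0 := congrFun hf i
      rw [this]; simp
    ext s j m
    have h2 : ∀ m, ∑ j, TensorProduct.map (LinearMap.mulLeft k (b j))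
        ((f s j).restrictScalars k) (δ m) = 0 := by
      intro m
      have := h1 (Pi.single s m)
      simp only [F] at this
      rw [Finset.sum_eq_single s] at this
      · simpa using this
      · intro s' _ hs'
        refine Finset.sum_eq_zero fun j _ => ?_
        rw [Pi.single_eq_of_ne hs', map_zero, map_zero]
      · simp
    have h3 := recover δ hδcoassoc hδcounit b _ h2 m
    exact basis_left_zero b _ h3 j
  have hEsurj : Function.Surjective E := by
    rw [← LinearMap.injective_iff_surjective_of_finrank_eq_finrank]
    · exact hEinj
    · rw [Module.finrank_pi_fintype, Module.finrank_pi_fintype]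
      simp only [Module.finrank_pi_fintype, Module.finrank_tensorProduct, Finset.sum_const,
        Finset.card_univ, Fintype.card_fin, smul_eq_mul]
      rw [← hr, ← ht, ← hd]
      ring
  rw [injective_iff_map_eq_zero]
  intro u hu
  ext1 i
  have : (u i).unop = 0 := by
    apply ann_zero lam hcoassoc hsimple (S := S)
    intro s
    obtain ⟨f, hf⟩ := hEsurj (Pi.single i (1 ⊗ₜ s))
    have hf' : ∀ j, F f (e j) = (Pi.single i (1 ⊗ₜ s) : Fin r → H ⊗[k] S) j :=
      fun j => congrFun hf j
    have h1 := hFp f u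
    rw [hu, Finset.sum_eq_single i] at h1
    · rw [hf', Pi.single_eq_same] at h1
      rw [← h1]
      simp [F]
    · intro j _ hj
      rw [hf', Pi.single_eq_of_ne hj]; simp
    · simp
  exact MulOpposite.unop_injective this

/-- Skryabin.  Let `H` be a finite-dimensional Hopf algebra,
`A` a finite-dimensional `H`-simple left `H`-comodule algebra and `M` a
finite-dimensional `(H,A)`-Hopf module.  Then some direct sum `M^{⊕t}` (`t ≥ 1`)
of copies of `M` is a free right `A`-module. -/
theorem free_module_up_to_multiplicity
    [FiniteDimensional k H] [FiniteDimensional k A] [FiniteDimensional k M]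
    -- the comodule algebra structure on `A`:
    (lam : A →ₐ[k] H ⊗[k] A)
    (hcoassoc : (TensorProduct.assoc k H H A).toLinearMap ∘ₗ
        (TensorProduct.map (Coalgebra.comul (R := k) (A := H)) LinearMap.id) ∘ₗ
        lam.toLinearMap =
      (TensorProduct.map LinearMap.id lam.toLinearMap) ∘ₗ lam.toLinearMap)
    (hcounit : (TensorProduct.lid k A).toLinearMap ∘ₗ
        (TensorProduct.map (Coalgebra.counit (R := k) (A := H)) LinearMap.id) ∘ₗ
        lam.toLinearMap = LinearMap.id)
    -- `A` is `H`-simple: every `H`-costable right ideal is `0` or `A`: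
    (hsimple : ∀ J : Submodule Aᵐᵒᵖ A,
      (∀ x ∈ J, lam x ∈
        Submodule.span k {u : H ⊗[k] A | ∃ (h : H) (y : A), y ∈ J ∧ u = h ⊗ₜ[k] y}) →
      J = ⊥ ∨ J = ⊤)
    -- the `(H,A)`-Hopf module structure on `M`:
    (δ : M →ₗ[k] H ⊗[k] M)
    (hδcoassoc : (TensorProduct.assoc k H H M).toLinearMap ∘ₗ
        (TensorProduct.map (Coalgebra.comul (R := k) (A := H)) LinearMap.id) ∘ₗ δ =
      (TensorProduct.map LinearMap.id δ) ∘ₗ δ)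
    (hδcounit : (TensorProduct.lid k M).toLinearMap ∘ₗ
        (TensorProduct.map (Coalgebra.counit (R := k) (A := H)) LinearMap.id) ∘ₗ δ =
      LinearMap.id)
    (hδcompat : ∀ (m : M) (a : A),
      δ (MulOpposite.op a • m) = hopfModMul k H A M (δ m) (lam a)) :
    ∃ t : ℕ, 1 ≤ t ∧ ∃ n : ℕ,
      Nonempty ((Fin t → M) ≃ₗ[Aᵐᵒᵖ] (Fin n → A)) := by
  rcases subsingleton_or_nontrivial A with hA | hA
  · have : Subsingleton M := by
      refine ⟨fun x y => ?_⟩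
      have h1 : (1 : Aᵐᵒᵖ) = 0 := MulOpposite.unop_injective (Subsingleton.elim _ _)
      rw [← one_smul Aᵐᵒᵖ x, ← one_smul Aᵐᵒᵖ y, h1, zero_smul, zero_smul]
    exact ⟨1, le_rfl, 1, ⟨{ (0 : (Fin 1 → M) →ₗ[Aᵐᵒᵖ] (Fin 1 → A)) with
      invFun := 0
      left_inv := fun _ => Subsingleton.elim _ _
      right_inv := fun _ => Subsingleton.elim _ _ }⟩⟩
  · obtain ⟨m, hm, t, r, ht1, ht, hr, p, hp⟩ := exists_max k Aᵐᵒᵖ M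
    have : Nontrivial (Aᵐᵒᵖ ⧸ m) := Submodule.Quotient.nontrivial_iff.mpr hm.ne_top
    have hinj := core lam hcoassoc hsimple δ hδcoassoc hδcounit hδcompat (S := Aᵐᵒᵖ ⧸ m)
      t r ht hr p hp
    let e1 := LinearEquiv.ofBijective p ⟨hinj, hp⟩
    let e2 : Aᵐᵒᵖ ≃ₗ[Aᵐᵒᵖ] A :=
      { toFun := MulOpposite.unop
        invFun := MulOpposite.op
        map_add' := fun _ _ => rfl
        map_smul' := fun _ _ => rfl
        left_inv := fun _ => rfl
        right_inv := fun _ => rfl }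
    exact ⟨t, ht1, r, ⟨e1.symm.trans (LinearEquiv.piCongrRight fun _ => e2)⟩⟩

end Skryabin

end
end

section
/- There is a unique unital k-algebra homomorphism λ : A(V,F,ψ,ξ,α) → U ⊗ A(V,F,ψ,ξ,α) (the target carrying the tensor product algebra structure) such that λ(v_i) = X_i ⊗ 1 + G_{g_i} ⊗ v_i for 1 ≤ i ≤ θ and λ(e_f) = G_f ⊗ e_f for f ∈ F. Moreover λ is coassociative and counital: (Δ ⊗ id)∘λ = (id ⊗ λ)∘λ and (ε ⊗ id)∘λ = id (under the identification k ⊗ A(V,F,ψ,ξ,α) ≅ A(V,F,ψ,ξ,α)); thus A(V,F,ψ,ξ,α) is a left U-comodule algebra. -/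
open scoped TensorProduct

noncomputable section

namespace QLSComod

variable (k : Type) [Field k] [IsAlgClosed k] [CharZero k]
variable (Γ : Type) [CommGroup Γ] [Fintype Γ]
variable (θ : ℕ) (g : Fin θ → Γ) (χ : Fin θ → (Γ →* kˣ)) (N : Fin θ → ℕ)

/-- The relations presenting the bosonization `U = B(V) # kΓ` of a quantum linear
space. -/
inductive URel : FreeAlgebra k (Fin θ ⊕ Γ) → FreeAlgebra k (Fin θ ⊕ Γ) → Prop
  | group_one : URel (FreeAlgebra.ι k (Sum.inr (1 : Γ))) 1
  | group_mul (h h' : Γ) :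
      URel (FreeAlgebra.ι k (Sum.inr h) * FreeAlgebra.ι k (Sum.inr h'))
        (FreeAlgebra.ι k (Sum.inr (h * h')))
  | group_comm (h : Γ) (i : Fin θ) :
      URel (FreeAlgebra.ι k (Sum.inr h) * FreeAlgebra.ι k (Sum.inl i))
        ((χ i h : k) • (FreeAlgebra.ι k (Sum.inl i) * FreeAlgebra.ι k (Sum.inr h)))
  | nilpotent (i : Fin θ) : URel (FreeAlgebra.ι k (Sum.inl i) ^ N i) 0
  | qcomm (i j : Fin θ) (hij : i ≠ j) :
      URel (FreeAlgebra.ι k (Sum.inl i) * FreeAlgebra.ι k (Sum.inl j))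
        ((χ j (g i) : k) • (FreeAlgebra.ι k (Sum.inl j) * FreeAlgebra.ι k (Sum.inl i)))

/-- The bosonization `U`, presented by generators and relations. -/
abbrev U := RingQuot (URel k Γ θ g χ N)

/-- The generator `X i` of `U`. -/
def X (i : Fin θ) : U k Γ θ g χ N :=
  RingQuot.mkAlgHom k (URel k Γ θ g χ N) (FreeAlgebra.ι k (Sum.inl i))

/-- The group-like generator `G h` of `U`. -/
def G (h : Γ) : U k Γ θ g χ N :=
  RingQuot.mkAlgHom k (URel k Γ θ g χ N) (FreeAlgebra.ι k (Sum.inr h))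

variable (F : Subgroup Γ) (ψ : F → F → kˣ) (ξ : Fin θ → k) (α : Fin θ → Fin θ → k)

/-- The relations presenting the comodule algebra `A(V,F,ψ,ξ,α)`:
`e_1 = 1`, `e_f·e_h = ψ(f,h)·e_{fh}`, `e_f·v_i = χ_i(f)·v_i·e_f`,
`v_i·v_j − q_{ij}·v_j·v_i = α_{ij}·e_{g_i g_j}` if `g_i g_j ∈ F` and `= 0`
otherwise (`i < j`), and `v_i^{N_i} = ξ_i·e_{g_i^{N_i}}` if `g_i^{N_i} ∈ F` and
`= 0` otherwise. -/
inductive ARel : FreeAlgebra k (Fin θ ⊕ F) → FreeAlgebra k (Fin θ ⊕ F) → Prop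
  | e_one : ARel (FreeAlgebra.ι k (Sum.inr (1 : F))) 1
  | e_mul (f f' : F) :
      ARel (FreeAlgebra.ι k (Sum.inr f) * FreeAlgebra.ι k (Sum.inr f'))
        ((ψ f f' : k) • FreeAlgebra.ι k (Sum.inr (f * f')))
  | e_v (f : F) (i : Fin θ) :
      ARel (FreeAlgebra.ι k (Sum.inr f) * FreeAlgebra.ι k (Sum.inl i))
        ((χ i (f : Γ) : k) • (FreeAlgebra.ι k (Sum.inl i) * FreeAlgebra.ι k (Sum.inr f)))
  | v_comm_mem (i j : Fin θ) (hij : i < j) (hmem : g i * g j ∈ F) :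
      ARel (FreeAlgebra.ι k (Sum.inl i) * FreeAlgebra.ι k (Sum.inl j)
          - (χ j (g i) : k) • (FreeAlgebra.ι k (Sum.inl j) * FreeAlgebra.ι k (Sum.inl i)))
        (α i j • FreeAlgebra.ι k (Sum.inr ⟨g i * g j, hmem⟩))
  | v_comm_nmem (i j : Fin θ) (hij : i < j) (hnmem : g i * g j ∉ F) :
      ARel (FreeAlgebra.ι k (Sum.inl i) * FreeAlgebra.ι k (Sum.inl j)
          - (χ j (g i) : k) • (FreeAlgebra.ι k (Sum.inl j) * FreeAlgebra.ι k (Sum.inl i))) 0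
  | v_pow_mem (i : Fin θ) (hmem : g i ^ N i ∈ F) :
      ARel (FreeAlgebra.ι k (Sum.inl i) ^ N i)
        (ξ i • FreeAlgebra.ι k (Sum.inr ⟨g i ^ N i, hmem⟩))
  | v_pow_nmem (i : Fin θ) (hnmem : g i ^ N i ∉ F) :
      ARel (FreeAlgebra.ι k (Sum.inl i) ^ N i) 0

/-- The comodule algebra `A(V,F,ψ,ξ,α)`, presented by generators and relations. -/
abbrev A := RingQuot (ARel k Γ θ g χ N F ψ ξ α)

/-- The generator `v i` of `A(V,F,ψ,ξ,α)`. -/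
def v (i : Fin θ) : A k Γ θ g χ N F ψ ξ α :=
  RingQuot.mkAlgHom k (ARel k Γ θ g χ N F ψ ξ α) (FreeAlgebra.ι k (Sum.inl i))

/-- The generator `e f` of `A(V,F,ψ,ξ,α)`. -/
def e (f : F) : A k Γ θ g χ N F ψ ξ α :=
  RingQuot.mkAlgHom k (ARel k Γ θ g χ N F ψ ξ α) (FreeAlgebra.ι k (Sum.inr f))

/-- Gaussian binomial coefficients. -/
def qb {K : Type} [Field K] (q : K) : ℕ → ℕ → K
  | _, 0 => 1
  | 0, _ + 1 => 0
  | n + 1, m + 1 => qb q n m + q ^ (m + 1) * qb q n (m + 1)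

theorem qb_zero {K : Type} [Field K] (q : K) (n : ℕ) : qb q n 0 = 1 := by
  cases n <;> rfl

theorem qb_gt {K : Type} [Field K] (q : K) : ∀ (n m : ℕ), n < m → qb q n m = 0
  | 0, 0, h => absurd h (by simp)
  | n + 1, 0, h => absurd h (by simp)
  | 0, m + 1, _ => rfl
  | n + 1, m + 1, h => by
      rw [qb, qb_gt q n m (by omega), qb_gt q n (m + 1) (by omega)]; simp

theorem qb_self {K : Type} [Field K] (q : K) (n : ℕ) : qb q n n = 1 := by
  induction n with
  | zero => rfl
  | succ n ih => rw [qb, ih, qb_gt q n (n + 1) (by omega)]; simp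

theorem qb_rec {K : Type} [Field K] (q : K) (n : ℕ) : ∀ m : ℕ,
    q ^ m * (q ^ (m + 1) - 1) * qb q n (m + 1) = (q ^ n - q ^ m) * qb q n m := by
  induction n with
  | zero =>
    intro m
    cases m with
    | zero => simp [qb]
    | succ m => simp [qb]
  | succ n ih =>
    intro m
    cases m with
    | zero =>
      have h := ih 0
      simp only [qb, qb_zero] at h ⊢
      linear_combination q * h
    | succ m =>
      have h := ih m
      have h' := ih (m + 1)
      simp only [qb] at h h' ⊢
      linear_combination q ^ (m + 1 + 1) * h' + q * h

theorem qb_vanish {K : Type} [Field K] (q : K) (hq0 : q ≠ 0) (n m : ℕ) (hn : q ^ n = 1)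
    (hm : q ^ (m + 1) ≠ 1) (hmn : m < n) : qb q n (m + 1) = 0 := by
  obtain ⟨n, rfl⟩ : ∃ n', n = n' + 1 := ⟨n - 1, by omega⟩
  have h := qb_rec q n m
  have h2 : q ^ m * (q ^ (m + 1) - 1) * qb q (n + 1) (m + 1) = 0 := by
    rw [qb]
    linear_combination q ^ (m + 1) * h + q ^ m * qb q n m * hn
  have h3 : q ^ m ≠ 0 := pow_ne_zero _ hq0
  have h4 : q ^ (m + 1) - 1 ≠ 0 := sub_ne_zero.mpr hm
  simpa [h3, h4, hq0] using h2

theorem qcomm_pow {K : Type} [Field K] {R : Type} [Ring R] [Algebra K R] (q : K) (a b : R)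
    (hab : b * a = q • (a * b)) (m : ℕ) : b * a ^ m = q ^ m • (a ^ m * b) := by
  induction m with
  | zero => simp
  | succ m ih =>
    rw [pow_succ, ← mul_assoc, ih, smul_mul_assoc, mul_assoc, hab, mul_smul_comm, smul_smul,
      pow_succ, mul_assoc]

theorem q_binomial {K : Type} [Field K] {R : Type} [Ring R] [Algebra K R] (q : K) (a b : R)
    (hab : b * a = q • (a * b)) (n : ℕ) :
    (a + b) ^ n = ∑ m ∈ Finset.range (n + 1), qb q n m • (a ^ m * b ^ (n - m)) := by
  induction n with
  | zero => simp [qb]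
  | succ n ih =>
    rw [pow_succ', ih, Finset.mul_sum]
    have h1 : ∀ m ∈ Finset.range (n + 1),
        (a + b) * (qb q n m • (a ^ m * b ^ (n - m))) =
        qb q n m • (a ^ (m + 1) * b ^ (n - m)) + (q ^ m * qb q n m) • (a ^ m * b ^ (n + 1 - m)) := by
      intro m hm
      have hm' : n + 1 - m = (n - m) + 1 := by
        have := Finset.mem_range.mp hm
        omega
      rw [mul_smul_comm, add_mul, smul_add, ← mul_assoc, ← mul_assoc, qcomm_pow q a b hab,
        ← pow_succ', smul_mul_assoc, mul_assoc, ← pow_succ', smul_smul, hm', mul_comm (qb q n m)]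
    rw [Finset.sum_congr rfl h1, Finset.sum_add_distrib]
    rw [Finset.sum_range_succ' (fun m => qb q (n + 1) m • (a ^ m * b ^ (n + 1 - m)))]
    simp only [qb, add_smul, Finset.sum_add_distrib, Nat.add_sub_add_right]
    rw [Finset.sum_range_succ' (fun m => (q ^ m * qb q n m) • (a ^ m * b ^ (n + 1 - m)))]
    rw [Finset.sum_range_succ (fun m => (q ^ (m + 1) * qb q n (m + 1)) • (a ^ (m + 1) * b ^ (n - m)))]
    rw [qb_gt q n (n + 1) (by omega)]
    simp [qb_zero, add_assoc]

theorem q_freshman {K : Type} [Field K] {R : Type} [Ring R] [Algebra K R] (q : K) (hq0 : q ≠ 0)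
    (a b : R) (hab : b * a = q • (a * b)) (n : ℕ) (hn0 : 0 < n) (hn : q ^ n = 1)
    (hlt : ∀ m, 0 < m → m < n → q ^ m ≠ 1) : (a + b) ^ n = a ^ n + b ^ n := by
  rw [q_binomial q a b hab, Finset.sum_range_succ]
  obtain ⟨n, rfl⟩ : ∃ n', n = n' + 1 := ⟨n - 1, by omega⟩
  rw [Finset.sum_range_succ', Finset.sum_eq_zero]
  · simp [qb_self, qb_zero, add_comm]
  · intro m hm
    have := Finset.mem_range.mp hm
    rw [qb_vanish q hq0 (n + 1) m hn (hlt _ (by omega) (by omega)) (by omega), zero_smul]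

section tens

variable {K : Type} [Field K] {R S : Type} [Ring R] [Algebra K R] [Ring S] [Algebra K S]

theorem t_ev (x Gi Gf : R) (v e : S) (c : K) (h1 : Gf * x = c • (x * Gf)) (h2 : Gf * Gi = Gi * Gf)
    (h3 : e * v = c • (v * e)) :
    (Gf ⊗ₜ[K] e) * (x ⊗ₜ[K] (1 : S) + Gi ⊗ₜ[K] v) =
      c • ((x ⊗ₜ[K] (1 : S) + Gi ⊗ₜ[K] v) * (Gf ⊗ₜ[K] e)) := by
  simp only [mul_add, add_mul, Algebra.TensorProduct.tmul_mul_tmul, h1, h2, h3, smul_add,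
    TensorProduct.smul_tmul', TensorProduct.tmul_smul, mul_one, one_mul]

theorem t_comm (x y Gi Gj Gij : R) (v w z : S) (c d : K) (hcd : c * d = 1)
    (h1 : x * y = c • (y * x))
    (h2 : Gi * y = c • (y * Gi)) (h3 : Gj * x = d • (x * Gj))
    (h4 : Gi * Gj = Gij) (h5 : Gj * Gi = Gij) (h6 : v * w - c • (w * v) = z) :
    (x ⊗ₜ[K] (1 : S) + Gi ⊗ₜ[K] v) * (y ⊗ₜ[K] (1 : S) + Gj ⊗ₜ[K] w) -
      c • ((y ⊗ₜ[K] (1 : S) + Gj ⊗ₜ[K] w) * (x ⊗ₜ[K] (1 : S) + Gi ⊗ₜ[K] v)) =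
      Gij ⊗ₜ[K] z := by
  rw [← h6]
  simp only [mul_add, add_mul, Algebra.TensorProduct.tmul_mul_tmul, h1, h2, h3, h4, h5, smul_add,
    ← TensorProduct.smul_tmul', TensorProduct.tmul_smul, mul_one, one_mul, smul_smul, hcd,
    one_smul, TensorProduct.tmul_sub]
  abel

theorem t_pow (x Gi : R) (v : S) (q : K) (hq0 : q ≠ 0) (h1 : Gi * x = q • (x * Gi))
    (n : ℕ) (hn0 : 0 < n) (hn : q ^ n = 1)
    (hlt : ∀ m, 0 < m → m < n → q ^ m ≠ 1) (hx : x ^ n = 0) :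
    (x ⊗ₜ[K] (1 : S) + Gi ⊗ₜ[K] v) ^ n = (Gi ^ n) ⊗ₜ[K] (v ^ n) := by
  rw [q_freshman q hq0 _ _ _ n hn0 hn hlt]
  · simp [Algebra.TensorProduct.tmul_pow, hx]
  · simp only [Algebra.TensorProduct.tmul_mul_tmul, h1, TensorProduct.smul_tmul', mul_one, one_mul]

end tens

local notation "Uu" => U k Γ θ g χ N
local notation "Xx" => X k Γ θ g χ N
local notation "Gg" => G k Γ θ g χ N
local notation "Aa" => A k Γ θ g χ N F ψ ξ α
local notation "vv" => v k Γ θ g χ N F ψ ξ α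
local notation "ee" => e k Γ θ g χ N F ψ ξ α

set_option linter.unusedSectionVars false

theorem hom_ext {B : Type} [Semiring B] [Algebra k B] (p p' : Aa →ₐ[k] B)
    (h1 : ∀ i, p (vv i) = p' (vv i)) (h2 : ∀ f, p (ee f) = p' (ee f)) : p = p' := by
  apply RingQuot.ringQuot_ext'
  apply FreeAlgebra.hom_ext
  funext s
  rcases s with i | f
  · exact h1 i
  · exact h2 f

theorem G_mul (h h' : Γ) : Gg h * Gg h' = Gg (h * h') := by
  have := RingQuot.mkAlgHom_rel k (URel.group_mul (k := k) (g := g) (χ := χ) (N := N) h h')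
  rwa [map_mul] at this

theorem G_one : Gg 1 = 1 := by
  have := RingQuot.mkAlgHom_rel k (URel.group_one (k := k) (g := g) (χ := χ) (N := N))
  rwa [map_one] at this

theorem G_pow (h : Γ) (n : ℕ) : Gg h ^ n = Gg (h ^ n) := by
  induction n with
  | zero => rw [pow_zero, pow_zero, G_one]
  | succ n ih => rw [pow_succ, pow_succ, ih, G_mul]

theorem G_X (h : Γ) (i : Fin θ) : Gg h * Xx i = (χ i h : k) • (Xx i * Gg h) := by
  have := RingQuot.mkAlgHom_rel k (URel.group_comm (k := k) (g := g) (χ := χ) (N := N) h i)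
  rwa [map_smul, map_mul, map_mul] at this

theorem X_pow (i : Fin θ) : Xx i ^ N i = 0 := by
  have := RingQuot.mkAlgHom_rel k (URel.nilpotent (k := k) (g := g) (χ := χ) (N := N) i)
  rwa [map_pow, map_zero] at this

theorem X_X (i j : Fin θ) (hij : i ≠ j) : Xx i * Xx j = (χ j (g i) : k) • (Xx j * Xx i) := by
  have := RingQuot.mkAlgHom_rel k (URel.qcomm (k := k) (g := g) (χ := χ) (N := N) i j hij)
  rwa [map_smul, map_mul, map_mul] at this

theorem e_one' : ee 1 = 1 := by
  have := RingQuot.mkAlgHom_rel k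
    (ARel.e_one (k := k) (g := g) (χ := χ) (N := N) (F := F) (ψ := ψ) (ξ := ξ) (α := α))
  rwa [map_one] at this

theorem e_mul' (f f' : F) : ee f * ee f' = (ψ f f' : k) • ee (f * f') := by
  have := RingQuot.mkAlgHom_rel k
    (ARel.e_mul (k := k) (g := g) (χ := χ) (N := N) (F := F) (ψ := ψ) (ξ := ξ) (α := α) f f')
  rwa [map_smul, map_mul] at this

theorem e_v' (f : F) (i : Fin θ) : ee f * vv i = (χ i (f : Γ) : k) • (vv i * ee f) := by
  have := RingQuot.mkAlgHom_rel k
    (ARel.e_v (k := k) (g := g) (χ := χ) (N := N) (F := F) (ψ := ψ) (ξ := ξ) (α := α) f i)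
  rwa [map_smul, map_mul, map_mul] at this

theorem v_comm_mem' (i j : Fin θ) (hij : i < j) (hmem : g i * g j ∈ F) :
    vv i * vv j - (χ j (g i) : k) • (vv j * vv i) = α i j • ee ⟨g i * g j, hmem⟩ := by
  have := RingQuot.mkAlgHom_rel k
    (ARel.v_comm_mem (k := k) (g := g) (χ := χ) (N := N) (F := F) (ψ := ψ) (ξ := ξ) (α := α)
      i j hij hmem)
  rwa [map_smul, map_sub, map_smul, map_mul, map_mul] at this

theorem v_comm_nmem' (i j : Fin θ) (hij : i < j) (hmem : g i * g j ∉ F) :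
    vv i * vv j - (χ j (g i) : k) • (vv j * vv i) = 0 := by
  have := RingQuot.mkAlgHom_rel k
    (ARel.v_comm_nmem (k := k) (g := g) (χ := χ) (N := N) (F := F) (ψ := ψ) (ξ := ξ) (α := α)
      i j hij hmem)
  rwa [map_zero, map_sub, map_smul, map_mul, map_mul] at this

theorem v_pow_mem' (i : Fin θ) (hmem : g i ^ N i ∈ F) :
    vv i ^ N i = ξ i • ee ⟨g i ^ N i, hmem⟩ := by
  have := RingQuot.mkAlgHom_rel k
    (ARel.v_pow_mem (k := k) (g := g) (χ := χ) (N := N) (F := F) (ψ := ψ) (ξ := ξ) (α := α)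
      i hmem)
  rwa [map_smul, map_pow] at this

theorem v_pow_nmem' (i : Fin θ) (hmem : g i ^ N i ∉ F) : vv i ^ N i = 0 := by
  have := RingQuot.mkAlgHom_rel k
    (ARel.v_pow_nmem (k := k) (g := g) (χ := χ) (N := N) (F := F) (ψ := ψ) (ξ := ξ) (α := α)
      i hmem)
  rwa [map_zero, map_pow] at this

/-- The coaction on the free algebra. -/
def lam0 : FreeAlgebra k (Fin θ ⊕ F) →ₐ[k] Uu ⊗[k] Aa :=
  FreeAlgebra.lift k (Sum.elim (fun i => Xx i ⊗ₜ[k] (1 : Aa) + Gg (g i) ⊗ₜ[k] vv i)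
    (fun f : F => Gg (f : Γ) ⊗ₜ[k] ee f))

local notation "ll" => lam0 k Γ θ g χ N F ψ ξ α

theorem lam0_inl (i : Fin θ) : ll (FreeAlgebra.ι k (Sum.inl i)) =
    Xx i ⊗ₜ[k] (1 : Aa) + Gg (g i) ⊗ₜ[k] vv i := by
  rw [lam0, FreeAlgebra.lift_ι_apply, Sum.elim_inl]

theorem lam0_inr (f : F) : ll (FreeAlgebra.ι k (Sum.inr f)) = Gg (f : Γ) ⊗ₜ[k] ee f := by
  rw [lam0, FreeAlgebra.lift_ι_apply, Sum.elim_inr]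

theorem lam0_pow (hN : ∀ i, N i = orderOf (χ i (g i))) (hN1 : ∀ i, 1 < N i) (i : Fin θ) :
    (Xx i ⊗ₜ[k] (1 : Aa) + Gg (g i) ⊗ₜ[k] vv i) ^ N i = Gg (g i ^ N i) ⊗ₜ[k] (vv i ^ N i) := by
  rw [t_pow (Xx i) (Gg (g i)) (vv i) (χ i (g i) : k) (Units.ne_zero _) (G_X k Γ θ g χ N _ _)
    (N i) (by have := hN1 i; omega) _ _ (X_pow k Γ θ g χ N i), G_pow]
  · rw [hN i, ← Units.val_pow_eq_pow_val, pow_orderOf_eq_one, Units.val_one]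
  · intro m hm hmN h
    rw [← Units.val_pow_eq_pow_val, Units.val_eq_one] at h
    rw [hN i] at hmN
    exact absurd (orderOf_le_of_pow_eq_one hm h) (by omega)

theorem lam0_comm (hcompat : ∀ i j, i ≠ j → χ i (g j) * χ j (g i) = 1)
    (i j : Fin θ) (hij : i < j) (z : Aa)
    (hz : vv i * vv j - (χ j (g i) : k) • (vv j * vv i) = z) :
    (Xx i ⊗ₜ[k] (1 : Aa) + Gg (g i) ⊗ₜ[k] vv i) * (Xx j ⊗ₜ[k] (1 : Aa) + Gg (g j) ⊗ₜ[k] vv j) -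
      (χ j (g i) : k) • ((Xx j ⊗ₜ[k] (1 : Aa) + Gg (g j) ⊗ₜ[k] vv j) *
        (Xx i ⊗ₜ[k] (1 : Aa) + Gg (g i) ⊗ₜ[k] vv i)) = Gg (g i * g j) ⊗ₜ[k] z := by
  refine t_comm _ _ _ _ _ _ _ _ _ (χ i (g j) : k) ?_ (X_X k Γ θ g χ N i j hij.ne)
    (G_X k Γ θ g χ N _ _) (G_X k Γ θ g χ N _ _) (G_mul k Γ θ g χ N _ _) ?_ hz
  · rw [← Units.val_mul, mul_comm, hcompat i j hij.ne, Units.val_one]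
  · rw [G_mul, mul_comm]

theorem lam0_rel (hcompat : ∀ i j, i ≠ j → χ i (g j) * χ j (g i) = 1)
    (hN : ∀ i, N i = orderOf (χ i (g i))) (hN1 : ∀ i, 1 < N i)
    ⦃x y : FreeAlgebra k (Fin θ ⊕ F)⦄ (h : ARel k Γ θ g χ N F ψ ξ α x y) : ll x = ll y := by
  induction h with
  | e_one =>
    rw [lam0_inr, e_one', OneMemClass.coe_one, G_one, map_one, Algebra.TensorProduct.one_def]
  | e_mul f f' =>
    rw [map_mul, map_smul, lam0_inr, lam0_inr, lam0_inr, Algebra.TensorProduct.tmul_mul_tmul,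
      e_mul', G_mul, TensorProduct.tmul_smul, Subgroup.coe_mul]
  | e_v f i =>
    rw [map_mul, map_smul, map_mul, lam0_inr, lam0_inl]
    refine t_ev _ _ _ _ _ _ (G_X k Γ θ g χ N _ _) ?_ (e_v' k Γ θ g χ N F ψ ξ α f i)
    rw [G_mul, G_mul, mul_comm]
  | v_comm_mem i j hij hmem =>
    rw [map_sub, map_smul, map_smul, map_mul, map_mul, lam0_inl, lam0_inl, lam0_inr,
      lam0_comm k Γ θ g χ N F ψ ξ α hcompat i j hij _
        (v_comm_mem' k Γ θ g χ N F ψ ξ α i j hij hmem), TensorProduct.tmul_smul]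
  | v_comm_nmem i j hij hmem =>
    rw [map_sub, map_smul, map_mul, map_mul, lam0_inl, lam0_inl,
      lam0_comm k Γ θ g χ N F ψ ξ α hcompat i j hij _
        (v_comm_nmem' k Γ θ g χ N F ψ ξ α i j hij hmem), TensorProduct.tmul_zero, map_zero]
  | v_pow_mem i hmem =>
    rw [map_pow, map_smul, lam0_inl, lam0_inr, lam0_pow k Γ θ g χ N F ψ ξ α hN hN1,
      v_pow_mem' k Γ θ g χ N F ψ ξ α i hmem, TensorProduct.tmul_smul]
  | v_pow_nmem i hmem =>
    rw [map_pow, map_zero, lam0_inl, lam0_pow k Γ θ g χ N F ψ ξ α hN hN1,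
      v_pow_nmem' k Γ θ g χ N F ψ ξ α i hmem, TensorProduct.tmul_zero]

/-- `A(V,F,ψ,ξ,α)` is a left `U`-comodule algebra: there is a
unique unital algebra map `λ : A(V,F,ψ,ξ,α) → U ⊗ A(V,F,ψ,ξ,α)` with
`λ(v_i) = X_i ⊗ 1 + G_{g_i} ⊗ v_i` and `λ(e_f) = G_f ⊗ e_f`; moreover any such
`λ` is coassociative and counital. -/
theorem comodule_algebra_structure
    (hθ : 1 ≤ θ)
    (hq : ∀ i, χ i (g i) ≠ 1)
    (hcompat : ∀ i j, i ≠ j → χ i (g j) * χ j (g i) = 1)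
    (hN : ∀ i, N i = orderOf (χ i (g i))) (hN1 : ∀ i, 1 < N i)
    -- `ψ` is a normalized 2-cocycle on `F`:
    (hψ : ∀ x y z : F, ψ x y * ψ (x * y) z = ψ y z * ψ x (y * z))
    (hψ1 : ∀ x : F, ψ 1 x = 1) (hψ1' : ∀ x : F, ψ x 1 = 1)
    -- `(ξ, α)` is a compatible comodule algebra datum:
    (hξ : ∀ i, ξ i = 0 ∨ ∃ hmem : g i ^ N i ∈ F,
      ∀ f : F, (χ i (f : Γ)) ^ N i =
        ψ f ⟨g i ^ N i, hmem⟩ * (ψ ⟨g i ^ N i, hmem⟩ f)⁻¹)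
    (hα : ∀ i j : Fin θ, i < j → (α i j = 0 ∨ ∃ hmem : g i * g j ∈ F,
      ∀ f : F, χ i (f : Γ) * χ j (f : Γ) =
        ψ f ⟨g i * g j, hmem⟩ * (ψ ⟨g i * g j, hmem⟩ f)⁻¹))
    -- a bialgebra structure on `U`:
    (Δ : Uu →ₐ[k] Uu ⊗[k] Uu) (ε : Uu →ₐ[k] k)
    (hcoassoc : (Algebra.TensorProduct.assoc k k k Uu Uu Uu).toAlgHom.comp
        ((Algebra.TensorProduct.map Δ (AlgHom.id k Uu)).comp Δ) =
      (Algebra.TensorProduct.map (AlgHom.id k Uu) Δ).comp Δ)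
    (hcounit_left : (Algebra.TensorProduct.lid k Uu).toAlgHom.comp
        ((Algebra.TensorProduct.map ε (AlgHom.id k Uu)).comp Δ) = AlgHom.id k Uu)
    (hcounit_right : (Algebra.TensorProduct.rid k k Uu).toAlgHom.comp
        ((Algebra.TensorProduct.map (AlgHom.id k Uu) ε).comp Δ) = AlgHom.id k Uu)
    (hΔG : ∀ h : Γ, Δ (Gg h) = Gg h ⊗ₜ[k] Gg h)
    (hΔX : ∀ i : Fin θ, Δ (Xx i) = Xx i ⊗ₜ[k] (1 : Uu) + Gg (g i) ⊗ₜ[k] Xx i)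
    (hεG : ∀ h : Γ, ε (Gg h) = 1) (hεX : ∀ i : Fin θ, ε (Xx i) = 0) :
    (∃! lam : Aa →ₐ[k] Uu ⊗[k] Aa,
        (∀ i : Fin θ, lam (vv i) = Xx i ⊗ₜ[k] (1 : Aa) + Gg (g i) ⊗ₜ[k] vv i) ∧
        (∀ f : F, lam (ee f) = Gg (f : Γ) ⊗ₜ[k] ee f)) ∧
    (∀ lam : Aa →ₐ[k] Uu ⊗[k] Aa,
      ((∀ i : Fin θ, lam (vv i) = Xx i ⊗ₜ[k] (1 : Aa) + Gg (g i) ⊗ₜ[k] vv i) ∧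
        (∀ f : F, lam (ee f) = Gg (f : Γ) ⊗ₜ[k] ee f)) →
      ((TensorProduct.assoc k Uu Uu Aa).toLinearMap ∘ₗ
          (TensorProduct.map Δ.toLinearMap LinearMap.id) ∘ₗ lam.toLinearMap =
        (TensorProduct.map LinearMap.id lam.toLinearMap) ∘ₗ lam.toLinearMap) ∧
      ((TensorProduct.lid k Aa).toLinearMap ∘ₗ
          (TensorProduct.map ε.toLinearMap LinearMap.id) ∘ₗ lam.toLinearMap =
        LinearMap.id)) := by
  refine ⟨?_, ?_⟩
  · refine ⟨RingQuot.liftAlgHom k ⟨lam0 k Γ θ g χ N F ψ ξ α,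
      lam0_rel k Γ θ g χ N F ψ ξ α hcompat hN hN1⟩, ⟨?_, ?_⟩, ?_⟩
    · intro i
      exact (RingQuot.liftAlgHom_mkAlgHom_apply k _ _ _).trans (lam0_inl k Γ θ g χ N F ψ ξ α i)
    · intro f
      exact (RingQuot.liftAlgHom_mkAlgHom_apply k _ _ _).trans (lam0_inr k Γ θ g χ N F ψ ξ α f)
    · rintro l ⟨h1, h2⟩
      apply hom_ext k Γ θ g χ N F ψ ξ α
      · intro i
        rw [h1]
        exact ((RingQuot.liftAlgHom_mkAlgHom_apply k _ _ _).trans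
          (lam0_inl k Γ θ g χ N F ψ ξ α i)).symm
      · intro f
        rw [h2]
        exact ((RingQuot.liftAlgHom_mkAlgHom_apply k _ _ _).trans
          (lam0_inr k Γ θ g χ N F ψ ξ α f)).symm
  · rintro l ⟨h1, h2⟩
    constructor
    · have key : (Algebra.TensorProduct.assoc k k k Uu Uu Aa).toAlgHom.comp
          ((Algebra.TensorProduct.map Δ (AlgHom.id k Aa)).comp l) =
          (Algebra.TensorProduct.map (AlgHom.id k Uu) l).comp l := by
        apply hom_ext k Γ θ g χ N F ψ ξ α
        · intro i
          simp only [AlgHom.comp_apply, h1, h2, map_add, Algebra.TensorProduct.map_tmul, hΔX, hΔG,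
            AlgHom.id_apply, map_one, TensorProduct.add_tmul, TensorProduct.tmul_add,
            AlgEquiv.toAlgHom_apply, Algebra.TensorProduct.assoc_tmul,
            Algebra.TensorProduct.one_def, add_assoc]
        · intro f
          simp only [AlgHom.comp_apply, h1, h2, map_add, Algebra.TensorProduct.map_tmul, hΔX, hΔG,
            AlgHom.id_apply, AlgEquiv.toAlgHom_apply,
            Algebra.TensorProduct.assoc_tmul]
      apply LinearMap.ext
      intro a
      exact DFunLike.congr_fun key a
    · have key : (Algebra.TensorProduct.lid k Aa).toAlgHom.comp
          ((Algebra.TensorProduct.map ε (AlgHom.id k Aa)).comp l) = AlgHom.id k Aa := by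
        apply hom_ext k Γ θ g χ N F ψ ξ α
        · intro i
          simp only [AlgHom.comp_apply, h1, h2, map_add, Algebra.TensorProduct.map_tmul, hεX, hεG,
            AlgHom.id_apply, AlgEquiv.toAlgHom_apply,
            Algebra.TensorProduct.lid_tmul, zero_smul, one_smul, zero_add]
        · intro f
          simp only [AlgHom.comp_apply, h1, h2, map_add, Algebra.TensorProduct.map_tmul, hεX, hεG,
            AlgHom.id_apply, AlgEquiv.toAlgHom_apply,
            Algebra.TensorProduct.lid_tmul, one_smul]
      apply LinearMap.ext
      intro a
      exact DFunLike.congr_fun key a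

end QLSComod

end
end

section
/- Take F = Γ. Writing A := A(V,Γ,ψ,ξ,α) and letting λ : A → U ⊗ A be the unique algebra homomorphism with λ(v_i) = X_i ⊗ 1 + G_{g_i} ⊗ v_i and λ(e_f) = G_f ⊗ e_f, the canonical Galois map β : A ⊗_k A → U ⊗_k A defined by β(a ⊗ b) = λ(a)·(1 ⊗ b) is a linear isomorphism; i.e. A(V,Γ,ψ,ξ,α) is a U-Hopf–Galois extension of the field k. -/
open scoped TensorProduct

noncomputable section

namespace QLSGalois

variable (k : Type) [Field k] [IsAlgClosed k] [CharZero k]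
variable (Γ : Type) [CommGroup Γ] [Fintype Γ]
variable (θ : ℕ) (g : Fin θ → Γ) (χ : Fin θ → (Γ →* kˣ)) (N : Fin θ → ℕ)

/-- The relations presenting the bosonization `U = B(V) # kΓ` of a quantum linear
space. -/
inductive URel : FreeAlgebra k (Fin θ ⊕ Γ) → FreeAlgebra k (Fin θ ⊕ Γ) → Prop
  | group_one : URel (FreeAlgebra.ι k (Sum.inr (1 : Γ))) 1
  | group_mul (h h' : Γ) :
      URel (FreeAlgebra.ι k (Sum.inr h) * FreeAlgebra.ι k (Sum.inr h'))
        (FreeAlgebra.ι k (Sum.inr (h * h')))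
  | group_comm (h : Γ) (i : Fin θ) :
      URel (FreeAlgebra.ι k (Sum.inr h) * FreeAlgebra.ι k (Sum.inl i))
        ((χ i h : k) • (FreeAlgebra.ι k (Sum.inl i) * FreeAlgebra.ι k (Sum.inr h)))
  | nilpotent (i : Fin θ) : URel (FreeAlgebra.ι k (Sum.inl i) ^ N i) 0
  | qcomm (i j : Fin θ) (hij : i ≠ j) :
      URel (FreeAlgebra.ι k (Sum.inl i) * FreeAlgebra.ι k (Sum.inl j))
        ((χ j (g i) : k) • (FreeAlgebra.ι k (Sum.inl j) * FreeAlgebra.ι k (Sum.inl i)))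

/-- The bosonization `U`, presented by generators and relations. -/
abbrev U := RingQuot (URel k Γ θ g χ N)

/-- The generator `X i` of `U`. -/
def X (i : Fin θ) : U k Γ θ g χ N :=
  RingQuot.mkAlgHom k (URel k Γ θ g χ N) (FreeAlgebra.ι k (Sum.inl i))

/-- The group-like generator `G h` of `U`. -/
def G (h : Γ) : U k Γ θ g χ N :=
  RingQuot.mkAlgHom k (URel k Γ θ g χ N) (FreeAlgebra.ι k (Sum.inr h))

variable (ψ : Γ → Γ → kˣ) (ξ : Fin θ → k) (α : Fin θ → Fin θ → k)

/-- The relations presenting `A(V,Γ,ψ,ξ,α)` (the case `F = Γ`):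
`e_1 = 1`, `e_f·e_h = ψ(f,h)·e_{fh}`, `e_f·v_i = χ_i(f)·v_i·e_f`,
`v_i·v_j − q_{ij}·v_j·v_i = α_{ij}·e_{g_i g_j}` (`i < j`), and
`v_i^{N_i} = ξ_i·e_{g_i^{N_i}}`. -/
inductive ARel : FreeAlgebra k (Fin θ ⊕ Γ) → FreeAlgebra k (Fin θ ⊕ Γ) → Prop
  | e_one : ARel (FreeAlgebra.ι k (Sum.inr (1 : Γ))) 1
  | e_mul (f f' : Γ) :
      ARel (FreeAlgebra.ι k (Sum.inr f) * FreeAlgebra.ι k (Sum.inr f'))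
        ((ψ f f' : k) • FreeAlgebra.ι k (Sum.inr (f * f')))
  | e_v (f : Γ) (i : Fin θ) :
      ARel (FreeAlgebra.ι k (Sum.inr f) * FreeAlgebra.ι k (Sum.inl i))
        ((χ i f : k) • (FreeAlgebra.ι k (Sum.inl i) * FreeAlgebra.ι k (Sum.inr f)))
  | v_comm (i j : Fin θ) (hij : i < j) :
      ARel (FreeAlgebra.ι k (Sum.inl i) * FreeAlgebra.ι k (Sum.inl j)
          - (χ j (g i) : k) • (FreeAlgebra.ι k (Sum.inl j) * FreeAlgebra.ι k (Sum.inl i)))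
        (α i j • FreeAlgebra.ι k (Sum.inr (g i * g j)))
  | v_pow (i : Fin θ) :
      ARel (FreeAlgebra.ι k (Sum.inl i) ^ N i)
        (ξ i • FreeAlgebra.ι k (Sum.inr (g i ^ N i)))

/-- The comodule algebra `A(V,Γ,ψ,ξ,α)`, presented by generators and relations. -/
abbrev A := RingQuot (ARel k Γ θ g χ N ψ ξ α)

/-- The generator `v i` of `A(V,Γ,ψ,ξ,α)`. -/
def v (i : Fin θ) : A k Γ θ g χ N ψ ξ α :=
  RingQuot.mkAlgHom k (ARel k Γ θ g χ N ψ ξ α) (FreeAlgebra.ι k (Sum.inl i))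

/-- The generator `e f` of `A(V,Γ,ψ,ξ,α)`. -/
def e (f : Γ) : A k Γ θ g χ N ψ ξ α :=
  RingQuot.mkAlgHom k (ARel k Γ θ g χ N ψ ξ α) (FreeAlgebra.ι k (Sum.inr f))

local notation "Uu" => U k Γ θ g χ N
local notation "Xx" => X k Γ θ g χ N
local notation "Gg" => G k Γ θ g χ N
local notation "Aa" => A k Γ θ g χ N ψ ξ α
local notation "vv" => v k Γ θ g χ N ψ ξ α
local notation "ee" => e k Γ θ g χ N ψ ξ α

section helpers
open MulOpposite

def qc {K : Type} [Field K] (q : K) : ℕ → ℕ → K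
  | _, 0 => 1
  | 0, _ + 1 => 0
  | n + 1, m + 1 => qc q n m + q ^ (m + 1) * qc q n (m + 1)

theorem qc_zero {K : Type} [Field K] (q : K) (n : ℕ) : qc q n 0 = 1 := by
  cases n <;> rfl

theorem qc_gt {K : Type} [Field K] (q : K) (n : ℕ) : ∀ m, n < m → qc q n m = 0 := by
  induction n with
  | zero => intro m hm; cases m with
    | zero => omega
    | succ m => rfl
  | succ n ih => intro m hm; cases m with
    | zero => omega
    | succ m => rw [qc, ih m (by omega), ih (m+1) (by omega)]; simp

theorem qc_self {K : Type} [Field K] (q : K) (n : ℕ) : qc q n n = 1 := by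
  induction n with
  | zero => rfl
  | succ n ih => rw [qc, ih, qc_gt q n (n+1) (by omega)]; simp

theorem qc_rec {K : Type} [Field K] (q : K) (n : ℕ) :
    ∀ m, q ^ m * (1 - q ^ (m + 1)) * qc q n (m + 1) = (q ^ m - q ^ n) * qc q n m := by
  induction n with
  | zero => intro m; cases m with
    | zero => simp [qc]
    | succ m => simp [qc]
  | succ n ih =>
    intro m
    cases m with
    | zero =>
      have := ih 0
      simp only [qc, qc_zero] at this ⊢
      linear_combination q * this
    | succ m =>
      have h0 := ih m
      have h1 := ih (m + 1)
      simp only [qc]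
      linear_combination q ^ (m + 2) * h1 + q * h0

theorem qc_van {K : Type} [Field K] (q : K) (n : ℕ) (hn : IsPrimitiveRoot q n) :
    ∀ m, 0 < m → m < n → qc q n m = 0 := by
  intro m
  induction m with
  | zero => intro h; omega
  | succ m ih =>
    intro _ hm
    have h := qc_rec q n m
    have hq0 : q ≠ 0 := hn.ne_zero (by omega)
    have h1 : (1 - q ^ (m + 1)) ≠ 0 := by
      intro hh
      exact hn.pow_ne_one_of_pos_of_lt (by omega) hm (sub_eq_zero.mp hh).symm
    have h2 : (q ^ m - q ^ n) * qc q n m = 0 := by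
      rcases Nat.eq_zero_or_pos m with rfl | hp
      · simp [hn.pow_eq_one]
      · rw [ih hp (by omega), mul_zero]
    rw [h2] at h
    exact (mul_eq_zero.mp h).resolve_left (mul_ne_zero (pow_ne_zero _ hq0) h1)

theorem q_pow_comm {K M : Type} [Field K] [Ring M] [Algebra K M] (q : K) (a b : M)
    (h : b * a = q • (a * b)) (m : ℕ) : b * a ^ m = q ^ m • (a ^ m * b) := by
  induction m with
  | zero => simp
  | succ m ih =>
    rw [pow_succ, ← mul_assoc, ih, smul_mul_assoc, mul_assoc, h, mul_smul_comm, smul_smul,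
      ← mul_assoc, pow_succ]

theorem q_binom {K M : Type} [Field K] [Ring M] [Algebra K M] (q : K) (a b : M)
    (h : b * a = q • (a * b)) (n : ℕ) :
    (a + b) ^ n = ∑ m ∈ Finset.range (n + 1), qc q n m • (a ^ m * b ^ (n - m)) := by
  induction n with
  | zero => simp [qc]
  | succ n ih =>
    rw [pow_succ', ih, add_mul, Finset.mul_sum, Finset.mul_sum, Finset.sum_range_succ' _ (n + 1)]
    have e1 : ∀ m ∈ Finset.range (n + 1),
        b * (qc q n m • (a ^ m * b ^ (n - m))) =
        (q ^ m * qc q n m) • (a ^ m * b ^ (n + 1 - m)) := by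
      intro m hm
      have hm' : m < n + 1 := Finset.mem_range.mp hm
      rw [mul_smul_comm, ← mul_assoc, q_pow_comm q a b h, smul_mul_assoc, smul_smul, mul_assoc,
        ← pow_succ', mul_comm (qc q n m), show n - m + 1 = n + 1 - m by omega]
    rw [Finset.sum_congr rfl e1]
    have e2 : ∑ m ∈ Finset.range (n + 1), (q ^ m * qc q n m) • (a ^ m * b ^ (n + 1 - m))
        = ∑ m ∈ Finset.range (n + 1 + 1), (q ^ m * qc q n m) • (a ^ m * b ^ (n + 1 - m)) := by
      rw [Finset.sum_range_succ _ (n + 1), qc_gt q n (n+1) (by omega)]; simp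
    rw [e2, Finset.sum_range_succ' _ (n + 1), ← add_assoc, ← Finset.sum_add_distrib]
    congr 1
    · apply Finset.sum_congr rfl
      intro m _
      rw [qc, add_smul, mul_smul_comm, ← mul_assoc, ← pow_succ',
        show n + 1 - (m + 1) = n - m by omega]
    · simp [qc_zero]

theorem q_frob {K M : Type} [Field K] [Ring M] [Algebra K M] (q : K) (a b : M)
    (h : b * a = q • (a * b)) (n : ℕ) (hn0 : 0 < n) (hn : IsPrimitiveRoot q n) :
    (a + b) ^ n = a ^ n + b ^ n := by
  obtain ⟨n, rfl⟩ : ∃ m, n = m + 1 := ⟨n - 1, by omega⟩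
  rw [q_binom q a b h, Finset.sum_range_succ, Finset.sum_range_succ',
    Finset.sum_eq_zero, qc_self, qc_zero]
  · simp [add_comm]
  · intro m hm
    have := Finset.mem_range.mp hm
    rw [qc_van q _ hn _ (by omega) (by omega), zero_smul]

/-- powers of a product of q-commuting elements -/
theorem q_mul_pow {K M : Type} [Field K] [Ring M] [Algebra K M] (q : K) (w T : M)
    (h : T * w = q • (w * T)) (n : ℕ) :
    (w * T) ^ n = q ^ (n.choose 2) • (w ^ n * T ^ n) := by
  induction n with
  | zero => simp
  | succ n ih =>
    have hT : T ^ n * w = q ^ n • (w * T ^ n) := by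
      clear ih
      induction n with
      | zero => simp
      | succ n ih =>
        rw [pow_succ', mul_assoc, ih, mul_smul_comm, ← mul_assoc, h, smul_mul_assoc, smul_smul,
          mul_assoc, ← pow_succ]
    rw [pow_succ, ih, smul_mul_assoc, mul_assoc, ← mul_assoc (T ^ n), hT, smul_mul_assoc,
      mul_smul_comm, smul_smul, ← pow_add]
    congr 1
    · rw [Nat.choose_succ_succ' n 1, Nat.choose_one_right, add_comm]
    · rw [pow_succ, pow_succ, mul_assoc, mul_assoc]

theorem q_sign {K : Type} [Field K] (q : K) (n : ℕ) (hn0 : 0 < n) (hn : IsPrimitiveRoot q n) :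
    (-1) ^ n * q ^ (n.choose 2) = -1 := by
  rcases Nat.even_or_odd n with he | ho
  · obtain ⟨m, rfl⟩ := he
    have h1 : (q ^ m) = -1 := by
      have h2 : (q ^ m) * q ^ m = 1 := by rw [← pow_add, hn.pow_eq_one]
      rcases mul_self_eq_one_iff.mp h2 with h3 | h3
      · exact absurd h3 (hn.pow_ne_one_of_pos_of_lt (by omega) (by omega))
      · exact h3
    have : (m + m).choose 2 = m * (2 * m - 1) := by
      rw [Nat.choose_two_right, show m + m = 2 * m by ring, mul_assoc,
        Nat.mul_div_cancel_left _ (by norm_num)]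
    rw [this, pow_mul, h1, ← pow_add]
    exact Odd.neg_one_pow ⟨2 * m - 1, by omega⟩
  · obtain ⟨m, rfl⟩ := ho
    have : (2 * m + 1).choose 2 = (2 * m + 1) * m := by
      rw [Nat.choose_two_right, show 2 * m + 1 - 1 = m * 2 by omega, ← mul_assoc,
        Nat.mul_div_cancel _ (by norm_num)]
    rw [this, pow_mul, hn.pow_eq_one, one_pow, mul_one]
    exact Odd.neg_one_pow ⟨m, rfl⟩

section gen
variable {K : Type} [Field K] {B H I : Type} [Ring B] [Algebra K B] [Ring H] [Algebra K H]

/-- the Galois map, from the enveloping algebra -/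
def bt (lam : B →ₐ[K] H ⊗[K] B) : B ⊗[K] Bᵐᵒᵖ →ₗ[K] H ⊗[K] B :=
  (LinearMap.mul' K (H ⊗[K] B)).comp
    (TensorProduct.map lam.toLinearMap
      ((Algebra.TensorProduct.includeRight (R := K) (A := H) (B := B)).toLinearMap.comp
        (opLinearEquiv K).symm.toLinearMap))

theorem bt_tmul (lam : B →ₐ[K] H ⊗[K] B) (x : B) (y : Bᵐᵒᵖ) :
    bt lam (x ⊗ₜ y) = lam x * (1 ⊗ₜ unop y) := by
  simp [bt]

theorem bt_left (lam : B →ₐ[K] H ⊗[K] B) (x : B) (m : B ⊗[K] Bᵐᵒᵖ) :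
    bt lam ((x ⊗ₜ 1) * m) = lam x * bt lam m := by
  induction m with
  | zero => simp
  | add a b ha hb => rw [mul_add, map_add, ha, hb, map_add, mul_add]
  | tmul a b => simp [bt_tmul, mul_assoc]

theorem bt_right (lam : B →ₐ[K] H ⊗[K] B) (y : B) (m : B ⊗[K] Bᵐᵒᵖ) :
    bt lam ((1 ⊗ₜ op y) * m) = bt lam m * (1 ⊗ₜ y) := by
  induction m with
  | zero => simp
  | add a b ha hb => rw [mul_add, map_add, ha, hb, map_add, add_mul]
  | tmul a b => simp [bt_tmul, mul_assoc]

/-- the inverse -/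
def gm (τ : H →ₐ[K] B ⊗[K] Bᵐᵒᵖ) : H ⊗[K] B →ₗ[K] B ⊗[K] Bᵐᵒᵖ :=
  (LinearMap.mul' K (B ⊗[K] Bᵐᵒᵖ)).comp
    ((TensorProduct.map ((Algebra.TensorProduct.includeRight (R := K) (A := B)
        (B := Bᵐᵒᵖ)).toLinearMap.comp (opLinearEquiv K).toLinearMap) τ.toLinearMap).comp
      (TensorProduct.comm K H B).toLinearMap)

theorem gm_tmul (τ : H →ₐ[K] B ⊗[K] Bᵐᵒᵖ) (u : H) (a : B) :
    gm τ (u ⊗ₜ a) = (1 ⊗ₜ op a) * τ u := by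
  simp [gm]

theorem main_gen {G' I' : Type} (lam : B →ₐ[K] H ⊗[K] B) (τ : H →ₐ[K] B ⊗[K] Bᵐᵒᵖ)
    (E : G' → Bˣ) (V : I' → B) (gg : I' → G') (GG : G' → H) (XX : I' → H)
    (hB : ∀ p : B → Prop, (∀ c : K, p (algebraMap K B c)) → (∀ x y, p x → p y → p (x + y)) →
      (∀ x y, p x → p y → p (x * y)) → (∀ f, p (E f)) → (∀ i, p (V i)) → ∀ x, p x)
    (hH : ∀ p : H → Prop, (∀ c : K, p (algebraMap K H c)) → (∀ x y, p x → p y → p (x + y)) →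
      (∀ x y, p x → p y → p (x * y)) → (∀ f, p (GG f)) → (∀ i, p (XX i)) → ∀ x, p x)
    (hlE : ∀ f, lam (E f) = GG f ⊗ₜ (E f : B))
    (hlV : ∀ i, lam (V i) = XX i ⊗ₜ 1 + GG (gg i) ⊗ₜ V i)
    (hτG : ∀ f, τ (GG f) = (E f : B) ⊗ₜ op (((E f)⁻¹ : Bˣ) : B))
    (hτX : ∀ i, τ (XX i) = V i ⊗ₜ 1 -
      (1 ⊗ₜ op (V i)) * ((E (gg i) : B) ⊗ₜ op (((E (gg i))⁻¹ : Bˣ) : B))) :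
    Function.Bijective
      ((LinearMap.mul' K (H ⊗[K] B)).comp
        (TensorProduct.map lam.toLinearMap
          (Algebra.TensorProduct.includeRight (R := K) (A := H) (B := B)).toLinearMap)) := by
  have hQ : ∀ a : B, ∀ w, gm τ (lam a * w) = (a ⊗ₜ 1) * gm τ w := by
    apply hB
    · intro c w
      rw [AlgHom.commutes, Algebra.algebraMap_eq_smul_one, Algebra.algebraMap_eq_smul_one,
        smul_one_mul, map_smul, ← TensorProduct.smul_tmul', smul_mul_assoc,
        ← Algebra.TensorProduct.one_def, one_mul]
    · intro x y hx hy w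
      rw [map_add, add_mul, map_add, hx, hy, TensorProduct.add_tmul, add_mul]
    · intro x y hx hy w
      rw [map_mul lam, mul_assoc, hx, hy, ← mul_assoc]; simp
    · intro f w
      induction w with
      | zero => simp
      | add a b ha hb => rw [mul_add, map_add, ha, hb, map_add, mul_add]
      | tmul u c =>
        rw [hlE, Algebra.TensorProduct.tmul_mul_tmul, gm_tmul, gm_tmul, map_mul, hτG,
          ← mul_assoc, ← mul_assoc]
        congr 1
        simp [← op_mul, ← mul_assoc]
    · intro i w
      induction w with
      | zero => simp
      | add a b ha hb => rw [mul_add, map_add, ha, hb, map_add, mul_add]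
      | tmul u c =>
        rw [hlV, add_mul, Algebra.TensorProduct.tmul_mul_tmul, Algebra.TensorProduct.tmul_mul_tmul,
          map_add, gm_tmul, gm_tmul, gm_tmul, map_mul, map_mul, hτG, hτX,
          ← mul_assoc, ← mul_assoc, ← mul_assoc, ← add_mul]
        congr 1
        simp [mul_sub, ← op_mul, ← mul_assoc]
  have hR : ∀ u : H, ∀ m u', bt lam m = u' ⊗ₜ 1 → bt lam (τ u * m) = (u * u') ⊗ₜ 1 := by
    apply hH
    · intro c m u' h
      rw [AlgHom.commutes, Algebra.algebraMap_eq_smul_one, Algebra.algebraMap_eq_smul_one,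
        smul_one_mul, smul_one_mul, map_smul, h, TensorProduct.smul_tmul']
    · intro x y hx hy m u' h
      rw [map_add, add_mul, map_add, hx m u' h, hy m u' h, add_mul, TensorProduct.add_tmul]
    · intro x y hx hy m u' h
      rw [map_mul τ, mul_assoc, hx _ _ (hy m u' h), mul_assoc]
    · intro f m u' h
      have : τ (GG f) = (1 ⊗ₜ op (((E f)⁻¹ : Bˣ) : B)) * ((E f : B) ⊗ₜ 1) := by simp [hτG]
      rw [this, mul_assoc, bt_right, bt_left, h, hlE]
      simp
    · intro i m u' h
      have : τ (XX i) = V i ⊗ₜ 1 - (1 ⊗ₜ op (V i)) * ((1 ⊗ₜ op (((E (gg i))⁻¹ : Bˣ) : B)) *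
          ((E (gg i) : B) ⊗ₜ 1)) := by simp [hτX]
      rw [this, sub_mul, map_sub, mul_assoc, mul_assoc, bt_right, bt_right, bt_left, bt_left,
        h, hlE, hlV]
      simp [add_mul]
  set β := ((LinearMap.mul' K (H ⊗[K] B)).comp
        (TensorProduct.map lam.toLinearMap
          (Algebra.TensorProduct.includeRight (R := K) (A := H) (B := B)).toLinearMap)) with hβ
  let φ : B ⊗[K] B ≃ₗ[K] B ⊗[K] Bᵐᵒᵖ := TensorProduct.congr (LinearEquiv.refl K B) (opLinearEquiv K)
  have h1 : ∀ x, gm τ (β x) = φ x := by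
    intro x
    induction x with
    | zero => simp
    | add a b ha hb => rw [map_add, map_add, ha, hb, map_add]
    | tmul a b =>
      have : β (a ⊗ₜ b) = lam a * (1 ⊗ₜ b) := by simp [hβ]
      rw [this, hQ, gm_tmul, map_one, mul_one]
      simp [φ]
  have h2 : ∀ m, β (φ.symm m) = bt lam m := by
    intro m
    induction m with
    | zero => simp
    | add a b ha hb => rw [map_add, map_add, ha, hb, map_add]
    | tmul a b => simp [φ, hβ, bt_tmul]
  have h3 : ∀ w, bt lam (gm τ w) = w := by
    intro w
    induction w with
    | zero => simp
    | add a b ha hb => rw [map_add, map_add, ha, hb]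
    | tmul u a =>
      have := hR u 1 1 (by rw [Algebra.TensorProduct.one_def, bt_tmul]; simp [Algebra.TensorProduct.one_def])
      rw [mul_one, mul_one] at this
      rw [gm_tmul, bt_right, this]
      simp
  constructor
  · intro x y hxy
    apply φ.injective
    rw [← h1, ← h1, hxy]
  · intro w
    exact ⟨φ.symm (gm τ w), by rw [h2, h3]⟩

/-- the group-like element of the enveloping algebra attached to a unit -/
def TT (K : Type) [Field K] {B : Type} [Ring B] [Algebra K B] (x : Bˣ) : B ⊗[K] Bᵐᵒᵖ :=
  (x : B) ⊗ₜ op ((x⁻¹ : Bˣ) : B)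

theorem TT_mul (x y : Bˣ) : TT K x * TT K y = TT K (x * y) := by
  simp [TT]

theorem TT_one : TT K (1 : Bˣ) = 1 := by
  simp [TT, Algebra.TensorProduct.one_def]

theorem TT_pow (x : Bˣ) (n : ℕ) : TT K x ^ n = TT K (x ^ n) := by
  induction n with
  | zero => simp [TT_one]
  | succ n ih => rw [pow_succ, ih, TT_mul, pow_succ]

theorem TT_smul (x y : Bˣ) (c : Kˣ) (h : (x : B) = (c : K) • (y : B)) : TT K x = TT K y := by
  have h2 : ((x⁻¹ : Bˣ) : B) = ((c⁻¹ : Kˣ) : K) • ((y⁻¹ : Bˣ) : B) := by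
    apply Units.inv_eq_of_mul_eq_one_right
    rw [h, smul_mul_smul_comm]
    simp
  rw [TT, TT, h, h2, op_smul, TensorProduct.smul_tmul_smul]
  simp

theorem TT_left (x : Bˣ) (V : B) (q : K) (h : (x : B) * V = q • (V * x)) :
    TT K x * (V ⊗ₜ 1) = q • ((V ⊗ₜ 1) * TT K x) := by
  simp [TT, h, TensorProduct.smul_tmul']

theorem TT_right (x : Bˣ) (V : B) (q : K) (h : (x : B) * V = q • (V * x)) :
    TT K x * (1 ⊗ₜ op V) = q • ((1 ⊗ₜ op V) * TT K x) := by
  have h2 : V * ((x⁻¹ : Bˣ) : B) = q • (((x⁻¹ : Bˣ) : B) * V) := by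
    have : V = ((x⁻¹ : Bˣ) : B) * (q • (V * x)) := by rw [← h]; simp
    conv_lhs => rw [this]
    simp [mul_assoc]
  simp only [TT, Algebra.TensorProduct.tmul_mul_tmul, ← op_mul, h2, op_smul, mul_one, one_mul,
    TensorProduct.tmul_smul]

theorem TT_canc (x : Bˣ) : (1 ⊗ₜ op (x : B)) * TT K x = (x : B) ⊗ₜ 1 := by
  simp [TT, ← op_mul]

theorem sub_as_smul {M : Type} [Ring M] [Algebra K M] (a b : M) : a - b = a + (-1 : K) • b := by
  rw [neg_one_smul, sub_eq_add_neg]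

theorem add_neg_one_smul {M : Type} [Ring M] [Algebra K M] (b : M) : b + (-1 : K) • b = 0 := by
  rw [neg_one_smul, add_neg_cancel]

theorem gcomm_gen {M : Type} [Ring M] [Algebra K M] (q : K) (a w T S : M)
    (b1 : T * a = q • (a * T)) (b2 : T * w = q • (w * T)) (b3 : T * S = S * T) :
    T * (a - w * S) = q • ((a - w * S) * T) := by
  rw [mul_sub, b1, ← mul_assoc, b2, smul_mul_assoc, mul_assoc, b3, ← mul_assoc, sub_mul,
    smul_sub]

theorem tau_pow (x Y : Bˣ) (V : B) (q ξ : K) (n : ℕ) (c : Kˣ) (hn0 : 0 < n)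
    (hn : IsPrimitiveRoot q n) (h : (x : B) * V = q • (V * x))
    (hY : ((x ^ n : Bˣ) : B) = (c : K) • (Y : B)) (hV : V ^ n = ξ • (Y : B)) :
    ((V ⊗ₜ 1 : B ⊗[K] Bᵐᵒᵖ) - (1 ⊗ₜ op V) * TT K x) ^ n = 0 := by
  have hc : (V ⊗ₜ 1 : B ⊗[K] Bᵐᵒᵖ) * (1 ⊗ₜ op V) = (1 ⊗ₜ op V) * (V ⊗ₜ 1) := by simp
  have hs : (V ⊗ₜ 1 : B ⊗[K] Bᵐᵒᵖ) - (1 ⊗ₜ op V) * TT K x =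
      (V ⊗ₜ 1) + (-1 : K) • ((1 ⊗ₜ op V) * TT K x) := sub_as_smul _ _
  rw [hs, q_frob q _ _ _ n hn0 hn, smul_pow, q_mul_pow q _ _ (TT_right x V q h),
    TT_pow, TT_smul _ _ c hY]
  · have e1 : (V ⊗ₜ 1 : B ⊗[K] Bᵐᵒᵖ) ^ n = ξ • ((Y : B) ⊗ₜ 1) := by
      simp [Algebra.TensorProduct.tmul_pow, hV, TensorProduct.smul_tmul']
    have e2 : (1 ⊗ₜ op V : B ⊗[K] Bᵐᵒᵖ) ^ n = ξ • (1 ⊗ₜ op (Y : B)) := by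
      simp [Algebra.TensorProduct.tmul_pow, ← op_pow, hV]
    rw [e1, e2, smul_mul_assoc, TT_canc, smul_smul, q_sign q n hn0 hn]
    exact add_neg_one_smul (K := K) (M := B ⊗[K] Bᵐᵒᵖ) _
  · rw [smul_mul_assoc, mul_smul_comm, mul_assoc, TT_left x V q h, mul_smul_comm, ← mul_assoc,
      ← mul_assoc, hc, smul_comm]

theorem tau_comm (x1 x2 Y : Bˣ) (V1 V2 : B) (q12 q21 al : K) (c c' : Kˣ)
    (h12 : (x1 : B) * V2 = q12 • (V2 * x1))
    (h21 : (x2 : B) * V1 = q21 • (V1 * x2))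
    (hq : q12 * q21 = 1)
    (hY : ((x1 * x2 : Bˣ) : B) = (c : K) • (Y : B))
    (hY' : ((x2 * x1 : Bˣ) : B) = (c' : K) • (Y : B))
    (hV : V1 * V2 - q12 • (V2 * V1) = al • (Y : B)) :
    ((V1 ⊗ₜ 1 : B ⊗[K] Bᵐᵒᵖ) - (1 ⊗ₜ op V1) * TT K x1) *
      ((V2 ⊗ₜ 1 : B ⊗[K] Bᵐᵒᵖ) - (1 ⊗ₜ op V2) * TT K x2) =
    q12 • (((V2 ⊗ₜ 1 : B ⊗[K] Bᵐᵒᵖ) - (1 ⊗ₜ op V2) * TT K x2) *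
      ((V1 ⊗ₜ 1 : B ⊗[K] Bᵐᵒᵖ) - (1 ⊗ₜ op V1) * TT K x1)) := by
  have hc : ∀ V W : B, (V ⊗ₜ 1 : B ⊗[K] Bᵐᵒᵖ) * (1 ⊗ₜ op W) = (1 ⊗ₜ op W) * (V ⊗ₜ 1) := by simp
  have m1 := TT_left (K := K) x1 V2 q12 h12
  have m2 := TT_left (K := K) x2 V1 q21 h21
  have m3 := TT_right (K := K) x1 V2 q12 h12
  have m4 := TT_right (K := K) x2 V1 q21 h21
  have m5 : TT K x1 * TT K x2 = TT K Y := by rw [TT_mul, TT_smul _ _ c hY]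
  have m6 : TT K x2 * TT K x1 = TT K Y := by rw [TT_mul, TT_smul _ _ c' hY']
  have m7 : (V1 ⊗ₜ 1 : B ⊗[K] Bᵐᵒᵖ) * (V2 ⊗ₜ 1) =
      q12 • ((V2 ⊗ₜ 1) * (V1 ⊗ₜ 1)) + al • ((Y : B) ⊗ₜ 1) := by
    rw [sub_eq_iff_eq_add'] at hV
    simp [hV, TensorProduct.add_tmul, TensorProduct.smul_tmul']
  have m8 : (1 ⊗ₜ op V2 : B ⊗[K] Bᵐᵒᵖ) * (1 ⊗ₜ op V1) =
      q12 • ((1 ⊗ₜ op V1) * (1 ⊗ₜ op V2)) + al • (1 ⊗ₜ op (Y : B)) := by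
    rw [sub_eq_iff_eq_add'] at hV
    simp [← op_mul, hV, TensorProduct.tmul_add]
  have m9 := TT_canc (K := K) Y
  have c12 := hc V1 V2
  have c21 := hc V2 V1
  generalize (V1 ⊗ₜ 1 : B ⊗[K] Bᵐᵒᵖ) = a1 at *
  generalize (V2 ⊗ₜ 1 : B ⊗[K] Bᵐᵒᵖ) = a2 at *
  generalize (1 ⊗ₜ op V1 : B ⊗[K] Bᵐᵒᵖ) = w1 at *
  generalize (1 ⊗ₜ op V2 : B ⊗[K] Bᵐᵒᵖ) = w2 at *
  generalize ((Y : B) ⊗ₜ 1 : B ⊗[K] Bᵐᵒᵖ) = yl at *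
  generalize (1 ⊗ₜ op (Y : B) : B ⊗[K] Bᵐᵒᵖ) = yr at *
  have n1 : w1 * TT K x1 * a2 = q12 • (a2 * (w1 * TT K x1)) := by
    rw [mul_assoc, m1, mul_smul_comm, ← mul_assoc, ← mul_assoc, c21]
  have n2 : w2 * TT K x2 * a1 = q21 • (a1 * (w2 * TT K x2)) := by
    rw [mul_assoc, m2, mul_smul_comm, ← mul_assoc, ← mul_assoc, c12]
  have n3 : w1 * TT K x1 * (w2 * TT K x2) = q12 • (w1 * w2 * TT K Y) := by
    rw [mul_assoc, ← mul_assoc (TT K x1), m3, smul_mul_assoc, mul_smul_comm, mul_assoc w2, m5,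
      mul_assoc]
  have n4 : w2 * TT K x2 * (w1 * TT K x1) = q21 • (w2 * w1 * TT K Y) := by
    rw [mul_assoc, ← mul_assoc (TT K x2), m4, smul_mul_assoc, mul_smul_comm, mul_assoc w1, m6,
      mul_assoc]
  simp only [sub_mul, mul_sub, smul_sub]
  rw [n1, n2, n3, n4, m7, m8, smul_smul, smul_smul, hq, one_smul, one_smul, add_mul,
    smul_mul_assoc, smul_mul_assoc, m9]
  abel

end gen

end helpers

/-- For `F = Γ`, the comodule algebra `A = A(V,Γ,ψ,ξ,α)` is a
`U`-Hopf–Galois extension of `k`: the canonical Galois map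
`β : A ⊗ A → U ⊗ A`, `β(a ⊗ b) = λ(a)·(1 ⊗ b)`, is bijective. -/
theorem galois_map_bijective
    (hθ : 1 ≤ θ)
    (hq : ∀ i, χ i (g i) ≠ 1)
    (hcompat : ∀ i j, i ≠ j → χ i (g j) * χ j (g i) = 1)
    (hN : ∀ i, N i = orderOf (χ i (g i))) (hN1 : ∀ i, 1 < N i)
    -- `ψ` is a normalized 2-cocycle on `Γ`:
    (hψ : ∀ x y z : Γ, ψ x y * ψ (x * y) z = ψ y z * ψ x (y * z))
    (hψ1 : ∀ x : Γ, ψ 1 x = 1) (hψ1' : ∀ x : Γ, ψ x 1 = 1)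
    -- `(ξ, α)` is a compatible comodule algebra datum:
    (hξ : ∀ i, ξ i = 0 ∨
      ∀ f : Γ, (χ i f) ^ N i = ψ f (g i ^ N i) * (ψ (g i ^ N i) f)⁻¹)
    (hα : ∀ i j : Fin θ, i < j → (α i j = 0 ∨
      ∀ f : Γ, χ i f * χ j f = ψ f (g i * g j) * (ψ (g i * g j) f)⁻¹))
    -- the comodule structure map `λ`:
    (lam : Aa →ₐ[k] Uu ⊗[k] Aa)
    (hlamv : ∀ i : Fin θ, lam (vv i) = Xx i ⊗ₜ[k] (1 : Aa) + Gg (g i) ⊗ₜ[k] vv i)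
    (hlame : ∀ f : Γ, lam (ee f) = Gg f ⊗ₜ[k] ee f) :
    Function.Bijective
      ((LinearMap.mul' k (Uu ⊗[k] Aa)).comp
        (TensorProduct.map lam.toLinearMap
          (Algebra.TensorProduct.includeRight (R := k) (A := Uu) (B := Aa)).toLinearMap)) := by
  classical
  -- relations in `A`
  have r1 : ee 1 = 1 := by
    have := RingQuot.mkAlgHom_rel k (ARel.e_one (k := k) (g := g) (χ := χ) (N := N) (ψ := ψ)
      (ξ := ξ) (α := α))
    simpa [e] using this
  have r2 : ∀ f f', ee f * ee f' = (ψ f f' : k) • ee (f * f') := by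
    intro f f'
    have := RingQuot.mkAlgHom_rel k (ARel.e_mul (k := k) (g := g) (χ := χ) (N := N) (ψ := ψ)
      (ξ := ξ) (α := α) f f')
    simpa [e] using this
  have r3 : ∀ f i, ee f * vv i = (χ i f : k) • (vv i * ee f) := by
    intro f i
    have := RingQuot.mkAlgHom_rel k (ARel.e_v (k := k) (g := g) (χ := χ) (N := N) (ψ := ψ)
      (ξ := ξ) (α := α) f i)
    simpa [e, v] using this
  have r4 : ∀ i j, i < j → vv i * vv j - (χ j (g i) : k) • (vv j * vv i) =
      α i j • ee (g i * g j) := by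
    intro i j hij
    have := RingQuot.mkAlgHom_rel k (ARel.v_comm (k := k) (g := g) (χ := χ) (N := N) (ψ := ψ)
      (ξ := ξ) (α := α) i j hij)
    simpa [e, v] using this
  have r5 : ∀ i, vv i ^ N i = ξ i • ee (g i ^ N i) := by
    intro i
    have := RingQuot.mkAlgHom_rel k (ARel.v_pow (k := k) (g := g) (χ := χ) (N := N) (ψ := ψ)
      (ξ := ξ) (α := α) i)
    simpa [e, v] using this
  -- units
  have hu : ∀ f, IsUnit (ee f) := by
    intro f
    have a1 : ee f * ((((ψ f f⁻¹)⁻¹ : kˣ) : k) • ee f⁻¹) = 1 := by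
      rw [mul_smul_comm, r2, smul_smul, mul_inv_cancel, r1]; simp
    have a2 : ((((ψ f⁻¹ f)⁻¹ : kˣ) : k) • ee f⁻¹) * ee f = 1 := by
      rw [smul_mul_assoc, r2, smul_smul, inv_mul_cancel, r1]; simp
    exact isUnit_iff_exists_and_exists.mpr ⟨⟨_, a1⟩, ⟨_, a2⟩⟩
  choose E hE using hu
  have E2 : ∀ f f', ((E f * E f' : (Aa)ˣ) : Aa) = (ψ f f' : k) • (E (f * f') : Aa) := by
    intro f f'
    rw [Units.val_mul, hE, hE, hE, r2]
  have EP : ∀ f (n : ℕ), ∃ c : kˣ, ((E f ^ n : (Aa)ˣ) : Aa) = (c : k) • (E (f ^ n) : Aa) := by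
    intro f n
    induction n with
    | zero => exact ⟨1, by simp [hE, r1]⟩
    | succ n ih =>
      obtain ⟨c, hc⟩ := ih
      refine ⟨c * ψ (f ^ n) f, ?_⟩
      rw [pow_succ, Units.val_mul, hc, smul_mul_assoc, ← Units.val_mul, E2, smul_smul, pow_succ,
        Units.val_mul]
  have hprim : ∀ i, IsPrimitiveRoot ((χ i (g i) : kˣ) : k) (N i) := by
    intro i
    rw [IsPrimitiveRoot.coe_units_iff, hN i]
    exact IsPrimitiveRoot.orderOf _
  have hq2 : ∀ i j, i ≠ j → ((χ j (g i) : kˣ) : k) * ((χ i (g j) : kˣ) : k) = 1 := by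
    intro i j hij
    rw [← Units.val_mul, hcompat j i hij.symm, Units.val_one]
  -- the translation map
  let t0 : Fin θ ⊕ Γ → Aa ⊗[k] (Aa)ᵐᵒᵖ := Sum.elim
    (fun i => (vv i ⊗ₜ 1) - (1 ⊗ₜ MulOpposite.op (vv i)) * TT k (E (g i))) (fun f => TT k (E f))
  have hcm : ∀ i j, i < j → t0 (Sum.inl i) * t0 (Sum.inl j) =
      (χ j (g i) : k) • (t0 (Sum.inl j) * t0 (Sum.inl i)) := by
    intro i j hij
    exact tau_comm (E (g i)) (E (g j)) (E (g i * g j)) (vv i) (vv j) _ (χ i (g j) : k) (α i j)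
      (ψ (g i) (g j)) (ψ (g j) (g i)) (by rw [hE, r3]) (by rw [hE, r3]) (hq2 i j hij.ne)
      (E2 _ _) (by rw [E2, mul_comm (g j)]) (by rw [hE, r4 i j hij])
  have hrel : ∀ ⦃x y⦄, URel k Γ θ g χ N x y →
      FreeAlgebra.lift k t0 x = FreeAlgebra.lift k t0 y := by
    intro x y h
    cases h with
    | group_one =>
      have : E 1 = 1 := Units.ext (by rw [hE, r1, Units.val_one])
      simp [t0, this, TT_one]
    | group_mul h h' =>
      simp only [map_mul, FreeAlgebra.lift_ι_apply, t0, Sum.elim_inr]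
      rw [TT_mul, TT_smul _ _ _ (E2 h h')]
    | group_comm h i =>
      have b1 := TT_left (K := k) (E h) (vv i) (χ i h : k) (by rw [hE, r3])
      have b2 := TT_right (K := k) (E h) (vv i) (χ i h : k) (by rw [hE, r3])
      have b3 : TT k (E h) * TT k (E (g i)) = TT k (E (g i)) * TT k (E h) := by
        rw [TT_mul, TT_mul, TT_smul _ _ _ (E2 _ _), TT_smul _ _ _ (E2 _ _), mul_comm h]
      simp only [map_mul, map_smul, FreeAlgebra.lift_ι_apply, t0, Sum.elim_inr, Sum.elim_inl]
      exact gcomm_gen _ _ _ _ _ b1 b2 b3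
    | nilpotent i =>
      obtain ⟨c, hc⟩ := EP (g i) (N i)
      simp only [map_pow, FreeAlgebra.lift_ι_apply, t0, Sum.elim_inl, map_zero]
      exact tau_pow (E (g i)) (E (g i ^ N i)) (vv i) _ (ξ i) (N i) c
        (by have := hN1 i; omega) (hprim i) (by rw [hE, r3]) hc (by rw [hE, r5])
    | qcomm i j hij =>
      simp only [map_mul, map_smul, FreeAlgebra.lift_ι_apply]
      rcases lt_or_gt_of_ne hij with h | h
      · exact hcm i j h
      · rw [hcm j i h, smul_smul, hq2 i j hij, one_smul]
  let τ : Uu →ₐ[k] Aa ⊗[k] (Aa)ᵐᵒᵖ :=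
    RingQuot.liftAlgHom k ⟨FreeAlgebra.lift k t0, hrel⟩
  refine main_gen lam τ E vv g Gg Xx ?_ ?_ ?_ hlamv ?_ ?_
  · intro p h1 h2 h3 h4 h5 x
    obtain ⟨x, rfl⟩ := RingQuot.mkAlgHom_surjective k (ARel k Γ θ g χ N ψ ξ α) x
    induction x using FreeAlgebra.induction with
    | grade0 r => rw [AlgHom.commutes]; exact h1 r
    | grade1 y =>
      cases y with
      | inl i => exact h5 i
      | inr f => have := h4 f; rw [hE] at this; exact this
    | mul a b ha hb => rw [map_mul]; exact h3 _ _ ha hb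
    | add a b ha hb => rw [map_add]; exact h2 _ _ ha hb
  · intro p h1 h2 h3 h4 h5 x
    obtain ⟨x, rfl⟩ := RingQuot.mkAlgHom_surjective k (URel k Γ θ g χ N) x
    induction x using FreeAlgebra.induction with
    | grade0 r => rw [AlgHom.commutes]; exact h1 r
    | grade1 y =>
      cases y with
      | inl i => exact h5 i
      | inr f => exact h4 f
    | mul a b ha hb => rw [map_mul]; exact h3 _ _ ha hb
    | add a b ha hb => rw [map_add]; exact h2 _ _ ha hb
  · intro f
    rw [hE, hlame]
  · intro f
    simp only [τ, G, RingQuot.liftAlgHom_mkAlgHom_apply, FreeAlgebra.lift_ι_apply]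
    rfl
  · intro i
    simp only [τ, X, RingQuot.liftAlgHom_mkAlgHom_apply, FreeAlgebra.lift_ι_apply]
    rfl

end QLSGalois

end
end
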